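/- Let p be a trigonometric polynomial with ∫_0^1 p(x) dx = 0, and let (N_k)_{k≥1} be the increasing enumeration of all numbers that can be written in the form Σ_{i=1}^M (i⁴ + i) for some positive integer M. Then for almost all x ∈ [A,B]: limsup_{k→∞} |Σ_{n=1}^{N_k} p(ξ x^{s_n})| / √(N_k log log N_k) = √2 · ‖p‖. -/

import Mathlib

open MeasureTheory Filter

/-- The `L²` norm of `f` over `[A,B]`. -/
noncomputable def fnorm (A B : ℝ) (f : ℝ → ℝ) : ℝ :=
  Real.sqrt (∫ x in A..B, (f x) ^ 2)

/-- The natural logarithm, interpreted as `max {1, log x}`. -/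
noncomputable def plog (x : ℝ) : ℝ := max 1 (Real.log x)

/-- The `k`-th element (for `k ≥ 1`) of the increasing enumeration of all numbers of
the form `∑_{i=1}^M (i⁴ + i)`. -/
def Nk (k : ℕ) : ℕ := ∑ i ∈ Finset.Icc 1 k, (i ^ 4 + i)

noncomputable def ee (t : ℝ) : ℂ := Complex.exp (((2 * Real.pi * t : ℝ) : ℂ) * Complex.I)

lemma ee_norm (t : ℝ) : ‖ee t‖ = 1 := Complex.norm_exp_ofReal_mul_I _

lemma ee_add (s t : ℝ) : ee (s + t) = ee s * ee t := by
  unfold ee; rw [← Complex.exp_add]; congr 1; push_cast; ring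

lemma ee_zero : ee 0 = 1 := by simp [ee]

lemma ee_cont : Continuous ee := by unfold ee; fun_prop

lemma ee_deriv {f : ℝ → ℝ} {f1 x : ℝ} (h : HasDerivAt f f1 x) :
    HasDerivAt (fun x => ee (f x)) (ee (f x) * (((2 * Real.pi * f1 : ℝ) : ℂ) * Complex.I)) x := by
  unfold ee
  exact (((h.const_mul (2 * Real.pi)).ofReal_comp).mul_const Complex.I).cexp

lemma osc (u v : ℝ) (huv : u ≤ v) (f f1 f2 g1 g2 : ℝ → ℝ) (c D : ℝ) (hc : 0 < c)
    (hf : ∀ x, HasDerivAt f (f1 x) x) (hf1 : ∀ x, HasDerivAt f1 (f2 x) x) (hf2 : Continuous f2)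
    (hg1 : ∀ x, HasDerivAt g1 (g2 x) x) (hg2 : Continuous g2)
    (hpos : ∀ x ∈ Set.Icc u v, 0 < g1 x) (hnn : ∀ x ∈ Set.Icc u v, 0 ≤ g2 x)
    (hlow : ∀ x ∈ Set.Icc u v, c * g1 x ≤ |f1 x|)
    (hup : ∀ x ∈ Set.Icc u v, |f2 x| ≤ D * g2 x) (hD : 0 ≤ D) :
    ‖∫ x in u..v, ee (f x)‖ ≤ (2 / c + D / c ^ 2) / g1 u := by
  have hfc : Continuous f := continuous_iff_continuousAt.2 fun x => (hf x).continuousAt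
  have hf1c : Continuous f1 := continuous_iff_continuousAt.2 fun x => (hf1 x).continuousAt
  have hg1c : Continuous g1 := continuous_iff_continuousAt.2 fun x => (hg1 x).continuousAt
  have hu : u ∈ Set.Icc u v := Set.left_mem_Icc.2 huv
  have hv : v ∈ Set.Icc u v := Set.right_mem_Icc.2 huv
  have hne : ∀ x ∈ Set.Icc u v, f1 x ≠ 0 := by
    intro x hx h0
    have := hlow x hx
    rw [h0, abs_zero] at this
    have := mul_pos hc (hpos x hx)
    linarith
  have hpi : (1:ℝ) ≤ 2 * Real.pi := by have := Real.pi_gt_three; linarith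
  have hpine : ((2 * Real.pi : ℝ) : ℂ) ≠ 0 := by
    norm_cast; linarith
  set F : ℝ → ℂ := fun x => ee (f x) * (((2 * Real.pi * f1 x : ℝ) : ℂ) * Complex.I)⁻¹ with hF
  have hFd : ∀ x ∈ Set.Icc u v, HasDerivAt F
      (ee (f x) - ee (f x) * (((f2 x / (2 * Real.pi * f1 x ^ 2) : ℝ) : ℂ) * Complex.I⁻¹)) x := by
    intro x hx
    have h1 := ee_deriv (hf x)
    have h2 : HasDerivAt (fun x => (((2 * Real.pi * f1 x : ℝ) : ℂ) * Complex.I))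
      (((2 * Real.pi * f2 x : ℝ) : ℂ) * Complex.I) x :=
      (((hf1 x).const_mul (2 * Real.pi)).ofReal_comp).mul_const Complex.I
    have hne' : (((2 * Real.pi * f1 x : ℝ) : ℂ) * Complex.I) ≠ 0 := by
      refine mul_ne_zero ?_ Complex.I_ne_zero
      norm_cast
      exact mul_ne_zero (by linarith) (hne x hx)
    have h3 := h1.mul (h2.fun_inv hne')
    refine h3.congr_deriv ?_
    have hI := Complex.I_ne_zero
    have hfx : (f1 x : ℂ) ≠ 0 := by exact_mod_cast hne x hx
    have hpp : (Real.pi : ℂ) ≠ 0 := by exact_mod_cast Real.pi_ne_zero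
    push_cast
    field_simp
    ring
  have hcE : Continuous (fun x => ee (f x)) := ee_cont.comp hfc
  have hcF : ContinuousOn (fun x => f2 x / (2 * Real.pi * f1 x ^ 2)) (Set.uIcc u v) := by
    rw [Set.uIcc_of_le huv]
    refine hf2.continuousOn.div (by fun_prop) ?_
    intro x hx
    exact mul_ne_zero (by linarith) (pow_ne_zero _ (hne x hx))
  have hc2 : ContinuousOn (fun x => ee (f x) * (((f2 x / (2 * Real.pi * f1 x ^ 2) : ℝ) : ℂ) * Complex.I⁻¹))
      (Set.uIcc u v) :=
    hcE.continuousOn.mul ((Complex.continuous_ofReal.comp_continuousOn hcF).mul continuousOn_const)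
  have hI1 : IntervalIntegrable (fun x => ee (f x)) volume u v := hcE.intervalIntegrable _ _
  have hI2 := hc2.intervalIntegrable (μ := volume)
  have key := intervalIntegral.integral_eq_sub_of_hasDerivAt (f := F) (a := u) (b := v)
    (f' := fun x => (ee (f x) - ee (f x) * (((f2 x / (2 * Real.pi * f1 x ^ 2) : ℝ) : ℂ) * Complex.I⁻¹)))
    (by rw [Set.uIcc_of_le huv]; exact hFd) (hI1.sub hI2)
  rw [intervalIntegral.integral_sub hI1 hI2] at key
  have hmono : ∀ x ∈ Set.Icc u v, g1 u ≤ g1 x := by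
    have : MonotoneOn g1 (Set.Icc u v) := by
      apply monotoneOn_of_deriv_nonneg (convex_Icc u v) hg1c.continuousOn
      · intro x _; exact (hg1 x).differentiableAt.differentiableWithinAt
      · intro x hx; rw [(hg1 x).deriv]; exact hnn x (interior_subset hx)
    intro x hx; exact this hu hx hx.1
  have hFb : ∀ x ∈ Set.Icc u v, ‖F x‖ ≤ 1 / (c * g1 u) := by
    intro x hx
    rw [hF]
    simp only [norm_mul, ee_norm, norm_inv, Complex.norm_real, Complex.norm_I, mul_one, one_mul,
      Real.norm_eq_abs]
    rw [← one_div]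
    apply one_div_le_one_div_of_le (mul_pos hc (hpos u hu))
    calc c * g1 u ≤ c * g1 x := by gcongr; exact hmono x hx
      _ ≤ |f1 x| := hlow x hx
      _ ≤ |2 * Real.pi * f1 x| := by
        rw [abs_mul, abs_of_pos (by linarith : 0 < 2 * Real.pi)]
        nlinarith [abs_nonneg (f1 x)]
      _ ≤ |2| * |Real.pi| * |f1 x| := by rw [abs_mul, abs_mul]
  have h3 : ‖∫ x in u..v, ee (f x) * (((f2 x / (2 * Real.pi * f1 x ^ 2) : ℝ) : ℂ) * Complex.I⁻¹)‖
      ≤ ∫ x in u..v, (D / c ^ 2) * (g2 x / g1 x ^ 2) := by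
    apply intervalIntegral.norm_integral_le_of_norm_le huv
    · refine Eventually.of_forall ?_
      intro x hx
      have hx' : x ∈ Set.Icc u v := ⟨hx.1.le, hx.2⟩
      simp only [norm_mul, ee_norm, norm_inv, Complex.norm_real, Complex.norm_I, mul_one, one_mul,
        Real.norm_eq_abs, inv_one]
      rw [abs_div, div_mul_div_comm]
      have hp := hpos x hx'
      apply div_le_div₀ (mul_nonneg hD (hnn x hx')) (hup x hx') (by positivity)
      rw [abs_mul, abs_of_pos (by linarith : 0 < 2 * Real.pi), ← mul_pow, abs_pow]
      have h1 := pow_le_pow_left₀ (by positivity) (hlow x hx') 2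
      nlinarith [sq_nonneg (|f1 x|)]
    · apply ContinuousOn.intervalIntegrable
      rw [Set.uIcc_of_le huv]
      refine continuousOn_const.mul (hg2.continuousOn.div (by fun_prop) ?_)
      intro x hx
      exact pow_ne_zero _ (hpos x hx).ne'
  have h4 : ∫ x in u..v, (D / c ^ 2) * (g2 x / g1 x ^ 2) = (D / c ^ 2) * (1 / g1 u - 1 / g1 v) := by
    rw [intervalIntegral.integral_const_mul]
    congr 1
    have := intervalIntegral.integral_eq_sub_of_hasDerivAt (f := fun x => - (g1 x)⁻¹) (a := u) (b := v)
      (f' := fun x => g2 x / g1 x ^ 2) ?_ ?_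
    · rw [this]; ring
    · rw [Set.uIcc_of_le huv]
      intro x hx
      refine ((hg1 x).fun_inv (hpos x hx).ne').neg.congr_deriv ?_
      ring
    · apply ContinuousOn.intervalIntegrable
      rw [Set.uIcc_of_le huv]
      refine (hg2.continuousOn.div (by fun_prop) ?_)
      intro x hx
      exact pow_ne_zero _ (hpos x hx).ne'
  have h5 : (D / c ^ 2) * (1 / g1 u - 1 / g1 v) ≤ (D / c ^ 2) * (1 / g1 u) := by
    have : 0 ≤ 1 / g1 v := by have := hpos v hv; positivity
    have : 0 ≤ D / c ^ 2 := by positivity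
    apply mul_le_mul_of_nonneg_left _ this
    linarith
  have h6 : ∫ x in u..v, ee (f x) = F v - F u +
      ∫ x in u..v, ee (f x) * (((f2 x / (2 * Real.pi * f1 x ^ 2) : ℝ) : ℂ) * Complex.I⁻¹) := by
    rw [← key]; ring
  rw [h6]
  calc _ ≤ ‖F v‖ + ‖F u‖ + (D / c ^ 2) * (1 / g1 u) := by
        refine (norm_add_le _ _).trans (add_le_add (norm_sub_le _ _) ?_)
        linarith
    _ ≤ 1 / (c * g1 u) + 1 / (c * g1 u) + (D / c ^ 2) * (1 / g1 u) := by
        gcongr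
        · exact hFb v hv
        · exact hFb u hu
    _ = _ := by
        have := (hpos u hu).ne'
        field_simp
        ring

structure PhD (h h1 h2 : ℝ → ℝ) : Prop where
  d1 : ∀ x, HasDerivAt h (h1 x) x
  d2 : ∀ x, HasDerivAt h1 (h2 x) x
  ct : Continuous h2

lemma PhD.add {h h1 h2 k k1 k2 : ℝ → ℝ} (H : PhD h h1 h2) (K : PhD k k1 k2) :
    PhD (fun x => h x + k x) (fun x => h1 x + k1 x) (fun x => h2 x + k2 x) :=
  ⟨fun x => (H.d1 x).add (K.d1 x), fun x => (H.d2 x).add (K.d2 x), H.ct.add K.ct⟩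

lemma PhD.smul {h h1 h2 : ℝ → ℝ} (H : PhD h h1 h2) (r : ℝ) :
    PhD (fun x => r * h x) (fun x => r * h1 x) (fun x => r * h2 x) :=
  ⟨fun x => (H.d1 x).const_mul r, fun x => (H.d2 x).const_mul r, continuous_const.mul H.ct⟩

lemma PhD.cont {h h1 h2 : ℝ → ℝ} (H : PhD h h1 h2) : Continuous h :=
  continuous_iff_continuousAt.2 fun x => (H.d1 x).continuousAt

structure Sys (φ φ1 φ2 : ℕ → ℝ → ℝ) (α β κ c : ℝ) (n0 d : ℕ) : Prop where
  hab : α < β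
  hk : 1 < κ
  hc : 0 < c
  hc1 : c ≤ 1
  ph : ∀ n, PhD (φ n) (φ1 n) (φ2 n)
  pos1 : ∀ n, n0 ≤ n → ∀ x ∈ Set.Icc α β, 0 < φ1 n x
  nn2 : ∀ n, n0 ≤ n → ∀ x ∈ Set.Icc α β, 0 ≤ φ2 n x
  gr1 : ∀ n, n0 ≤ n → ∀ x ∈ Set.Icc α β, κ * φ1 n x ≤ φ1 (n + 1) x
  gr2 : ∀ n, n0 ≤ n → ∀ x ∈ Set.Icc α β, κ * φ2 n x ≤ φ2 (n + 1) x
  sep : ∀ m n, n0 ≤ m → m < n → ∀ i j : ℤ, i ≠ 0 → j ≠ 0 → |i| ≤ d → |j| ≤ d →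
    ∀ x ∈ Set.Icc α β, c * φ1 n x ≤ |i * φ1 n x + j * φ1 m x|
  bis : ∀ K : ℝ, 0 < K → ∃ n1 : ℕ, ∀ n, n1 ≤ n → ∀ u v, α ≤ u → u < v → v ≤ β →
    6 * K < φ1 n v * (v - u) → 2 * K ≤ φ1 n u * (v - u)

section
variable {φ φ1 φ2 : ℕ → ℝ → ℝ} {α β κ c : ℝ} {n0 d : ℕ}

lemma Sys.grow1 (S : Sys φ φ1 φ2 α β κ c n0 d) {n : ℕ} (hn : n0 ≤ n) (k : ℕ) {x : ℝ}
    (hx : x ∈ Set.Icc α β) : κ ^ k * φ1 n x ≤ φ1 (n + k) x := by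
  induction k with
  | zero => simp
  | succ k ih =>
    have := S.gr1 (n + k) (by omega) x hx
    have hk := S.hk
    calc κ ^ (k + 1) * φ1 n x = κ * (κ ^ k * φ1 n x) := by ring
      _ ≤ κ * φ1 (n + k) x := by gcongr
      _ ≤ _ := this

lemma Sys.grow2 (S : Sys φ φ1 φ2 α β κ c n0 d) {n : ℕ} (hn : n0 ≤ n) (k : ℕ) {x : ℝ}
    (hx : x ∈ Set.Icc α β) : κ ^ k * φ2 n x ≤ φ2 (n + k) x := by
  induction k with
  | zero => simp
  | succ k ih =>
    have := S.gr2 (n + k) (by omega) x hx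
    have hk := S.hk
    calc κ ^ (k + 1) * φ2 n x = κ * (κ ^ k * φ2 n x) := by ring
      _ ≤ κ * φ2 (n + k) x := by gcongr
      _ ≤ _ := this

lemma Sys.mono1 (S : Sys φ φ1 φ2 α β κ c n0 d) {m n : ℕ} (hn : n0 ≤ m) (hmn : m ≤ n) {x : ℝ}
    (hx : x ∈ Set.Icc α β) : φ1 m x ≤ φ1 n x := by
  obtain ⟨k, rfl⟩ := Nat.exists_eq_add_of_le hmn
  have h1 := S.grow1 hn k hx
  have h2 := S.pos1 m hn x hx
  have h3 : 1 ≤ κ ^ k := one_le_pow₀ S.hk.le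
  nlinarith

lemma Sys.mono2 (S : Sys φ φ1 φ2 α β κ c n0 d) {m n : ℕ} (hn : n0 ≤ m) (hmn : m ≤ n) {x : ℝ}
    (hx : x ∈ Set.Icc α β) : φ2 m x ≤ φ2 n x := by
  obtain ⟨k, rfl⟩ := Nat.exists_eq_add_of_le hmn
  have h1 := S.grow2 hn k hx
  have h2 := S.nn2 m hn x hx
  have h3 : 1 ≤ κ ^ k := one_le_pow₀ S.hk.le
  nlinarith

end

/-- low frequency trigonometric polynomials -/
def TP (α β C : ℝ) (g1 g2 : ℝ → ℝ) (K : ℝ) (H : ℝ → ℂ) : Prop :=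
  ∃ (ι : Type) (_ : Fintype ι) (a : ι → ℂ) (h h1 h2 : ι → ℝ → ℝ),
    (∀ i, PhD (h i) (h1 i) (h2 i)) ∧
    (∀ i, ∀ x ∈ Set.Icc α β, |h1 i x| ≤ C * g1 x ∧ |h2 i x| ≤ C * g2 x) ∧
    (∀ x, H x = ∑ i, a i * ee (h i x)) ∧ ∑ i, ‖a i‖ ≤ K

/-- oscillating trigonometric polynomials of a block -/
def OP (φ1 φ2 : ℕ → ℝ → ℝ) (α β c : ℝ) (d : ℕ) (B : Finset ℕ) (K : ℝ) (V : ℝ → ℂ) : Prop :=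
  ∃ (ι : Type) (_ : Fintype ι) (a : ι → ℂ) (h h1 h2 : ι → ℝ → ℝ) (n : ι → ℕ),
    (∀ i, PhD (h i) (h1 i) (h2 i)) ∧ (∀ i, n i ∈ B) ∧
    (∀ i, ∀ x ∈ Set.Icc α β, c * φ1 (n i) x ≤ |h1 i x| ∧ |h1 i x| ≤ 2 * d * φ1 (n i) x ∧
      |h2 i x| ≤ 2 * d * φ2 (n i) x) ∧
    (∀ x, V x = ∑ i, a i * ee (h i x)) ∧ ∑ i, ‖a i‖ ≤ K

lemma TP.cont {α β C : ℝ} {g1 g2 : ℝ → ℝ} {K : ℝ} {H : ℝ → ℂ} (h : TP α β C g1 g2 K H) :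
    Continuous H := by
  obtain ⟨ι, _, a, h, h1, h2, hp, -, hH, -⟩ := h
  have : H = fun x => ∑ i, a i * ee (h i x) := funext hH
  rw [this]
  refine continuous_finsetSum _ fun i _ => continuous_const.mul (ee_cont.comp (hp i).cont)

section
variable {φ φ1 φ2 : ℕ → ℝ → ℝ} {α β κ c : ℝ} {n0 d : ℕ}

lemma OP.cont {B : Finset ℕ} {K : ℝ} {V : ℝ → ℂ} (h : OP φ1 φ2 α β c d B K V) :
    Continuous V := by
  obtain ⟨ι, _, a, h, h1, h2, n, hp, -, -, hH, -⟩ := h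
  have : V = fun x => ∑ i, a i * ee (h i x) := funext hH
  rw [this]
  refine continuous_finsetSum _ fun i _ => continuous_const.mul (ee_cont.comp (hp i).cont)

lemma OP.add {B : Finset ℕ} {K K' : ℝ} {V V' : ℝ → ℂ} (h : OP φ1 φ2 α β c d B K V)
    (h' : OP φ1 φ2 α β c d B K' V') : OP φ1 φ2 α β c d B (K + K') (fun x => V x + V' x) := by
  obtain ⟨ι, _, a, h, h1, h2, n, q1, q2, q3, q4, q5⟩ := h
  obtain ⟨ι', _, a', h', h1', h2', n', q1', q2', q3', q4', q5'⟩ := h'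
  refine ⟨ι ⊕ ι', inferInstance, Sum.elim a a', Sum.elim h h', Sum.elim h1 h1', Sum.elim h2 h2',
    Sum.elim n n', ?_, ?_, ?_, ?_, ?_⟩
  · rintro (i | i)
    · exact q1 i
    · exact q1' i
  · rintro (i | i)
    · exact q2 i
    · exact q2' i
  · rintro (i | i)
    · exact q3 i
    · exact q3' i
  · intro x; simp [q4, q4']
  · simp; linarith

lemma OP.smul {B : Finset ℕ} {K : ℝ} {V : ℝ → ℂ} (h : OP φ1 φ2 α β c d B K V) (r : ℂ) :
    OP φ1 φ2 α β c d B (‖r‖ * K) (fun x => r * V x) := by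
  obtain ⟨ι, _, a, h, h1, h2, n, q1, q2, q3, q4, q5⟩ := h
  refine ⟨ι, inferInstance, fun i => r * a i, h, h1, h2, n, q1, q2, q3, ?_, ?_⟩
  · intro x; beta_reduce; rw [q4, Finset.mul_sum]; simp [mul_assoc]
  · simp only [norm_mul]; rw [← Finset.mul_sum]; gcongr

lemma TP.mul_OP (S : Sys φ φ1 φ2 α β κ c n0 d) {t t' g : ℕ} {B : Finset ℕ} {K K' : ℝ}
    {H V : ℝ → ℂ} (m : ℝ) (ht : n0 ≤ t) (htt : t ≤ t') (hB : ∀ n ∈ B, t ≤ n ∧ n + g ≤ t')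
    (hg : (2 * d + 1) ≤ κ ^ g * (c / 2))
    (hK : 0 ≤ K)
    (hH : TP α β (c / 2) (φ1 t) (φ2 t) K H) (hV : OP φ1 φ2 α β c d B K' V) :
    TP α β (c / 2) (φ1 t') (φ2 t') (K * (|m| + K')) (fun x => H x * (m + V x)) := by
  obtain ⟨ι, _, a, h, h1, h2, q1, q3, q4, q5⟩ := hH
  obtain ⟨ι', _, a', h', h1', h2', n', q1', q2', q3', q4', q5'⟩ := hV
  have hc := S.hc
  have hc1 := S.hc1
  refine ⟨ι × Option ι', inferInstance,
    fun p => a p.1 * (p.2.elim (m : ℂ) a'),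
    fun p => p.2.elim (h p.1) (fun j x => h p.1 x + h' j x),
    fun p => p.2.elim (h1 p.1) (fun j x => h1 p.1 x + h1' j x),
    fun p => p.2.elim (h2 p.1) (fun j x => h2 p.1 x + h2' j x), ?_, ?_, ?_, ?_⟩
  · rintro ⟨i, (_ | j)⟩
    · exact q1 i
    · exact (q1 i).add (q1' j)
  · rintro ⟨i, (_ | j)⟩ x hx
    · obtain ⟨b1, b2⟩ := q3 i x hx
      have e1 := S.mono1 ht htt hx
      have e2 := S.mono2 ht htt hx
      exact ⟨b1.trans (by gcongr), b2.trans (by gcongr)⟩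
    · obtain ⟨b1, b2⟩ := q3 i x hx
      obtain ⟨-, b1', b2'⟩ := q3' j x hx
      obtain ⟨w1, w2⟩ := hB _ (q2' j)
      have hn : n0 ≤ n' j := ht.trans w1
      have e1 := S.mono1 ht w1 hx
      have e2 := S.mono2 ht w1 hx
      have f1 := (S.grow1 hn g hx).trans (S.mono1 (by omega) w2 hx)
      have f2 := (S.grow2 hn g hx).trans (S.mono2 (by omega) w2 hx)
      have p1 := S.pos1 _ hn x hx
      have p2 := S.nn2 _ hn x hx
      have p1t := S.pos1 _ ht x hx
      have p2t := S.nn2 _ ht x hx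
      have ed : (0:ℝ) ≤ d := Nat.cast_nonneg d
      constructor
      · calc |h1 i x + h1' j x| ≤ |h1 i x| + |h1' j x| := abs_add_le _ _
          _ ≤ (c / 2) * φ1 (n' j) x + 2 * d * φ1 (n' j) x := by
            refine add_le_add (b1.trans ?_) b1'; gcongr
          _ ≤ (2 * d + 1) * φ1 (n' j) x := by nlinarith
          _ ≤ (κ ^ g * (c / 2)) * φ1 (n' j) x := by gcongr
          _ = (c / 2) * (κ ^ g * φ1 (n' j) x) := by ring
          _ ≤ _ := by gcongr
      · calc |h2 i x + h2' j x| ≤ |h2 i x| + |h2' j x| := abs_add_le _ _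
          _ ≤ (c / 2) * φ2 (n' j) x + 2 * d * φ2 (n' j) x := by
            refine add_le_add (b2.trans ?_) b2'; gcongr
          _ ≤ (2 * d + 1) * φ2 (n' j) x := by nlinarith
          _ ≤ (κ ^ g * (c / 2)) * φ2 (n' j) x := by gcongr
          _ = (c / 2) * (κ ^ g * φ2 (n' j) x) := by ring
          _ ≤ _ := by gcongr
  · intro x
    beta_reduce
    rw [Fintype.sum_prod_type, q4 x, Finset.sum_mul]
    refine Finset.sum_congr rfl fun i _ => ?_
    rw [Fintype.sum_option]
    simp only [Option.elim]
    rw [q4' x, mul_add, Finset.mul_sum]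
    congr 1
    · ring
    · refine Finset.sum_congr rfl fun j _ => ?_
      rw [ee_add]; ring
  · rw [Fintype.sum_prod_type]
    have : ∀ i, ∑ y : Option ι', ‖a i * (y.elim (m : ℂ) a')‖ = ‖a i‖ * (|m| + ∑ j, ‖a' j‖) := by
      intro i
      rw [Fintype.sum_option]
      simp [mul_add, Finset.mul_sum]
    simp only [this]
    rw [← Finset.sum_mul]
    gcongr

noncomputable def C0 (c : ℝ) (d : ℕ) : ℝ := 2 / (c / 2) + (2 * d + 1) / (c / 2) ^ 2

lemma TP.int_OP (S : Sys φ φ1 φ2 α β κ c n0 d) {t : ℕ} {B : Finset ℕ} {K K' : ℝ}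
    {H V : ℝ → ℂ} (ht : n0 ≤ t) (hB : ∀ n ∈ B, t ≤ n) (hK : 0 ≤ K)
    (hH : TP α β (c / 2) (φ1 t) (φ2 t) K H) (hV : OP φ1 φ2 α β c d B K' V)
    {u v : ℝ} (hu : α ≤ u) (huv : u ≤ v) (hv : v ≤ β) :
    ‖∫ x in u..v, H x * V x‖ ≤ K * K' * (C0 c d / φ1 t u) := by
  obtain ⟨ι, _, a, h, h1, h2, q1, q3, q4, q5⟩ := hH
  obtain ⟨ι', _, a', h', h1', h2', n', q1', q2', q3', q4', q5'⟩ := hV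
  have hc := S.hc
  have hc1 := S.hc1
  have hsub : ∀ x ∈ Set.Icc u v, x ∈ Set.Icc α β := fun x hx => ⟨hu.trans hx.1, hx.2.trans hv⟩
  have huu : u ∈ Set.Icc α β := ⟨hu, huv.trans hv⟩
  have hC : 0 ≤ C0 c d := by unfold C0; positivity
  have e : ∀ i j, ‖∫ x in u..v, ee (h i x + h' j x)‖ ≤ C0 c d / φ1 t u := by
    intro i j
    have w1 := hB _ (q2' j)
    have hn : n0 ≤ n' j := ht.trans w1
    have ed : (0:ℝ) ≤ d := Nat.cast_nonneg d
    have A := osc u v huv (fun x => h i x + h' j x) (fun x => h1 i x + h1' j x)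
      (fun x => h2 i x + h2' j x) (φ1 (n' j)) (φ2 (n' j)) (c / 2) (2 * d + 1) (by positivity)
      ((q1 i).add (q1' j)).d1 ((q1 i).add (q1' j)).d2 ((q1 i).add (q1' j)).ct
      (S.ph _).d2 (S.ph _).ct (fun x hx => S.pos1 _ hn x (hsub x hx))
      (fun x hx => S.nn2 _ hn x (hsub x hx)) ?_ ?_ (by positivity)
    · refine A.trans ?_
      exact div_le_div_of_nonneg_left hC (S.pos1 _ ht u huu) (S.mono1 ht w1 huu)
    · intro x hx
      have hx := hsub x hx
      obtain ⟨b1, b2⟩ := q3 i x hx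
      obtain ⟨b0', b1', b2'⟩ := q3' j x hx
      have e1 := S.mono1 ht w1 hx
      have : |h1' j x| ≤ |h1 i x + h1' j x| + |h1 i x| := by
        have := abs_sub (h1 i x + h1' j x) (h1 i x)
        simpa using this
      have : (c / 2) * φ1 t x ≤ (c / 2) * φ1 (n' j) x := by gcongr
      linarith
    · intro x hx
      have hx := hsub x hx
      obtain ⟨b1, b2⟩ := q3 i x hx
      obtain ⟨b0', b1', b2'⟩ := q3' j x hx
      have e1 := S.mono2 ht w1 hx
      have p2 := S.nn2 _ hn x hx
      have : (c / 2) * φ2 t x ≤ (c / 2) * φ2 (n' j) x := by gcongr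
      have := abs_add_le (h2 i x) (h2' j x)
      nlinarith
  have hint : ∀ i j, IntervalIntegrable (fun x => ee (h i x + h' j x)) volume u v := fun i j =>
    (ee_cont.comp ((q1 i).add (q1' j)).cont).intervalIntegrable _ _
  have eq : ∫ x in u..v, H x * V x = ∑ i, ∑ j, a i * a' j * ∫ x in u..v, ee (h i x + h' j x) := by
    have : ∀ x, H x * V x = ∑ i, ∑ j, a i * a' j * ee (h i x + h' j x) := by
      intro x
      rw [q4, q4', Finset.sum_mul_sum]
      refine Finset.sum_congr rfl fun i _ => Finset.sum_congr rfl fun j _ => ?_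
      rw [ee_add]; ring
    simp only [this]
    rw [intervalIntegral.integral_finsetSum]
    · refine Finset.sum_congr rfl fun i _ => ?_
      rw [intervalIntegral.integral_finsetSum]
      · refine Finset.sum_congr rfl fun j _ => ?_
        rw [intervalIntegral.integral_const_mul]
      · intro j _; exact (hint i j).const_mul _
    · intro i _
      apply Continuous.intervalIntegrable
      refine continuous_finsetSum _ fun j _ => continuous_const.mul (ee_cont.comp ((q1 i).add (q1' j)).cont)
  rw [eq]
  have hp : 0 ≤ C0 c d / φ1 t u := div_nonneg hC (S.pos1 _ ht u huu).le
  calc _ ≤ ∑ i, ∑ j, ‖a i‖ * ‖a' j‖ * (C0 c d / φ1 t u) := by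
        refine norm_sum_le_of_le _ fun i _ => norm_sum_le_of_le _ fun j _ => ?_
        rw [norm_mul, norm_mul]
        gcongr
        exact e i j
    _ = (∑ i, ‖a i‖) * (∑ j, ‖a' j‖) * (C0 c d / φ1 t u) := by
        rw [Finset.sum_mul_sum, Finset.sum_mul]
        refine Finset.sum_congr rfl fun i _ => ?_
        rw [Finset.sum_mul]
    _ ≤ _ := by gcongr

end

structure Pol (p : ℝ → ℝ) (F : Finset ℤ) (cf : ℤ → ℂ) (d : ℕ) (W σ2 Lp : ℝ) : Prop where
  rep : ∀ x, (p x : ℂ) = ∑ j ∈ F, cf j * ee (j * x)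
  hF : ∀ j ∈ F, j ≠ 0 ∧ |j| ≤ d ∧ -j ∈ F
  hW : ∑ j ∈ F, ‖cf j‖ ≤ W
  Wp : 0 < W
  hs : ∑ j ∈ F, cf j * cf (-j) = (σ2 : ℂ)
  s0 : 0 ≤ σ2
  sW : σ2 ≤ W ^ 2
  bd : ∀ x, |p x| ≤ W
  L0 : 0 ≤ Lp
  lip : ∀ x y, |p x - p y| ≤ Lp * |x - y|
  cont : Continuous p

noncomputable def Ub (p : ℝ → ℝ) (φ : ℕ → ℝ → ℝ) (B : Finset ℕ) (x : ℝ) : ℝ :=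
  ∑ n ∈ B, p (φ n x)

section
variable {φ φ1 φ2 : ℕ → ℝ → ℝ} {α β κ c : ℝ} {n0 d : ℕ}
variable {p : ℝ → ℝ} {F : Finset ℤ} {cf : ℤ → ℂ} {W σ2 Lp : ℝ}

lemma Ub_cont (S : Sys φ φ1 φ2 α β κ c n0 d) (P : Pol p F cf d W σ2 Lp) (B : Finset ℕ) :
    Continuous (Ub p φ B) := by
  unfold Ub
  exact continuous_finsetSum _ fun n _ => P.cont.comp (S.ph n).cont

lemma Ub_bd (P : Pol p F cf d W σ2 Lp) (B : Finset ℕ) (x : ℝ) :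
    |Ub p φ B x| ≤ W * B.card := by
  unfold Ub
  refine (Finset.abs_sum_le_sum_abs _ _).trans ?_
  refine (Finset.sum_le_card_nsmul _ _ W fun n _ => P.bd _).trans ?_
  rw [nsmul_eq_mul, mul_comm]

lemma Ub_rep (P : Pol p F cf d W σ2 Lp) (B : Finset ℕ) (x : ℝ) :
    (Ub p φ B x : ℂ) = ∑ q ∈ B ×ˢ F, cf q.2 * ee (q.2 * φ q.1 x) := by
  unfold Ub
  rw [Finset.sum_product]
  push_cast
  exact Finset.sum_congr rfl fun n _ => P.rep _

lemma sum_norm_prod (P : Pol p F cf d W σ2 Lp) (B : Finset ℕ) :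
    ∑ q ∈ B ×ˢ F, ‖cf q.2‖ ≤ W * B.card := by
  rw [Finset.sum_product]
  simp only [Finset.sum_const, nsmul_eq_mul]
  have := P.hW
  rw [mul_comm]
  gcongr

lemma int_abs_one {j : ℤ} (h : j ≠ 0) : (1:ℝ) ≤ |(j:ℝ)| := by
  have := Int.one_le_abs h
  exact_mod_cast this

lemma int_abs_le {j : ℤ} {d : ℕ} (h : |j| ≤ d) : |(j:ℝ)| ≤ d := by
  exact_mod_cast h

lemma OP_one (S : Sys φ φ1 φ2 α β κ c n0 d) (P : Pol p F cf d W σ2 Lp) (B : Finset ℕ)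
    (hB : ∀ n ∈ B, n0 ≤ n) :
    OP φ1 φ2 α β c d B (W * B.card) (fun x => (Ub p φ B x : ℂ)) := by
  refine ⟨↥(B ×ˢ F), inferInstance, fun q => cf q.1.2, fun q x => q.1.2 * φ q.1.1 x,
    fun q x => q.1.2 * φ1 q.1.1 x, fun q x => q.1.2 * φ2 q.1.1 x, fun q => q.1.1, ?_, ?_, ?_, ?_, ?_⟩
  · intro q; exact (S.ph _).smul _
  · rintro ⟨q, hq⟩; exact (Finset.mem_product.1 hq).1
  · rintro ⟨q, hq⟩ x hx
    obtain ⟨h1, h2⟩ := Finset.mem_product.1 hq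
    have p1 := S.pos1 _ (hB _ h1) x hx
    have p2 := S.nn2 _ (hB _ h1) x hx
    obtain ⟨f1, f2, -⟩ := P.hF _ h2
    have i1 := int_abs_one f1
    have i2 := int_abs_le f2
    have := S.hc1
    simp only [abs_mul, abs_of_pos p1, abs_of_nonneg p2]
    refine ⟨?_, ?_, ?_⟩
    · gcongr; linarith
    · gcongr; linarith
    · gcongr; linarith
  · intro x
    beta_reduce
    rw [Ub_rep P, ← Finset.sum_coe_sort]
  · rw [Finset.sum_coe_sort (B ×ˢ F) (fun q => ‖cf q.2‖)]
    exact sum_norm_prod P B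

lemma OP_two (S : Sys φ φ1 φ2 α β κ c n0 d) (P : Pol p F cf d W σ2 Lp) (B : Finset ℕ)
    (hB : ∀ n ∈ B, n0 ≤ n) :
    OP φ1 φ2 α β c d B (W * B.card * (W * B.card))
      (fun x => (Ub p φ B x : ℂ) ^ 2 - (B.card * σ2 : ℝ)) := by
  classical
  set T := ((B ×ˢ F) ×ˢ (B ×ˢ F)).filter (fun q => ¬ (q.2.1 = q.1.1 ∧ q.2.2 = - q.1.2)) with hT
  refine ⟨↥T, inferInstance, fun q => cf q.1.1.2 * cf q.1.2.2,
    fun q x => q.1.1.2 * φ q.1.1.1 x + q.1.2.2 * φ q.1.2.1 x,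
    fun q x => q.1.1.2 * φ1 q.1.1.1 x + q.1.2.2 * φ1 q.1.2.1 x,
    fun q x => q.1.1.2 * φ2 q.1.1.1 x + q.1.2.2 * φ2 q.1.2.1 x,
    fun q => max q.1.1.1 q.1.2.1, ?_, ?_, ?_, ?_, ?_⟩
  · intro q; exact ((S.ph _).smul _).add ((S.ph _).smul _)
  · rintro ⟨q, hq⟩
    simp only [hT, Finset.mem_filter, Finset.mem_product] at hq
    dsimp only
    rcases max_choice q.1.1 q.2.1 with h | h <;> rw [h]
    · exact hq.1.1.1
    · exact hq.1.2.1
  · rintro ⟨⟨⟨n, j⟩, ⟨m, k⟩⟩, hq⟩ x hx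
    simp only [hT, Finset.mem_filter, Finset.mem_product] at hq
    obtain ⟨⟨⟨hn, hj⟩, ⟨hm, hk⟩⟩, hne⟩ := hq
    dsimp only
    obtain ⟨fj1, fj2, -⟩ := P.hF _ hj
    obtain ⟨fk1, fk2, -⟩ := P.hF _ hk
    have j2 := int_abs_le fj2
    have k2 := int_abs_le fk2
    have hmax : n0 ≤ max n m := (hB _ hn).trans (le_max_left _ _)
    have a1 := S.mono1 (hB _ hn) (le_max_left n m) hx
    have a2 := S.mono1 (hB _ hm) (le_max_right n m) hx
    have b1 := S.mono2 (hB _ hn) (le_max_left n m) hx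
    have b2 := S.mono2 (hB _ hm) (le_max_right n m) hx
    have p1 := S.pos1 _ (hB _ hn) x hx
    have p2 := S.pos1 _ (hB _ hm) x hx
    have q1 := S.nn2 _ (hB _ hn) x hx
    have q2 := S.nn2 _ (hB _ hm) x hx
    have ed : (0:ℝ) ≤ d := Nat.cast_nonneg d
    refine ⟨?_, ?_, ?_⟩
    · rcases lt_trichotomy n m with h | h | h
      · rw [max_eq_right h.le, add_comm]
        exact S.sep n m (hB _ hn) h k j fk1 fj1 fk2 fj2 x hx
      · subst h
        rw [max_self, ← add_mul, abs_mul, abs_of_pos p1]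
        have hjk : j + k ≠ 0 := by
          intro h0; apply hne; exact ⟨rfl, by omega⟩
        have := int_abs_one hjk
        push_cast at this
        have := S.hc1
        gcongr; linarith
      · rw [max_eq_left h.le]
        exact S.sep m n (hB _ hm) h j k fj1 fk1 fj2 fk2 x hx
    · calc _ ≤ |(j:ℝ)| * φ1 n x + |(k:ℝ)| * φ1 m x := by
            refine (abs_add_le _ _).trans ?_
            rw [abs_mul, abs_mul, abs_of_pos p1, abs_of_pos p2]
        _ ≤ d * φ1 (max n m) x + d * φ1 (max n m) x := by gcongr
        _ = _ := by ring
    · calc _ ≤ |(j:ℝ)| * φ2 n x + |(k:ℝ)| * φ2 m x := by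
            refine (abs_add_le _ _).trans ?_
            rw [abs_mul, abs_mul, abs_of_nonneg q1, abs_of_nonneg q2]
        _ ≤ d * φ2 (max n m) x + d * φ2 (max n m) x := by gcongr
        _ = _ := by ring
  · intro x
    rw [Finset.sum_coe_sort T (fun q => cf q.1.2 * cf q.2.2 * ee (q.1.2 * φ q.1.1 x + q.2.2 * φ q.2.1 x))]
    have h1 : (Ub p φ B x : ℂ) ^ 2 = ∑ q ∈ (B ×ˢ F) ×ˢ (B ×ˢ F),
        cf q.1.2 * cf q.2.2 * ee (q.1.2 * φ q.1.1 x + q.2.2 * φ q.2.1 x) := by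
      rw [sq, Ub_rep P, Finset.sum_mul_sum, Finset.sum_product (s := B ×ˢ F) (t := B ×ˢ F)]
      refine Finset.sum_congr rfl fun i _ => Finset.sum_congr rfl fun j _ => ?_
      rw [ee_add]; ring
    have h2 : ∑ q ∈ ((B ×ˢ F) ×ˢ (B ×ˢ F)).filter (fun q => (q.2.1 = q.1.1 ∧ q.2.2 = - q.1.2)),
        cf q.1.2 * cf q.2.2 * ee (q.1.2 * φ q.1.1 x + q.2.2 * φ q.2.1 x) = (B.card * σ2 : ℝ) := by
      rw [Finset.sum_filter, Finset.sum_product (s := B ×ˢ F) (t := B ×ˢ F)]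
      have : ∀ i ∈ B ×ˢ F, ∑ q ∈ B ×ˢ F, (if (q.1 = i.1 ∧ q.2 = - i.2) then
          cf i.2 * cf q.2 * ee (i.2 * φ i.1 x + q.2 * φ q.1 x) else 0) = cf i.2 * cf (- i.2) := by
        rintro ⟨n, j⟩ hi
        obtain ⟨hn, hj⟩ := Finset.mem_product.1 hi
        rw [Finset.sum_eq_single (n, -j)]
        · simp [ee_zero]
        · rintro ⟨m, k⟩ _ hne
          rw [if_neg]
          rintro ⟨h1, h2⟩
          exact hne (by simp_all)
        · intro h
          exact absurd (Finset.mem_product.2 ⟨hn, (P.hF j hj).2.2⟩ : (n, -j) ∈ B ×ˢ F) h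
      rw [Finset.sum_congr rfl this, Finset.sum_product]
      simp only [P.hs, Finset.sum_const, nsmul_eq_mul]
      push_cast; rfl
    beta_reduce
    rw [h1, ← h2, ← Finset.sum_filter_add_sum_filter_not _ (fun q => (q.2.1 = q.1.1 ∧ q.2.2 = - q.1.2))]
    ring
  · rw [Finset.sum_coe_sort T (fun q => ‖cf q.1.2 * cf q.2.2‖)]
    have h0 : 0 ≤ W * (B.card : ℝ) := mul_nonneg P.Wp.le (Nat.cast_nonneg _)
    calc _ ≤ ∑ q ∈ (B ×ˢ F) ×ˢ (B ×ˢ F), ‖cf q.1.2 * cf q.2.2‖ := by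
          apply Finset.sum_le_sum_of_subset_of_nonneg (Finset.filter_subset _ _)
          intros; positivity
      _ = (∑ q ∈ B ×ˢ F, ‖cf q.2‖) * (∑ q ∈ B ×ˢ F, ‖cf q.2‖) := by
          rw [Finset.sum_mul_sum, Finset.sum_product (s := B ×ˢ F) (t := B ×ˢ F)]
          simp
      _ ≤ _ := by
          have := sum_norm_prod P B
          gcongr

/-- Riesz product integral. -/
lemma riesz (S : Sys φ φ1 φ2 α β κ c n0 d) (P : Pol p F cf d W σ2 Lp) {g : ℕ}
    (hg : (2 * d + 1) ≤ κ ^ g * (c / 2)) (hg4 : 4 ≤ κ ^ g)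
    (B : ℕ → Finset ℕ) (t : ℕ → ℕ) (ht0 : n0 ≤ t 0) (ht : ∀ i, t i + g ≤ t (i + 1))
    (hB : ∀ i, ∀ n ∈ B i, t i ≤ n ∧ n + g ≤ t (i + 1))
    (lam mu : ℝ) (hmu0 : 0 ≤ mu) (hmu : mu ≤ lam ^ 2)
    (hsm : ∀ i, |lam| * (W * (B i).card) ≤ 1 / 2)
    {u v : ℝ} (hu : α ≤ u) (huv : u ≤ v) (hv : v ≤ β) (k : ℕ) :
    |(∫ x in u..v, ∏ i ∈ Finset.range k, (1 + lam * Ub p φ (B i) x + mu * (Ub p φ (B i) x) ^ 2)) -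
      (v - u) * ∏ i ∈ Finset.range k, (1 + mu * ((B i).card * σ2))| ≤
    (∏ i ∈ Finset.range k, (1 + mu * ((B i).card * σ2))) * (2 * C0 c d / φ1 (t 0) u) := by
  have hc := S.hc
  have huu : u ∈ Set.Icc α β := ⟨hu, huv.trans hv⟩
  have htn : ∀ i, n0 ≤ t i := by
    intro i
    induction i with
    | zero => exact ht0
    | succ i ih => have := ht i; omega
  have htg : ∀ i, 4 ^ i * φ1 (t 0) u ≤ φ1 (t i) u := by
    intro i
    induction i with
    | zero => simp
    | succ i ih =>
      have h1 := S.grow1 (htn i) g huu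
      have h2 := S.mono1 (by have := htn i; omega) (ht i) huu
      have h3 := S.pos1 _ (htn i) u huu
      calc 4 ^ (i + 1) * φ1 (t 0) u = 4 * (4 ^ i * φ1 (t 0) u) := by ring
        _ ≤ 4 * φ1 (t i) u := by gcongr
        _ ≤ κ ^ g * φ1 (t i) u := by gcongr
        _ ≤ _ := h1.trans h2
  set m : ℕ → ℝ := fun i => 1 + mu * ((B i).card * σ2) with hm
  have hs0 := P.s0
  have hm1 : ∀ i, 1 ≤ m i := by
    intro i; simp only [hm]
    have : 0 ≤ mu * ((B i).card * σ2) := by positivity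
    linarith
  set V : ℕ → ℝ → ℂ := fun i x => (lam : ℂ) * (Ub p φ (B i) x : ℂ) +
    (mu : ℂ) * ((Ub p φ (B i) x : ℂ) ^ 2 - ((B i).card * σ2 : ℝ)) with hV
  set z : ℕ → ℝ := fun i => |lam| * (W * (B i).card) with hz
  have hz0 : ∀ i, 0 ≤ z i := by
    intro i; have := P.Wp; simp only [hz]; positivity
  have hmuz : ∀ i, mu * (W * (B i).card * (W * (B i).card)) ≤ z i ^ 2 := by
    intro i
    calc _ ≤ lam ^ 2 * (W * (B i).card * (W * (B i).card)) := by
          have := P.Wp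
          gcongr
      _ = _ := by simp only [hz]; rw [mul_pow, sq_abs]; ring
  have hOP : ∀ i, OP φ1 φ2 α β c d (B i) (z i + z i ^ 2) (V i) := by
    intro i
    have hBi : ∀ n ∈ B i, n0 ≤ n := fun n hn => (htn i).trans (hB i n hn).1
    have h1 := ((OP_one S P (B i) hBi).smul (lam : ℂ)).add ((OP_two S P (B i) hBi).smul (mu : ℂ))
    obtain ⟨ι, w, a, h, h1, h2, n, q1, q2, q3, q4, q5⟩ := h1
    refine ⟨ι, w, a, h, h1, h2, n, q1, q2, q3, q4, q5.trans ?_⟩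
    simp only [Complex.norm_real, Real.norm_eq_abs]
    rw [abs_of_nonneg hmu0]
    have := hmuz i
    simp only [hz] at this ⊢
    linarith
  have hmz : ∀ i, |m i| + (z i + z i ^ 2) ≤ 2 := by
    intro i
    rw [abs_of_nonneg (by linarith [hm1 i])]
    have h1 : mu * ((B i).card * σ2) ≤ z i ^ 2 := by
      refine le_trans ?_ (hmuz i)
      have : ((B i).card : ℝ) ≤ (B i).card * (B i).card := by
        rcases Nat.eq_zero_or_pos (B i).card with h | h
        · simp [h]
        · have : (1:ℝ) ≤ (B i).card := by exact_mod_cast h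
          nlinarith
      apply mul_le_mul_of_nonneg_left _ hmu0
      calc ((B i).card : ℝ) * σ2 ≤ ((B i).card * (B i).card) * W ^ 2 := by
            have := P.sW
            gcongr
        _ = _ := by ring
    have h2 := hsm i
    have h3 := hz0 i
    have h2' : z i ≤ 1 / 2 := h2
    simp only [hm]
    nlinarith
  set Q : ℕ → ℝ → ℂ := fun k x => ∏ i ∈ Finset.range k, ((m i : ℂ) + V i x) with hQ
  have hTP : ∀ k, TP α β (c / 2) (φ1 (t k)) (φ2 (t k)) (2 ^ k) (Q k) := by
    intro k
    induction k with
    | zero =>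
      refine ⟨Unit, inferInstance, fun _ => 1, fun _ _ => 0, fun _ _ => 0, fun _ _ => 0, ?_, ?_, ?_, ?_⟩
      · intro _
        exact ⟨fun x => hasDerivAt_const x 0, fun x => hasDerivAt_const x 0, continuous_const⟩
      · intro _ x hx
        have := S.pos1 _ ht0 x hx
        have := S.nn2 _ ht0 x hx
        simp only [abs_zero]
        constructor <;> positivity
      · intro x; simp [hQ, ee_zero]
      · simp
    | succ k ih =>
      have h1 := ih.mul_OP S (m k) (htn k) (by have := ht k; omega) (hB k) hg (by positivity) (hOP k)
      obtain ⟨ι, w, a, h, h1, h2, q1, q3, q4, q5⟩ := h1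
      refine ⟨ι, w, a, h, h1, h2, q1, q3, fun x => ?_, q5.trans ?_⟩
      · rw [← q4 x]; simp only [hQ, Finset.prod_range_succ]
      · rw [pow_succ]; exact mul_le_mul_of_nonneg_left (hmz k) (by positivity)
  have hM0 : ∀ k, 0 ≤ ∏ i ∈ Finset.range k, m i := fun k =>
    Finset.prod_nonneg fun i _ => by linarith [hm1 i]
  have hp0 := S.pos1 _ ht0 u huu
  have hC : 0 ≤ C0 c d := by unfold C0; positivity
  have main : ∀ k, ‖(∫ x in u..v, Q k x) - (((v - u) * ∏ i ∈ Finset.range k, m i : ℝ) : ℂ)‖ ≤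
      (∏ i ∈ Finset.range k, m i) * ((2 - 2 * (1 / 2) ^ k) * (C0 c d / φ1 (t 0) u)) := by
    intro k
    induction k with
    | zero => simp [hQ]
    | succ k ih =>
      have hb := (hTP k).int_OP S (htn k) (fun n hn => (hB k n hn).1) (by positivity) (hOP k) hu huv hv
      have e1 : ∫ x in u..v, Q (k + 1) x = (m k : ℂ) * (∫ x in u..v, Q k x) + ∫ x in u..v, Q k x * V k x := by
        have : ∀ x, Q (k + 1) x = (m k : ℂ) * Q k x + Q k x * V k x := by
          intro x; simp only [hQ, Finset.prod_range_succ]; ring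
        simp only [this]
        rw [intervalIntegral.integral_add, intervalIntegral.integral_const_mul]
        · exact (continuous_const.mul (hTP k).cont).intervalIntegrable _ _
        · exact ((hTP k).cont.mul (hOP k).cont).intervalIntegrable _ _
      have hb2 : ‖∫ x in u..v, Q k x * V k x‖ ≤ (1 / 2) ^ k * (C0 c d / φ1 (t 0) u) := by
        refine hb.trans ?_
        have h1 : z k + z k ^ 2 ≤ 1 := by have := hmz k; have := hm1 k; have := le_abs_self (m k); linarith
        calc 2 ^ k * (z k + z k ^ 2) * (C0 c d / φ1 (t k) u) ≤ 2 ^ k * 1 * (C0 c d / (4 ^ k * φ1 (t 0) u)) := by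
              have := htg k
              have := hz0 k
              have := S.pos1 _ (htn k) u huu
              gcongr
          _ = _ := by
              have : (4:ℝ) ^ k = 2 ^ k * 2 ^ k := by rw [← mul_pow]; norm_num
              rw [this, one_div, inv_pow]; field_simp
      have hMk : 1 ≤ ∏ i ∈ Finset.range (k + 1), m i := by
        calc (1:ℝ) = ∏ i ∈ Finset.range (k + 1), 1 := by simp
          _ ≤ _ := Finset.prod_le_prod (fun _ _ => by norm_num) fun i _ => hm1 i
      have hq : 0 ≤ C0 c d / φ1 (t 0) u := by positivity
      rw [e1]
      calc _ = ‖(m k : ℂ) * ((∫ x in u..v, Q k x) - (((v - u) * ∏ i ∈ Finset.range k, m i : ℝ) : ℂ)) +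
            ∫ x in u..v, Q k x * V k x‖ := by
            congr 1; rw [Finset.prod_range_succ]; push_cast; ring
        _ ≤ m k * ((∏ i ∈ Finset.range k, m i) * ((2 - 2 * (1 / 2) ^ k) * (C0 c d / φ1 (t 0) u))) +
            (∏ i ∈ Finset.range (k + 1), m i) * ((1 / 2) ^ k * (C0 c d / φ1 (t 0) u)) := by
            refine (norm_add_le _ _).trans (add_le_add ?_ ?_)
            · rw [norm_mul, Complex.norm_real, Real.norm_eq_abs, abs_of_nonneg (by linarith [hm1 k])]
              exact mul_le_mul_of_nonneg_left ih (by linarith [hm1 k])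
            · refine hb2.trans (le_mul_of_one_le_left (by positivity) hMk)
        _ = _ := by rw [Finset.prod_range_succ]; ring
  have hfin := main k
  have e2 : (∫ x in u..v, Q k x) = ((∫ x in u..v, ∏ i ∈ Finset.range k,
      (1 + lam * Ub p φ (B i) x + mu * (Ub p φ (B i) x) ^ 2) : ℝ) : ℂ) := by
    rw [← intervalIntegral.integral_ofReal]
    congr 1
    ext x
    simp only [hQ, hm, hV]
    push_cast
    refine Finset.prod_congr rfl fun i _ => ?_
    ring
  rw [e2, ← Complex.ofReal_sub, Complex.norm_real, Real.norm_eq_abs] at hfin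
  refine hfin.trans ?_
  apply mul_le_mul_of_nonneg_left _ (hM0 k)
  rw [mul_div_assoc]
  have hq : 0 ≤ C0 c d / φ1 (t 0) u := by positivity
  apply mul_le_mul_of_nonneg_right _ hq
  have : (0:ℝ) ≤ (1 / 2) ^ k := by positivity
  linarith

end

lemma exp_quad {ε z : ℝ} (h1 : ε ≤ 1) (hz : |z| ≤ ε) :
    |Real.exp z - (1 + z + z ^ 2 / 2)| ≤ ε / 2 * z ^ 2 := by
  have h := Real.exp_bound (x := z) (hz.trans h1) (n := 3) (by norm_num)
  have e : ∑ m ∈ Finset.range 3, z ^ m / (m.factorial : ℝ) = 1 + z + z ^ 2 / 2 := by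
    simp [Finset.sum_range_succ, Nat.factorial]
  rw [e] at h
  refine h.trans ?_
  have : |z| ^ 3 = |z| * z ^ 2 := by rw [← sq_abs z]; ring
  rw [this]
  norm_num [Nat.factorial]
  nlinarith [mul_le_mul_of_nonneg_right hz (sq_nonneg z), abs_nonneg z, sq_nonneg z,
    mul_nonneg (abs_nonneg z) (sq_nonneg z)]

lemma exp_up {ε z : ℝ} (h1 : ε ≤ 1) (hz : |z| ≤ ε) :
    Real.exp z ≤ 1 + z + (1 + ε) / 2 * z ^ 2 := by
  have := (abs_le.1 (exp_quad h1 hz)).2; linarith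

lemma exp_lo {ε z : ℝ} (h1 : ε ≤ 1) (hz : |z| ≤ ε) :
    1 + z + (1 - ε) / 2 * z ^ 2 ≤ Real.exp z := by
  have := (abs_le.1 (exp_quad h1 hz)).1; linarith

section
variable {φ φ1 φ2 : ℕ → ℝ → ℝ} {α β κ c : ℝ} {n0 d : ℕ}
variable {p : ℝ → ℝ} {F : Finset ℤ} {cf : ℤ → ℂ} {W σ2 Lp : ℝ}

structure Blk (κ c : ℝ) (n0 d g : ℕ) (B : ℕ → Finset ℕ) (t : ℕ → ℕ) : Prop where
  hg : (2 * d + 1) ≤ κ ^ g * (c / 2)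
  hg4 : 4 ≤ κ ^ g
  ht0 : n0 ≤ t 0
  ht : ∀ i, t i + g ≤ t (i + 1)
  hB : ∀ i, ∀ n ∈ B i, t i ≤ n ∧ n + g ≤ t (i + 1)

lemma mgf_up (S : Sys φ φ1 φ2 α β κ c n0 d) (P : Pol p F cf d W σ2 Lp) {g : ℕ}
    {B : ℕ → Finset ℕ} {t : ℕ → ℕ} (hb : Blk κ c n0 d g B t) {ε lam : ℝ} (hε : ε ≤ 1 / 2)
    (hsm : ∀ i, |lam| * (W * (B i).card) ≤ ε)
    {u v : ℝ} (hu : α ≤ u) (huv : u ≤ v) (hv : v ≤ β) (k : ℕ) :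
    ∫ x in u..v, Real.exp (lam * ∑ i ∈ Finset.range k, Ub p φ (B i) x) ≤
      ((v - u) + 2 * C0 c d / φ1 (t 0) u) *
        Real.exp ((1 + ε) / 2 * lam ^ 2 * σ2 * ∑ i ∈ Finset.range k, ((B i).card : ℝ)) := by
  have hε0 : 0 ≤ ε := le_trans (by have := P.Wp; positivity) (hsm 0)
  have huu : u ∈ Set.Icc α β := ⟨hu, huv.trans hv⟩
  have hs0 := P.s0
  have hc := S.hc
  have hp0 := S.pos1 _ hb.ht0 u huu
  have hC : 0 ≤ C0 c d := by unfold C0; positivity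
  have hr := riesz S P hb.hg hb.hg4 B t hb.ht0 hb.ht hb.hB lam ((1 + ε) / 2 * lam ^ 2) (by positivity)
    (by nlinarith [sq_nonneg lam]) (fun i => (hsm i).trans hε) hu huv hv k
  have h1 : ∫ x in u..v, Real.exp (lam * ∑ i ∈ Finset.range k, Ub p φ (B i) x) ≤
      ∫ x in u..v, ∏ i ∈ Finset.range k, (1 + lam * Ub p φ (B i) x +
        (1 + ε) / 2 * lam ^ 2 * (Ub p φ (B i) x) ^ 2) := by
    have hcU := fun i => Ub_cont S P (B i)
    apply intervalIntegral.integral_mono_on huv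
    · apply Continuous.intervalIntegrable
      exact Real.continuous_exp.comp (continuous_const.mul (continuous_finsetSum _ fun i _ => hcU i))
    · apply Continuous.intervalIntegrable
      exact continuous_finsetProd _ fun i _ => by have := hcU i; fun_prop
    · intro x _
      rw [Finset.mul_sum, Real.exp_sum]
      apply Finset.prod_le_prod (fun _ _ => (Real.exp_pos _).le)
      intro i _
      have hz : |lam * Ub p φ (B i) x| ≤ ε := by
        rw [abs_mul]
        exact (mul_le_mul_of_nonneg_left (Ub_bd P (B i) x) (abs_nonneg _)).trans (hsm i)
      have := exp_up (by linarith) hz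
      rw [mul_pow] at this
      linarith
  have h2 := (abs_le.1 hr).2
  have h3 : ∏ i ∈ Finset.range k, (1 + (1 + ε) / 2 * lam ^ 2 * ((B i).card * σ2)) ≤
      Real.exp ((1 + ε) / 2 * lam ^ 2 * σ2 * ∑ i ∈ Finset.range k, ((B i).card : ℝ)) := by
    rw [Finset.mul_sum, Real.exp_sum]
    apply Finset.prod_le_prod (fun _ _ => by positivity)
    intro i _
    have := Real.add_one_le_exp ((1 + ε) / 2 * lam ^ 2 * σ2 * ((B i).card : ℝ))
    linarith
  calc _ ≤ _ := h1
    _ ≤ ((v - u) + 2 * C0 c d / φ1 (t 0) u) *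
      ∏ i ∈ Finset.range k, (1 + (1 + ε) / 2 * lam ^ 2 * ((B i).card * σ2)) := by linarith
    _ ≤ _ := by
      apply mul_le_mul_of_nonneg_left h3
      have : 0 ≤ v - u := by linarith
      positivity

lemma mgf_lo (S : Sys φ φ1 φ2 α β κ c n0 d) (P : Pol p F cf d W σ2 Lp) {g : ℕ}
    {B : ℕ → Finset ℕ} {t : ℕ → ℕ} (hb : Blk κ c n0 d g B t) {ε lam : ℝ} (hε : ε ≤ 1 / 2)
    (hsm : ∀ i, |lam| * (W * (B i).card) ≤ ε)
    {u v : ℝ} (hu : α ≤ u) (huv : u ≤ v) (hv : v ≤ β) (k : ℕ)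
    (hJ : 2 * C0 c d / φ1 (t 0) u ≤ v - u) :
    ((v - u) - 2 * C0 c d / φ1 (t 0) u) *
        Real.exp ((1 - 2 * ε) / 2 * lam ^ 2 * σ2 * ∑ i ∈ Finset.range k, ((B i).card : ℝ)) ≤
    ∫ x in u..v, Real.exp (lam * ∑ i ∈ Finset.range k, Ub p φ (B i) x) := by
  have hε0 : 0 ≤ ε := le_trans (by have := P.Wp; positivity) (hsm 0)
  have huu : u ∈ Set.Icc α β := ⟨hu, huv.trans hv⟩
  have hs0 := P.s0
  have hc := S.hc
  have hp0 := S.pos1 _ hb.ht0 u huu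
  have hC : 0 ≤ C0 c d := by unfold C0; positivity
  have hmu : 0 ≤ (1 - ε) / 2 * lam ^ 2 := mul_nonneg (by linarith) (sq_nonneg _)
  have hr := riesz S P hb.hg hb.hg4 B t hb.ht0 hb.ht hb.hB lam ((1 - ε) / 2 * lam ^ 2) hmu
    (by nlinarith [sq_nonneg lam]) (fun i => (hsm i).trans hε) hu huv hv k
  have h1 : ∫ x in u..v, ∏ i ∈ Finset.range k, (1 + lam * Ub p φ (B i) x +
        (1 - ε) / 2 * lam ^ 2 * (Ub p φ (B i) x) ^ 2) ≤
        ∫ x in u..v, Real.exp (lam * ∑ i ∈ Finset.range k, Ub p φ (B i) x) := by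
    have hcU := fun i => Ub_cont S P (B i)
    apply intervalIntegral.integral_mono_on huv
    · apply Continuous.intervalIntegrable
      exact continuous_finsetProd _ fun i _ => by have := hcU i; fun_prop
    · apply Continuous.intervalIntegrable
      exact Real.continuous_exp.comp (continuous_const.mul (continuous_finsetSum _ fun i _ => hcU i))
    · intro x _
      rw [Finset.mul_sum, Real.exp_sum]
      have hz : ∀ i, |lam * Ub p φ (B i) x| ≤ ε := by
        intro i
        rw [abs_mul]
        exact (mul_le_mul_of_nonneg_left (Ub_bd P (B i) x) (abs_nonneg _)).trans (hsm i)
      apply Finset.prod_le_prod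
      · intro i _
        have := (abs_le.1 (hz i)).1
        have : 0 ≤ (1 - ε) / 2 * lam ^ 2 * (Ub p φ (B i) x) ^ 2 := mul_nonneg hmu (sq_nonneg _)
        linarith
      · intro i _
        have := exp_lo (by linarith) (hz i)
        rw [mul_pow] at this
        linarith
  have h2 := (abs_le.1 hr).1
  have h3 : Real.exp ((1 - 2 * ε) / 2 * lam ^ 2 * σ2 * ∑ i ∈ Finset.range k, ((B i).card : ℝ)) ≤
      ∏ i ∈ Finset.range k, (1 + (1 - ε) / 2 * lam ^ 2 * ((B i).card * σ2)) := by
    rw [Finset.mul_sum, Real.exp_sum]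
    apply Finset.prod_le_prod (fun _ _ => (Real.exp_pos _).le)
    intro i _
    set w := lam ^ 2 * σ2 * ((B i).card : ℝ) with hw
    have hw0 : 0 ≤ w := by positivity
    have hwε : w ≤ ε ^ 2 := by
      calc w ≤ (|lam| * (W * (B i).card)) ^ 2 := by
            rw [mul_pow, sq_abs, mul_pow, hw, mul_assoc]
            have : ((B i).card : ℝ) ≤ (B i).card ^ 2 := by
              rcases Nat.eq_zero_or_pos (B i).card with h | h
              · simp [h]
              · have : (1:ℝ) ≤ (B i).card := by exact_mod_cast h
                nlinarith
            have := P.sW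
            gcongr
        _ ≤ _ := by
            have := hsm i
            have := P.Wp
            gcongr
    have hz0 : 0 ≤ (1 - 2 * ε) / 2 * w := mul_nonneg (by linarith) hw0
    have hz : |(1 - 2 * ε) / 2 * w| ≤ ε := by
      rw [abs_of_nonneg hz0]; nlinarith
    have := exp_up (by linarith) hz
    have e1 : (1 - 2 * ε) / 2 * lam ^ 2 * σ2 * ((B i).card : ℝ) = (1 - 2 * ε) / 2 * w := by
      rw [hw]; ring
    have e2 : (1 - ε) / 2 * lam ^ 2 * ((B i).card * σ2) = (1 - ε) / 2 * w := by rw [hw]; ring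
    rw [e1, e2]
    refine this.trans ?_
    have hq : (1 + ε) / 2 * ((1 - 2 * ε) / 2 * w) ^ 2 ≤ w ^ 2 := by
      have a1 : ((1 - 2 * ε) / 2 * w) ^ 2 ≤ w ^ 2 := by
        apply pow_le_pow_left₀ hz0; nlinarith
      nlinarith [sq_nonneg ((1 - 2 * ε) / 2 * w)]
    have : w ^ 2 ≤ ε / 2 * w := by
      have : w ≤ ε / 2 := by nlinarith
      nlinarith
    nlinarith
  calc _ ≤ ((v - u) - 2 * C0 c d / φ1 (t 0) u) *
      ∏ i ∈ Finset.range k, (1 + (1 - ε) / 2 * lam ^ 2 * ((B i).card * σ2)) := by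
        apply mul_le_mul_of_nonneg_left h3; linarith
    _ ≤ _ := by linarith
    _ ≤ _ := h1

lemma int_restrict {u v : ℝ} (huv : u ≤ v) (f : ℝ → ℝ) :
    ∫ x, f x ∂(volume.restrict (Set.Icc u v)) = ∫ x in u..v, f x := by
  rw [integral_Icc_eq_integral_Ioc, intervalIntegral.integral_of_le huv]

lemma integrable_cont {u v : ℝ} {f : ℝ → ℝ} (hf : Continuous f) :
    Integrable f (volume.restrict (Set.Icc u v)) :=
  hf.continuousOn.integrableOn_Icc

lemma markov {u v : ℝ} (huv : u ≤ v) {Z : ℝ → ℝ} (hZ : Continuous Z) (y : ℝ) :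
    (volume.restrict (Set.Icc u v)).real {x | y ≤ Z x} ≤
      Real.exp (-y) * ∫ x in u..v, Real.exp (Z x) := by
  have h := mul_meas_ge_le_integral_of_nonneg (μ := volume.restrict (Set.Icc u v))
    (f := fun x => Real.exp (Z x)) (Eventually.of_forall fun x => (Real.exp_pos _).le)
    (integrable_cont (Real.continuous_exp.comp hZ)) (Real.exp y)
  rw [int_restrict huv] at h
  simp only [Real.exp_le_exp] at h
  rw [Real.exp_neg, ← div_eq_inv_mul, le_div_iff₀ (Real.exp_pos _), mul_comm]
  exact h

lemma blk_tail (S : Sys φ φ1 φ2 α β κ c n0 d) (P : Pol p F cf d W σ2 Lp) {g : ℕ}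
    {B : ℕ → Finset ℕ} {t : ℕ → ℕ} (hb : Blk κ c n0 d g B t) {ε lam : ℝ} (hε : ε ≤ 1 / 2)
    (hsm : ∀ i, |lam| * (W * (B i).card) ≤ ε)
    {u v : ℝ} (hu : α ≤ u) (huv : u ≤ v) (hv : v ≤ β) (k : ℕ) (y : ℝ) :
    (volume.restrict (Set.Icc u v)).real {x | y ≤ lam * ∑ i ∈ Finset.range k, Ub p φ (B i) x} ≤
      ((v - u) + 2 * C0 c d / φ1 (t 0) u) *
        Real.exp (- y + (1 + ε) / 2 * lam ^ 2 * σ2 * ∑ i ∈ Finset.range k, ((B i).card : ℝ)) := by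
  have h1 := markov huv (Z := fun x => lam * ∑ i ∈ Finset.range k, Ub p φ (B i) x)
    (continuous_const.mul (continuous_finsetSum _ fun i _ => Ub_cont S P (B i))) y
  have h2 := mgf_up S P hb hε hsm hu huv hv k
  refine h1.trans ?_
  rw [Real.exp_add]
  have := mul_le_mul_of_nonneg_left h2 (Real.exp_pos (-y)).le
  linarith

/-- two-sided tail -/
lemma blk_tail2 (S : Sys φ φ1 φ2 α β κ c n0 d) (P : Pol p F cf d W σ2 Lp) {g : ℕ}
    {B : ℕ → Finset ℕ} {t : ℕ → ℕ} (hb : Blk κ c n0 d g B t) {ε lam : ℝ} (hε : ε ≤ 1 / 2)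
    (hlam : 0 ≤ lam)
    (hsm : ∀ i, lam * (W * (B i).card) ≤ ε)
    {u v : ℝ} (hu : α ≤ u) (huv : u ≤ v) (hv : v ≤ β) (k : ℕ) (y : ℝ) :
    (volume.restrict (Set.Icc u v)).real {x | y ≤ |∑ i ∈ Finset.range k, Ub p φ (B i) x|} ≤
      2 * (((v - u) + 2 * C0 c d / φ1 (t 0) u) *
        Real.exp (- (lam * y) + (1 + ε) / 2 * lam ^ 2 * σ2 * ∑ i ∈ Finset.range k, ((B i).card : ℝ))) := by
  have h1 := blk_tail S P hb (lam := lam) hε (by simpa [abs_of_nonneg hlam] using hsm) hu huv hv k (lam * y)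
  have h2 := blk_tail S P hb (lam := -lam) hε (by simpa [abs_of_nonneg hlam] using hsm) hu huv hv k (lam * y)
  rw [neg_sq] at h2
  have hsub : {x | y ≤ |∑ i ∈ Finset.range k, Ub p φ (B i) x|} ⊆
    {x | lam * y ≤ lam * ∑ i ∈ Finset.range k, Ub p φ (B i) x} ∪
    {x | lam * y ≤ -lam * ∑ i ∈ Finset.range k, Ub p φ (B i) x} := by
    intro x hx
    have hx' : y ≤ |∑ i ∈ Finset.range k, Ub p φ (B i) x| := hx
    rcases le_abs.1 hx' with h | h
    · left; exact mul_le_mul_of_nonneg_left h hlam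
    · right
      show lam * y ≤ -lam * _
      have := mul_le_mul_of_nonneg_left h hlam
      linarith
  have h3 := (measureReal_mono (μ := volume.restrict (Set.Icc u v)) hsub (by finiteness)).trans
    (measureReal_union_le _ _)
  linarith

end

/-- Gärtner–Ellis type lower bound. -/
lemma ge_lower {u v : ℝ} (huv : u ≤ v) {Z : ℝ → ℝ} (hZ : Continuous Z) {L τ η ε : ℝ}
    (hL : 0 < L) (hη : 0 < η) (hτ : η < τ)
    (hε : ε * (τ ^ 2 + (τ + η) ^ 2) / 2 ≤ η ^ 2 / 4) (hε0 : 0 ≤ ε)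
    (hL2 : 16 ≤ Real.exp (L * (η ^ 2 / 4)))
    (hup : ∀ θ, 0 ≤ θ → θ ≤ τ + η → ∫ x in u..v, Real.exp (θ * L * Z x) ≤
      2 * (v - u) * Real.exp ((1 + ε) * θ ^ 2 / 2 * L))
    (hlo : (v - u) / 2 * Real.exp ((1 - ε) * τ ^ 2 / 2 * L) ≤ ∫ x in u..v, Real.exp (τ * L * Z x)) :
    (v - u) / 4 * Real.exp (- (τ ^ 2 / 2 + ε * τ ^ 2 / 2 + τ * η) * L) ≤
      (volume.restrict (Set.Icc u v)).real {x | τ - η ≤ Z x} := by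
  set μ := volume.restrict (Set.Icc u v) with hμ
  have hset : MeasurableSet {x | τ - η ≤ Z x} := measurableSet_le measurable_const hZ.measurable
  have hI : ∀ θ : ℝ, Integrable (fun x => Real.exp (θ * L * Z x)) μ := fun θ =>
    integrable_cont (by fun_prop)
  have hpt : ∀ x, Real.exp (τ * L * Z x) ≤
      Real.exp (η * L * (τ - η)) * Real.exp ((τ - η) * L * Z x) +
      Real.exp (- (η * L * (τ + η))) * Real.exp ((τ + η) * L * Z x) +
      Set.indicator {x | τ - η ≤ Z x} (fun _ => Real.exp (τ * L * (τ + η))) x := by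
    intro x
    have n1 : 0 ≤ Real.exp (η * L * (τ - η)) * Real.exp ((τ - η) * L * Z x) := by positivity
    have n2 : 0 ≤ Real.exp (- (η * L * (τ + η))) * Real.exp ((τ + η) * L * Z x) := by positivity
    have n3 : 0 ≤ Set.indicator {x | τ - η ≤ Z x} (fun _ => Real.exp (τ * L * (τ + η))) x :=
      Set.indicator_nonneg (fun _ _ => (Real.exp_pos _).le) _
    have hηL : 0 < η * L := by positivity
    by_cases h1 : τ - η ≤ Z x
    · by_cases h2 : Z x ≤ τ + η
      · rw [Set.indicator_of_mem (by exact h1)]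
        have : Real.exp (τ * L * Z x) ≤ Real.exp (τ * L * (τ + η)) := by
          rw [Real.exp_le_exp]
          exact mul_le_mul_of_nonneg_left h2 (by nlinarith)
        linarith
      · have : Real.exp (τ * L * Z x) ≤ Real.exp (- (η * L * (τ + η))) * Real.exp ((τ + η) * L * Z x) := by
          rw [← Real.exp_add, Real.exp_le_exp]
          push Not at h2
          nlinarith
        linarith
    · have : Real.exp (τ * L * Z x) ≤ Real.exp (η * L * (τ - η)) * Real.exp ((τ - η) * L * Z x) := by
        rw [← Real.exp_add, Real.exp_le_exp]
        push Not at h1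
        nlinarith
      linarith
  have hint := integral_mono (μ := μ) (hI τ)
    ((((hI (τ - η)).const_mul (Real.exp (η * L * (τ - η)))).add
      ((hI (τ + η)).const_mul (Real.exp (- (η * L * (τ + η)))))).add
      ((integrable_const (Real.exp (τ * L * (τ + η)))).indicator hset)) hpt
  rw [integral_add' (((hI (τ - η)).const_mul _).add ((hI (τ + η)).const_mul _))
      ((integrable_const _).indicator hset),
    integral_add' ((hI (τ - η)).const_mul _) ((hI (τ + η)).const_mul _),
    integral_const_mul, integral_const_mul, integral_indicator_const _ hset, hμ, int_restrict huv,
    int_restrict huv, int_restrict huv, smul_eq_mul] at hint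
  have a1 := hup (τ - η) (by linarith) (by linarith)
  have a2 := hup (τ + η) (by linarith) le_rfl
  have hvu : 0 ≤ v - u := by linarith
  set E := Real.exp ((1 - ε) * τ ^ 2 / 2 * L) with hE
  have hEp : 0 < E := Real.exp_pos _
  have hq : Real.exp (- (L * (η ^ 2 / 4))) ≤ 1 / 16 := by
    rw [Real.exp_neg, ← one_div]
    exact one_div_le_one_div_of_le (by norm_num) hL2
  have key : ∀ θ δ : ℝ, δ = (1 - ε) * τ ^ 2 / 2 * L - L * (η ^ 2 / 4) → θ ≤ δ → Real.exp θ ≤ E / 16 := by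
    intro θ δ hd h
    calc Real.exp θ ≤ Real.exp δ := Real.exp_le_exp.2 h
      _ = E * Real.exp (- (L * (η ^ 2 / 4))) := by rw [hE, ← Real.exp_add, hd, sub_eq_add_neg]
      _ ≤ E * (1 / 16) := by gcongr
      _ = _ := by ring
  have b1 : Real.exp (η * L * (τ - η)) * ∫ x in u..v, Real.exp ((τ - η) * L * Z x) ≤ 2 * (v - u) * (E / 16) := by
    calc _ ≤ Real.exp (η * L * (τ - η)) * (2 * (v - u) * Real.exp ((1 + ε) * (τ - η) ^ 2 / 2 * L)) := by
          gcongr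
      _ = 2 * (v - u) * Real.exp (η * L * (τ - η) + (1 + ε) * (τ - η) ^ 2 / 2 * L) := by
          rw [Real.exp_add]; ring
      _ ≤ _ := by
          gcongr
          apply key _ _ rfl
          have : η * (τ - η) + (1 + ε) * (τ - η) ^ 2 / 2 ≤ (1 - ε) * τ ^ 2 / 2 - η ^ 2 / 4 := by
            nlinarith [mul_nonneg hε0 (mul_nonneg hη.le (hη.trans hτ).le)]
          nlinarith
  have b2 : Real.exp (-(η * L * (τ + η))) * ∫ x in u..v, Real.exp ((τ + η) * L * Z x) ≤ 2 * (v - u) * (E / 16) := by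
    calc _ ≤ Real.exp (-(η * L * (τ + η))) * (2 * (v - u) * Real.exp ((1 + ε) * (τ + η) ^ 2 / 2 * L)) := by
          gcongr
      _ = 2 * (v - u) * Real.exp (-(η * L * (τ + η)) + (1 + ε) * (τ + η) ^ 2 / 2 * L) := by
          rw [Real.exp_add]; ring
      _ ≤ _ := by
          gcongr
          apply key _ _ rfl
          have : -(η * (τ + η)) + (1 + ε) * (τ + η) ^ 2 / 2 ≤ (1 - ε) * τ ^ 2 / 2 - η ^ 2 / 4 := by
            nlinarith
          nlinarith
  have hfin : (v - u) / 4 * E ≤ (volume.restrict (Set.Icc u v)).real {x | τ - η ≤ Z x} * Real.exp (τ * L * (τ + η)) := by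
    have : (v - u) * E ≥ 0 := by positivity
    nlinarith
  have e3 : Real.exp (- (τ ^ 2 / 2 + ε * τ ^ 2 / 2 + τ * η) * L) = E / Real.exp (τ * L * (τ + η)) := by
    rw [hE, ← Real.exp_sub]; congr 1; ring
  rw [e3, ← mul_div_assoc, div_le_iff₀ (Real.exp_pos _)]
  exact hfin

section
variable {φ φ1 φ2 : ℕ → ℝ → ℝ} {α β κ c : ℝ} {n0 d : ℕ}
variable {p : ℝ → ℝ} {F : Finset ℤ} {cf : ℤ → ℂ} {W σ2 Lp : ℝ}

lemma Ub_Ico (p : ℝ → ℝ) (φ : ℕ → ℝ → ℝ) {a b e : ℕ} (h1 : a ≤ b) (h2 : b ≤ e) (x : ℝ) :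
    Ub p φ (Finset.Ico a e) x = Ub p φ (Finset.Ico a b) x + Ub p φ (Finset.Ico b e) x := by
  unfold Ub
  rw [Finset.sum_Ico_consecutive _ h1 h2]

noncomputable def Sbig (p : ℝ → ℝ) (φ : ℕ → ℝ → ℝ) (a l g k : ℕ) (x : ℝ) : ℝ :=
  ∑ i ∈ Finset.range k, Ub p φ (Finset.Ico (a + i * (l + g)) (a + i * (l + g) + l)) x

noncomputable def Sgap (p : ℝ → ℝ) (φ : ℕ → ℝ → ℝ) (a l g k : ℕ) (x : ℝ) : ℝ :=
  ∑ i ∈ Finset.range k, Ub p φ (Finset.Ico (a + i * (l + g) + l) (a + i * (l + g) + l + g)) x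

lemma S_decomp (p : ℝ → ℝ) (φ : ℕ → ℝ → ℝ) (a l g k : ℕ) (x : ℝ) :
    Ub p φ (Finset.Ico a (a + k * (l + g))) x = Sbig p φ a l g k x + Sgap p φ a l g k x := by
  induction k with
  | zero => simp [Ub, Sbig, Sgap]
  | succ k ih =>
    have e : a + (k + 1) * (l + g) = a + k * (l + g) + l + g := by ring
    unfold Sbig Sgap at *
    rw [Finset.sum_range_succ, Finset.sum_range_succ,
      Ub_Ico p φ (b := a + k * (l + g)) (by omega) (by rw [e]; omega), ih,
      Ub_Ico p φ (a := a + k * (l + g)) (b := a + k * (l + g) + l) (by omega) (by rw [e]; omega), e]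
    ring

lemma exists_g (S : Sys φ φ1 φ2 α β κ c n0 d) :
    ∃ g : ℕ, 1 ≤ g ∧ (2 * d + 1) ≤ κ ^ g * (c / 2) ∧ 4 ≤ κ ^ g := by
  have hc := S.hc
  obtain ⟨g, hg⟩ := pow_unbounded_of_one_lt (max 4 ((2 * d + 1) / (c / 2))) S.hk
  refine ⟨g, ?_, ?_, ?_⟩
  · by_contra h
    have : g = 0 := by omega
    subst this
    have := le_max_left (4:ℝ) ((2 * d + 1) / (c / 2))
    norm_num at hg
  · have := (le_max_right (4:ℝ) ((2 * d + 1) / (c / 2))).trans hg.le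
    rwa [div_le_iff₀ (by positivity)] at this
  · exact (le_max_left _ _).trans hg.le

lemma blk_big {g : ℕ} (h1 : (2 * d + 1) ≤ κ ^ g * (c / 2)) (h2 : 4 ≤ κ ^ g) {a : ℕ} (ha : n0 ≤ a)
    (l : ℕ) : Blk κ c n0 d g (fun i => Finset.Ico (a + i * (l + g)) (a + i * (l + g) + l))
      (fun i => a + i * (l + g)) := by
  refine ⟨h1, h2, by simpa using ha, fun i => ?_, fun i n hn => ?_⟩
  · have : (i + 1) * (l + g) = i * (l + g) + l + g := by ring
    omega
  · have : (i + 1) * (l + g) = i * (l + g) + l + g := by ring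
    simp only [Finset.mem_Ico] at hn
    omega

lemma blk_gap {g : ℕ} (h1 : (2 * d + 1) ≤ κ ^ g * (c / 2)) (h2 : 4 ≤ κ ^ g) {a : ℕ} (ha : n0 ≤ a)
    (l : ℕ) (hl : g ≤ l) :
    Blk κ c n0 d g (fun i => Finset.Ico (a + i * (l + g) + l) (a + i * (l + g) + l + g))
      (fun i => a + i * (l + g) + l) := by
  refine ⟨h1, h2, by omega, fun i => ?_, fun i n hn => ?_⟩
  · have : (i + 1) * (l + g) = i * (l + g) + l + g := by ring
    omega
  · have : (i + 1) * (l + g) = i * (l + g) + l + g := by ring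
    simp only [Finset.mem_Ico] at hn
    omega

lemma C0_nonneg (S : Sys φ φ1 φ2 α β κ c n0 d) : 0 ≤ C0 c d := by
  have := S.hc
  unfold C0; positivity

lemma gap_tail (S : Sys φ φ1 φ2 α β κ c n0 d) (P : Pol p F cf d W σ2 Lp) {g : ℕ} (hg1 : 1 ≤ g)
    (hg : (2 * d + 1) ≤ κ ^ g * (c / 2)) (hg4 : 4 ≤ κ ^ g) {η : ℝ} (hη : 0 < η) :
    ∃ l0 : ℕ, ∀ l, l0 ≤ l → ∃ r1 : ℝ, 0 < r1 ∧ ∀ a, n0 ≤ a → ∀ N : ℕ, ∀ r : ℝ, 0 < r → r ≤ r1 →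
      1 ≤ r ^ 2 * N → ∀ u v, α ≤ u → u ≤ v → v ≤ β →
      (volume.restrict (Set.Icc u v)).real
        {x | η * (r * N) ≤ |Ub p φ (Finset.Ico a (a + N)) x - Sbig p φ a l g (N / (l + g)) x|} ≤
      2 * (((v - u) + 2 * C0 c d / φ1 a u) * Real.exp (-2 * (r ^ 2 * N))) := by
  have hs0 := P.s0
  have hW := P.Wp
  have hgp : (0:ℝ) < g := by exact_mod_cast hg1
  obtain ⟨l1, hl1⟩ := exists_nat_ge ((6 / η) ^ 2 * σ2 * g)
  refine ⟨max g l1, fun l hl => ?_⟩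
  have hlg : g ≤ l := (le_max_left _ _).trans hl
  have hl2 : (6 / η) ^ 2 * σ2 * g ≤ l := hl1.trans (by exact_mod_cast (le_max_right _ _).trans hl)
  have hlp : (0:ℝ) < l := by exact_mod_cast hg1.trans hlg
  have hwp : (0:ℝ) < (l:ℝ) + g := by positivity
  refine ⟨min (η / (2 * (W * (l + g)))) (1 / (2 * ((6 / η) * (W * g)))), by positivity, ?_⟩
  intro a ha N r hr hr1 hrN u v hu huv hv
  have hra : r ≤ η / (2 * (W * (l + g))) := hr1.trans (min_le_left _ _)
  have hrb : r ≤ 1 / (2 * ((6 / η) * (W * g))) := hr1.trans (min_le_right _ _)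
  rw [le_div_iff₀ (by positivity)] at hra hrb
  set k := N / (l + g) with hk
  have hkN : k * (l + g) ≤ N := Nat.div_mul_le_self _ _
  have hrest : N < k * (l + g) + (l + g) := by
    have := Nat.lt_div_mul_add (a := N) (b := l + g) (by omega)
    exact this
  have hkN' : (k:ℝ) * (l + g) ≤ N := by exact_mod_cast hkN
  have hNr : 1 / r ≤ r * N := by
    rw [div_le_iff₀ hr]; nlinarith
  have hb := blk_gap (κ := κ) (c := c) (n0 := n0) (d := d) hg hg4 ha l hlg
  have huu : u ∈ Set.Icc α β := ⟨hu, huv.trans hv⟩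
  have ht := blk_tail2 S P hb (ε := 1 / 2) (lam := 6 / η * r) le_rfl (by positivity)
    (by intro i; simp only [Nat.card_Ico, add_tsub_cancel_left]; nlinarith) hu huv hv k (η / 2 * (r * N))
  have hsub : {x | η * (r * N) ≤ |Ub p φ (Finset.Ico a (a + N)) x - Sbig p φ a l g k x|} ⊆
      {x | η / 2 * (r * N) ≤ |∑ i ∈ Finset.range k,
        Ub p φ (Finset.Ico (a + i * (l + g) + l) (a + i * (l + g) + l + g)) x|} := by
    intro x hx
    have hx' : η * (r * N) ≤ |Ub p φ (Finset.Ico a (a + N)) x - Sbig p φ a l g k x| := hx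
    show η / 2 * (r * N) ≤ |Sgap p φ a l g k x|
    rw [Ub_Ico p φ (b := a + k * (l + g)) (by omega) (by omega), S_decomp] at hx'
    have h1 := Ub_bd (φ := φ) P (Finset.Ico (a + k * (l + g)) (a + N)) x
    have h2 : ((Finset.Ico (a + k * (l + g)) (a + N)).card : ℝ) ≤ l + g := by
      have : (Finset.Ico (a + k * (l + g)) (a + N)).card ≤ l + g := by
        rw [Nat.card_Ico]; omega
      exact_mod_cast this
    have h3 : W * ((Finset.Ico (a + k * (l + g)) (a + N)).card : ℝ) ≤ η / 2 * (r * N) := by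
      have h4 : W * (l + g) ≤ η / 2 * (1 / r) := by
        rw [mul_one_div, le_div_iff₀ hr]; linarith
      have h5 : η / 2 * (1 / r) ≤ η / 2 * (r * N) := by gcongr
      have := mul_le_mul_of_nonneg_left h2 hW.le
      linarith
    have e : Sbig p φ a l g k x + Sgap p φ a l g k x +
        Ub p φ (Finset.Ico (a + k * (l + g)) (a + N)) x - Sbig p φ a l g k x =
        Sgap p φ a l g k x + Ub p φ (Finset.Ico (a + k * (l + g)) (a + N)) x := by ring
    rw [e] at hx'
    have := abs_add_le (Sgap p φ a l g k x) (Ub p φ (Finset.Ico (a + k * (l + g)) (a + N)) x)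
    linarith
  refine (measureReal_mono hsub (by finiteness)).trans (ht.trans ?_)
  have hm := S.mono1 ha (n := a + 0 * (l + g) + l) (by omega) huu
  have hp0 := S.pos1 a ha u huu
  have hC := C0_nonneg S
  have hvu : 0 ≤ v - u := by linarith
  gcongr 2 * (((v - u) + ?_) * Real.exp ?_)
  · exact div_le_div_of_nonneg_left (by positivity) hp0 hm
  · simp only [Nat.card_Ico, add_tsub_cancel_left, Finset.sum_const, Finset.card_range, nsmul_eq_mul]
    have hkg : (k:ℝ) * g * l ≤ N * g := by
      have h0 : (k:ℝ) * l ≤ N := by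
        have : (0:ℝ) ≤ k * g := by positivity
        linarith
      calc (k:ℝ) * g * l = k * l * g := by ring
        _ ≤ _ := by gcongr
    have h1 : (6 / η) ^ 2 * σ2 * ((k:ℝ) * g) ≤ N := by
      have h2 : (6 / η) ^ 2 * σ2 * ((k:ℝ) * g) * l ≤ N * l := by
        calc _ = (6 / η) ^ 2 * σ2 * ((k:ℝ) * g * l) := by ring
          _ ≤ (6 / η) ^ 2 * σ2 * (N * g) := by gcongr
          _ = N * ((6 / η) ^ 2 * σ2 * g) := by ring
          _ ≤ _ := by gcongr
      exact le_of_mul_le_mul_right h2 hlp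
    have h3 : 6 / η * r * (η / 2 * (r * N)) = 3 * (r ^ 2 * N) := by field_simp; ring
    rw [h3]
    have h4 : (1 + 1 / 2) / 2 * (6 / η * r) ^ 2 * σ2 * (k * g) = 3 / 4 * r ^ 2 * ((6 / η) ^ 2 * σ2 * ((k:ℝ) * g)) := by ring
    rw [h4]
    have := mul_le_mul_of_nonneg_left h1 (show 0 ≤ 3 / 4 * r ^ 2 by positivity)
    nlinarith

lemma T1 (S : Sys φ φ1 φ2 α β κ c n0 d) (P : Pol p F cf d W σ2 Lp) {y : ℝ} (hy : 0 < y)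
    (hy2 : 2 * σ2 < y ^ 2) : ∃ ρ C r1 : ℝ, 1 < ρ ∧ 0 < C ∧ 0 < r1 ∧ ∀ a, n0 ≤ a → ∀ N : ℕ, ∀ r : ℝ,
      0 < r → r ≤ r1 → 1 ≤ r ^ 2 * N →
      (volume.restrict (Set.Icc α β)).real
        {x | y * (r * N) ≤ |Ub p φ (Finset.Ico a (a + N)) x|} ≤ C * Real.exp (-ρ * (r ^ 2 * N)) := by
  have hs0 := P.s0
  have hW := P.Wp
  obtain ⟨g, hg1, hg, hg4⟩ := exists_g S
  have hgp : (0:ℝ) < g := by exact_mod_cast hg1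
  -- choose y1
  obtain ⟨y1, hy1, hy1y⟩ : ∃ y1, Real.sqrt (2 * σ2) < y1 ∧ y1 < y :=
    exists_between (by rw [Real.sqrt_lt' hy]; exact hy2)
  have hy10 : 0 < y1 := (Real.sqrt_nonneg _).trans_lt hy1
  have hy12 : 2 * σ2 < y1 ^ 2 := by rwa [Real.sqrt_lt' hy10] at hy1
  obtain ⟨s', hs1, hs2⟩ : ∃ s', σ2 < s' ∧ s' < y1 ^ 2 / 2 := exists_between (by linarith)
  have hs' : 0 < s' := by linarith
  obtain ⟨ε, hε0, hε, hεs⟩ : ∃ ε : ℝ, 0 < ε ∧ ε ≤ 1 / 2 ∧ (1 + ε) * σ2 ≤ s' := by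
    refine ⟨min (1 / 2) ((s' - σ2) / (σ2 + 1)), ?_, min_le_left _ _, ?_⟩
    · have : 0 < s' - σ2 := by linarith
      positivity
    · have h1 := min_le_right (1 / 2) ((s' - σ2) / (σ2 + 1))
      have h2 : (s' - σ2) / (σ2 + 1) * σ2 ≤ s' - σ2 := by
        rw [div_mul_eq_mul_div, div_le_iff₀ (by linarith)]
        nlinarith
      have := mul_le_mul_of_nonneg_right h1 hs0
      linarith
  obtain ⟨l0, hl0⟩ := gap_tail S P hg1 hg hg4 (η := y - y1) (by linarith)
  obtain ⟨r1, hr1, hgap⟩ := hl0 (max l0 1) (le_max_left _ _)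
  set l := max l0 1 with hl
  have hlp : (0:ℝ) < l := by exact_mod_cast (le_max_right l0 1)
  have hC := C0_nonneg S
  have hαβ := S.hab
  have hp0 := S.pos1 n0 le_rfl α ⟨le_rfl, hαβ.le⟩
  have hba : 0 < β - α := by linarith
  refine ⟨min 2 (y1 ^ 2 / (2 * s')), 4 * ((β - α) + 2 * C0 c d / φ1 n0 α), min r1 (ε / (y1 / s' * (W * l))), ?_, by positivity, by positivity, ?_⟩
  · apply lt_min (by norm_num)
    rw [lt_div_iff₀ (by positivity)]; linarith
  intro a ha N r hr hrr hrN
  have hr1' := hrr.trans (min_le_left _ _)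
  have hr2 := hrr.trans (min_le_right _ _)
  rw [le_div_iff₀ (by positivity)] at hr2
  have hG := hgap a ha N r hr hr1' hrN α β le_rfl hαβ.le le_rfl
  have hb := blk_big (κ := κ) (c := c) (n0 := n0) (d := d) hg hg4 ha l
  set k := N / (l + g) with hk
  have hkN : k * (l + g) ≤ N := Nat.div_mul_le_self _ _
  have hkl : (k:ℝ) * l ≤ N := by
    have : (k:ℝ) * (l + g) ≤ N := by exact_mod_cast hkN
    have : (0:ℝ) ≤ k * g := by positivity
    linarith
  have ht := blk_tail2 S P hb (ε := ε) (lam := y1 / s' * r) hε (by positivity)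
    (by intro i; simp only [Nat.card_Ico, add_tsub_cancel_left]; linarith) le_rfl hαβ.le le_rfl k (y1 * (r * N))
  have hsub : {x | y * (r * N) ≤ |Ub p φ (Finset.Ico a (a + N)) x|} ⊆
      {x | (y - y1) * (r * N) ≤ |Ub p φ (Finset.Ico a (a + N)) x - Sbig p φ a l g k x|} ∪
      {x | y1 * (r * N) ≤ |Sbig p φ a l g k x|} := by
    intro x hx
    have hx' : y * (r * N) ≤ |Ub p φ (Finset.Ico a (a + N)) x| := hx
    by_contra h
    simp only [Set.mem_union, Set.mem_ofPred_eq, not_or, not_le] at h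
    have := abs_add_le (Ub p φ (Finset.Ico a (a + N)) x - Sbig p φ a l g k x) (Sbig p φ a l g k x)
    rw [sub_add_cancel] at this
    linarith [h.1, h.2]
  have hm := S.mono1 le_rfl ha (x := α) ⟨le_rfl, hαβ.le⟩
  have hdiv : 2 * C0 c d / φ1 a α ≤ 2 * C0 c d / φ1 n0 α :=
    div_le_div_of_nonneg_left (by positivity) hp0 hm
  have hq : 0 ≤ (β - α) + 2 * C0 c d / φ1 n0 α := by positivity
  have hrNp : 0 ≤ r ^ 2 * N := by linarith
  have e1 : Real.exp (-2 * (r ^ 2 * N)) ≤ Real.exp (- min 2 (y1 ^ 2 / (2 * s')) * (r ^ 2 * N)) := by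
    rw [Real.exp_le_exp]
    have := min_le_left 2 (y1 ^ 2 / (2 * s'))
    nlinarith
  have e2 : Real.exp (-(y1 / s' * r * (y1 * (r * N))) + (1 + ε) / 2 * (y1 / s' * r) ^ 2 * σ2 *
      ∑ i ∈ Finset.range k, ((Finset.Ico (a + i * (l + g)) (a + i * (l + g) + l)).card : ℝ)) ≤
      Real.exp (- min 2 (y1 ^ 2 / (2 * s')) * (r ^ 2 * N)) := by
    rw [Real.exp_le_exp]
    simp only [Nat.card_Ico, add_tsub_cancel_left, Finset.sum_const, Finset.card_range, nsmul_eq_mul]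
    have h1 := min_le_right 2 (y1 ^ 2 / (2 * s'))
    have h2 : (1 + ε) * σ2 * (k * l) ≤ s' * N := by gcongr
    have h3 := mul_le_mul_of_nonneg_left h2 (show 0 ≤ (y1 / s' * r) ^ 2 / 2 by positivity)
    have h4 : (y1 / s' * r) ^ 2 / 2 * (s' * N) = y1 ^ 2 / (2 * s') * (r ^ 2 * N) := by field_simp
    have h5 : y1 / s' * r * (y1 * (r * N)) = 2 * (y1 ^ 2 / (2 * s') * (r ^ 2 * N)) := by field_simp
    have h6 := mul_le_mul_of_nonneg_right h1 hrNp
    rw [h5]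
    linarith
  have f1 : 2 * (((β - α) + 2 * C0 c d / φ1 a α) * Real.exp (-2 * (r ^ 2 * N))) ≤
    2 * (((β - α) + 2 * C0 c d / φ1 n0 α) * Real.exp (- min 2 (y1 ^ 2 / (2 * s')) * (r ^ 2 * N))) := by
    gcongr
  have f2 : 2 * (((β - α) + 2 * C0 c d / φ1 (a + 0 * (l + g)) α) * Real.exp (-(y1 / s' * r * (y1 * (r * N))) + (1 + ε) / 2 * (y1 / s' * r) ^ 2 * σ2 *
      ∑ i ∈ Finset.range k, ((Finset.Ico (a + i * (l + g)) (a + i * (l + g) + l)).card : ℝ))) ≤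
    2 * (((β - α) + 2 * C0 c d / φ1 n0 α) * Real.exp (- min 2 (y1 ^ 2 / (2 * s')) * (r ^ 2 * N))) := by
    have : a + 0 * (l + g) = a := by ring
    rw [this]
    gcongr
  have h3 := (measureReal_mono (μ := volume.restrict (Set.Icc α β)) hsub (by finiteness)).trans
    (measureReal_union_le _ _)
  have ht' := ht.trans f2
  have hG' := hG.trans f1
  unfold Sbig at h3 hG'
  linarith

set_option maxHeartbeats 1000000 in
lemma T2 (S : Sys φ φ1 φ2 α β κ c n0 d) (P : Pol p F cf d W σ2 Lp) (hσ : 0 < σ2) {y : ℝ} (hy : 0 < y)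
    (hy2 : y ^ 2 < 2 * σ2) : ∃ ρ K L1 r1 : ℝ, 0 < ρ ∧ ρ < 1 ∧ 0 < K ∧ 1 ≤ L1 ∧ 0 < r1 ∧
      ∀ a, n0 ≤ a → ∀ N : ℕ, ∀ r : ℝ, 0 < r → r ≤ r1 → L1 ≤ r ^ 2 * N →
      ∀ u v, α ≤ u → u ≤ v → v ≤ β → K ≤ φ1 a u * (v - u) →
      (v - u) / 8 * Real.exp (-ρ * (r ^ 2 * N)) ≤ (volume.restrict (Set.Icc u v)).real
        {x | y * (r * N) ≤ Ub p φ (Finset.Ico a (a + N)) x} := by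
  have hW := P.Wp
  obtain ⟨g, hg1, hg, hg4⟩ := exists_g S
  have hgp : (0:ℝ) < g := by exact_mod_cast hg1
  obtain ⟨σ, hσp, hσσ⟩ : ∃ σ : ℝ, 0 < σ ∧ σ ^ 2 = σ2 := ⟨√σ2, Real.sqrt_pos.2 hσ, Real.sq_sqrt hσ.le⟩
  have hq2 : √2 ^ 2 = (2:ℝ) := Real.sq_sqrt (by norm_num)
  have hq0 : 0 < √(2:ℝ) := Real.sqrt_pos.2 (by norm_num)
  have hq15 : √(2:ℝ) ≤ 3 / 2 := by rw [Real.sqrt_le_left (by norm_num)]; norm_num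
  have hq1 : 1 ≤ √(2:ℝ) := by rw [Real.one_le_sqrt]; norm_num
  have hyσ : y / σ < √2 := by
    rw [div_lt_iff₀ hσp]
    apply lt_of_pow_lt_pow_left₀ 2 (by positivity)
    rw [mul_pow, hq2, hσσ]; exact hy2
  obtain ⟨η, hη, hηy⟩ : ∃ η, 0 < η ∧ y / σ = √2 - 4 * η := ⟨(√2 - y / σ) / 4, by linarith, by ring⟩
  have hyp : 0 < y / σ := by positivity
  have hη1 : η < 3 / 8 := by linarith
  obtain ⟨τ, hτ⟩ : ∃ τ, τ = √2 - 2 * η := ⟨_, rfl⟩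
  have hy' : y = σ * (τ - 2 * η) := by
    rw [hτ]; rw [div_eq_iff hσp.ne'] at hηy; rw [hηy]; ring
  obtain ⟨ε, hε⟩ : ∃ ε : ℝ, ε = η ^ 2 / 100 := ⟨_, rfl⟩
  have hε0 : 0 < ε := by rw [hε]; positivity
  have hε1 : ε ≤ 1 / 100 := by rw [hε]; nlinarith
  have hτη : η < τ := by linarith
  have hτ0 : 0 < τ := by linarith
  have hτ2 : τ + η ≤ 2 := by linarith
  have hεc : ε * (τ ^ 2 + (τ + η) ^ 2) / 2 ≤ η ^ 2 / 4 := by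
    have h1 : τ ^ 2 ≤ 2 ^ 2 := by gcongr; linarith
    have h2 : (τ + η) ^ 2 ≤ 2 ^ 2 := by gcongr
    have : ε * (τ ^ 2 + (τ + η) ^ 2) ≤ ε * (2 ^ 2 + 2 ^ 2) := by gcongr
    linarith [sq_nonneg η]
  set ρ := τ ^ 2 / 2 + ε * τ ^ 2 / 2 + τ * η with hρ
  have hρ0 : 0 < ρ := by positivity
  have hρ1 : ρ < 1 := by
    have h1 : τ ^ 2 + 2 * τ * η = 2 - 2 * √2 * η := by
      rw [hτ]; linear_combination hq2
    have h2 : τ ^ 2 ≤ 4 := by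
      have : τ ^ 2 ≤ 2 ^ 2 := by gcongr; linarith
      linarith
    have h3 : ε * τ ^ 2 ≤ η := by
      have h4 : ε * τ ^ 2 ≤ ε * 4 := by gcongr
      have h5 : η ^ 2 ≤ η * (3 / 8) := by rw [sq]; gcongr
      linarith
    have h6 : 1 * η ≤ √2 * η := by gcongr
    linarith
  obtain ⟨l0, hl0⟩ := gap_tail S P hg1 hg hg4 (η := σ * η) (by positivity)
  obtain ⟨l1, hl1⟩ := exists_nat_ge (4 * g / ε)
  obtain ⟨l, hll0, hll1, hl1p⟩ : ∃ l, l0 ≤ l ∧ l1 ≤ l ∧ 1 ≤ l :=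
    ⟨max l0 (max l1 1), by simp, by simp, by simp⟩
  obtain ⟨r1, hr1, hgap⟩ := hl0 l hll0
  have hlp : (0:ℝ) < l := by exact_mod_cast hl1p
  have hgl : 4 * g ≤ ε * l := by
    have : 4 * g / ε ≤ l := hl1.trans (by exact_mod_cast hll1)
    rw [div_le_iff₀ hε0] at this; linarith
  have hC := C0_nonneg S
  have hwp : (0:ℝ) < (l:ℝ) + g := by positivity
  refine ⟨ρ, 4 * C0 c d + 1, max 24 (64 / η ^ 2), min r1 (min (ε / 4 * σ / (2 * (W * l))) (min 1 (ε / (4 * (l + g))))),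
    hρ0, hρ1, by positivity, le_trans (by norm_num) (le_max_left _ _), by positivity, ?_⟩
  intro a ha N r hr hrr hL u v hu huv hv hK
  have hra := hrr.trans (min_le_left _ _)
  have hrr2 := hrr.trans (min_le_right _ _)
  have hrb := hrr2.trans (min_le_left _ _)
  have hrr3 := hrr2.trans (min_le_right _ _)
  have hrc := hrr3.trans (min_le_left _ _)
  have hrd := hrr3.trans (min_le_right _ _)
  rw [le_div_iff₀ (by positivity)] at hrb hrd
  have hL24 : 24 ≤ r ^ 2 * N := (le_max_left _ _).trans hL
  have hLη : 64 / η ^ 2 ≤ r ^ 2 * N := (le_max_right _ _).trans hL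
  set L := r ^ 2 * N with hLdef
  have hLp : 0 < L := by linarith
  have huu : u ∈ Set.Icc α β := ⟨hu, huv.trans hv⟩
  have hp0 := S.pos1 a ha u huu
  have hvu : 0 ≤ v - u := by linarith
  have hJ : 2 * C0 c d / φ1 a u ≤ (v - u) / 2 := by
    rw [div_le_iff₀ hp0]; linarith
  have hG := hgap a ha N r hr hra (by linarith) u v hu huv hv
  have hb := blk_big (κ := κ) (c := c) (n0 := n0) (d := d) hg hg4 ha l
  set k := N / (l + g) with hk
  have hkN : k * (l + g) ≤ N := Nat.div_mul_le_self _ _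
  have hrest : N < k * (l + g) + (l + g) := Nat.lt_div_mul_add (a := N) (b := l + g) (by omega)
  have hkN' : (k:ℝ) * (l + g) ≤ N := by exact_mod_cast hkN
  have hrest' : (N:ℝ) ≤ k * (l + g) + (l + g) := by exact_mod_cast hrest.le
  have hkl : (k:ℝ) * l ≤ N := by
    have : (0:ℝ) ≤ k * g := by positivity
    linarith
  have hN0 : (0:ℝ) ≤ N := by positivity
  have hNp : (0:ℝ) < N := by
    rcases hN0.lt_or_eq with h | h
    · exact h
    · rw [hLdef, ← h] at hLp; simp at hLp
  have hkl2 : (1 - ε / 2) * N ≤ k * l := by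
    have h1 : (k:ℝ) * g ≤ ε / 4 * N := by
      have h3 : (k:ℝ) * (4 * g) ≤ k * (ε * l) := by gcongr
      have h4 : ε * (k * l) ≤ ε * N := by gcongr
      linarith
    have h2 : (l + g : ℝ) ≤ ε / 4 * N := by
      have h3 : 1 ≤ r * N := by
        have : r ^ 2 * N ≤ r * N := by
          gcongr
          exact pow_le_of_le_one hr.le hrc (by norm_num)
        linarith
      have h4 : r * (4 * (l + g)) * N ≤ ε * N := by gcongr
      have h5 := mul_le_mul_of_nonneg_left h3 (show (0:ℝ) ≤ 4 * (l + g) by positivity)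
      linarith
    linarith
  have hcard : ∑ i ∈ Finset.range k, ((Finset.Ico (a + i * (l + g)) (a + i * (l + g) + l)).card : ℝ) = k * l := by
    simp only [Nat.card_Ico, add_tsub_cancel_left, Finset.sum_const, Finset.card_range, nsmul_eq_mul]
  have ea : a + 0 * (l + g) = a := by ring
  have hsm : ∀ θ, 0 ≤ θ → θ ≤ τ + η → ∀ i, |θ * r / σ| * (W * ((Finset.Ico (a + i * (l + g)) (a + i * (l + g) + l)).card : ℝ)) ≤ ε / 4 := by
    intro θ h0 h1 i
    simp only [Nat.card_Ico, add_tsub_cancel_left]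
    rw [abs_of_nonneg (by positivity), div_mul_eq_mul_div, div_le_iff₀ hσp]
    have : θ * r * (W * l) ≤ 2 * r * (W * l) := by gcongr; linarith
    linarith
  have hcS : Continuous (Sbig p φ a l g k) := continuous_finsetSum _ fun i _ => Ub_cont S P _
  have eZ : ∀ θ x, θ * L * (Sbig p φ a l g k x / (σ * (r * N))) = θ * r / σ * Sbig p φ a l g k x := by
    intro θ x
    rw [hLdef]; field_simp
  have hge := ge_lower huv (Z := fun x => Sbig p φ a l g k x / (σ * (r * N))) (hcS.div_const _)
    hLp hη hτη hεc hε0.le ?_ ?_ ?_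
  rotate_left
  · have h1 := Real.add_one_le_exp (L * (η ^ 2 / 4))
    rw [div_le_iff₀ (by positivity)] at hLη
    linarith
  · intro θ h0 h1
    simp only [eZ]
    have := mgf_up S P hb (ε := ε / 4) (lam := θ * r / σ) (by linarith) (hsm θ h0 h1) hu huv hv k
    rw [hcard, ea] at this
    refine this.trans ?_
    have e1 : (1 + ε / 4) / 2 * (θ * r / σ) ^ 2 * σ2 * (k * l) ≤ (1 + ε) * θ ^ 2 / 2 * L := by
      have : (1 + ε / 4) / 2 * (θ * r / σ) ^ 2 * σ2 * (k * l) = (1 + ε / 4) / 2 * (θ * r) ^ 2 * (k * l) := by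
        rw [← hσσ]; field_simp
      rw [this, hLdef]
      calc _ ≤ (1 + ε) / 2 * (θ * r) ^ 2 * N := by gcongr; linarith
        _ = _ := by ring
    gcongr ?_ * Real.exp ?_
    linarith
  · simp only [eZ]
    have := mgf_lo S P hb (ε := ε / 4) (lam := τ * r / σ) (by linarith) (hsm τ hτ0.le (by linarith)) hu huv hv k
      (by rw [ea]; linarith)
    rw [hcard, ea] at this
    refine le_trans ?_ this
    have e1 : (1 - ε) * τ ^ 2 / 2 * L ≤ (1 - 2 * (ε / 4)) / 2 * (τ * r / σ) ^ 2 * σ2 * (k * l) := by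
      have : (1 - 2 * (ε / 4)) / 2 * (τ * r / σ) ^ 2 * σ2 * (k * l) = (1 - ε / 2) / 2 * (τ * r) ^ 2 * (k * l) := by
        rw [← hσσ]; field_simp; ring
      rw [this, hLdef]
      have h1 := mul_le_mul_of_nonneg_left hkl2 (show 0 ≤ (1 - ε / 2) / 2 * (τ * r) ^ 2 from mul_nonneg (by linarith) (sq_nonneg _))
      refine le_trans ?_ h1
      have h2 : 0 ≤ (τ * r) ^ 2 * N := by positivity
      have h3 : 0 ≤ ε ^ 2 * ((τ * r) ^ 2 * N) := by positivity
      linarith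
    gcongr ?_ * Real.exp ?_
    all_goals linarith
  have hsub : {x | τ - η ≤ Sbig p φ a l g k x / (σ * (r * N))} ⊆
      {x | y * (r * N) ≤ Ub p φ (Finset.Ico a (a + N)) x} ∪
      {x | σ * η * (r * N) ≤ |Ub p φ (Finset.Ico a (a + N)) x - Sbig p φ a l g k x|} := by
    intro x hx
    have hx' : τ - η ≤ Sbig p φ a l g k x / (σ * (r * N)) := hx
    rw [le_div_iff₀ (by positivity)] at hx'
    by_contra h
    simp only [Set.mem_union, Set.mem_ofPred_eq, not_or, not_le] at h
    have := (abs_lt.1 h.2).1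
    have h1 := h.1
    rw [hy'] at h1
    linarith
  have h3 := (measureReal_mono (μ := volume.restrict (Set.Icc u v)) hsub (by finiteness)).trans
    (measureReal_union_le _ _)
  have hG2 : 2 * (((v - u) + 2 * C0 c d / φ1 a u) * Real.exp (-2 * L)) ≤ (v - u) / 8 * Real.exp (-ρ * L) := by
    have h1 : Real.exp (-2 * L) ≤ Real.exp (-ρ * L) * (1 / 24) := by
      have : Real.exp (-2 * L) = Real.exp (-ρ * L) * Real.exp (-((2 - ρ) * L)) := by
        rw [← Real.exp_add]; congr 1; ring
      rw [this]
      gcongr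
      rw [Real.exp_neg, ← one_div]
      apply one_div_le_one_div_of_le (by norm_num)
      have h5 := Real.add_one_le_exp ((2 - ρ) * L)
      have h6 : 1 * L ≤ (2 - ρ) * L := by gcongr; linarith
      linarith
    calc _ ≤ 2 * (((v - u) + (v - u) / 2) * (Real.exp (-ρ * L) * (1 / 24))) := by gcongr
      _ = _ := by ring
  have := hge.trans h3
  linarith [hG.trans hG2]

end

lemma bc_real {Ω : Type*} [MeasurableSpace Ω] (μ : Measure Ω) [IsFiniteMeasure μ] (s : ℕ → Set Ω)
    (b : ℕ → ℝ) (hb : Summable b) (h : ∀ᶠ n in atTop, μ.real (s n) ≤ b n) :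
    ∀ᵐ x ∂μ, ∀ᶠ n in atTop, x ∉ s n := by
  obtain ⟨n1, hn1⟩ := eventually_atTop.1 h
  have h2 : ∀ n, μ.real (s (n + n1)) ≤ b (n + n1) := fun n => hn1 _ (by omega)
  have hb' : Summable fun n => b (n + n1) := (summable_nat_add_iff n1).2 hb
  have h3 : ∑' n, μ (s (n + n1)) ≠ ⊤ := by
    have : ∀ n, μ (s (n + n1)) ≤ ENNReal.ofReal (b (n + n1)) := by
      intro n
      rw [← ofReal_measureReal]
      exact ENNReal.ofReal_le_ofReal (h2 n)
    have hb0 : ∀ n, 0 ≤ b (n + n1) := fun n => measureReal_nonneg.trans (h2 n)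
    have h4 := ENNReal.tsum_le_tsum this
    rw [← ENNReal.ofReal_tsum_of_nonneg hb0 hb'] at h4
    exact ne_top_of_le_ne_top ENNReal.ofReal_ne_top h4
  filter_upwards [ae_eventually_notMem h3] with x hx
  obtain ⟨n2, hn2⟩ := eventually_atTop.1 hx
  filter_upwards [eventually_ge_atTop (n2 + n1)] with n hn
  have := hn2 (n - n1) (by omega)
  rwa [show n - n1 + n1 = n by omega] at this

lemma chain (g : ℕ → ℝ) (θ : ℕ → ℝ) (r m k N : ℕ) (hk : m + k ≤ r) (hN : N < 2 ^ r)
    (h : ∀ l, m < l → l ≤ m + k → ∀ i, i < 2 ^ l →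
      |g (i * 2 ^ (r - l) + 2 ^ (r - l)) - g (i * 2 ^ (r - l))| ≤ θ l)
    (hθ : ∀ l, 0 ≤ θ l) :
    |g (N / 2 ^ (r - (m + k)) * 2 ^ (r - (m + k))) - g (N / 2 ^ (r - m) * 2 ^ (r - m))| ≤
      ∑ l ∈ Finset.range k, θ (m + l + 1) := by
  induction k with
  | zero => simp
  | succ k ih =>
    have ih' := ih (by omega) (fun l h1 h2 => h l h1 (by omega))
    rw [Finset.sum_range_succ]
    set e := r - (m + (k + 1)) with he
    have he2 : r - (m + k) = e + 1 := by omega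
    rw [he2] at ih'
    set j := N / 2 ^ e with hj
    have hj2 : N / 2 ^ (e + 1) = j / 2 := by rw [pow_succ, ← Nat.div_div_eq_div_mul]
    rw [hj2] at ih'
    have hjlt : j < 2 ^ (m + k + 1) := by
      rw [hj, Nat.div_lt_iff_lt_mul (by positivity), ← pow_add]
      rwa [show m + k + 1 + e = r by omega]
    have key : |g (j * 2 ^ e) - g (j / 2 * 2 ^ (e + 1))| ≤ θ (m + k + 1) := by
      rcases Nat.even_or_odd' j with ⟨i, hi | hi⟩
      · have : j / 2 = i := by omega
        rw [this, hi, pow_succ]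
        rw [show 2 * i * 2 ^ e = i * (2 ^ e * 2) by ring]
        simp [hθ]
      · have : j / 2 = i := by omega
        have h1 := h (m + k + 1) (by omega) (by omega) (2 * i) (by omega)
        rw [show r - (m + k + 1) = e by omega] at h1
        rw [this, hi, pow_succ, show i * (2 ^ e * 2) = 2 * i * 2 ^ e by ring,
          show (2 * i + 1) * 2 ^ e = 2 * i * 2 ^ e + 2 ^ e by ring]
        exact h1
    have := abs_sub_le (g (j * 2 ^ e)) (g (j / 2 * 2 ^ (e + 1))) (g (N / 2 ^ (r - m) * 2 ^ (r - m)))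
    linarith

lemma geo78 (m k : ℕ) : ∑ l ∈ Finset.range k, ((7:ℝ) / 8) ^ (m + l + 1) ≤ 8 * (7 / 8) ^ m := by
  have h : ∑ l ∈ Finset.range k, ((7:ℝ) / 8) ^ (m + l + 1) = 7 * (7 / 8) ^ m * (1 - (7 / 8) ^ k) := by
    induction k with
    | zero => simp
    | succ k ih => rw [Finset.sum_range_succ, ih]; ring
  rw [h]
  have h1 : (0:ℝ) < (7 / 8) ^ m := by positivity
  have h2 : (0:ℝ) < (7 / 8) ^ k := by positivity
  nlinarith [mul_pos h1 h2]

lemma pow49 (l : ℕ) (hl : 5 ≤ l) : (l:ℝ) + 2 ≤ (2 * (7 / 8) ^ 2 : ℝ) ^ l := by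
  induction l, hl using Nat.le_induction with
  | base => norm_num
  | succ l hl ih =>
    rw [pow_succ]
    push_cast
    have : (5:ℝ) ≤ l := by exact_mod_cast hl
    nlinarith

section
variable {φ φ1 φ2 : ℕ → ℝ → ℝ} {α β κ c : ℝ} {n0 d : ℕ}
variable {p : ℝ → ℝ} {F : Finset ℤ} {cf : ℤ → ℂ} {W σ2 Lp : ℝ}

lemma ev_small {r1 : ℝ} (hr1 : 0 < r1) : ∀ᶠ r : ℕ in atTop,
    ((7:ℝ) / 8) ^ (2 * (r / 2)) * Real.log r ≤ r1 ^ 2 := by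
  have h := tendsto_self_mul_const_pow_of_lt_one (r := (7:ℝ) / 8) (by norm_num) (by norm_num)
  have h2 : ∀ᶠ r : ℕ in atTop, (r:ℝ) * (7 / 8) ^ r < 7 / 8 * r1 ^ 2 :=
    h.eventually_lt_const (by positivity)
  filter_upwards [h2, eventually_ge_atTop 1] with r hr hr1
  have hl : Real.log r ≤ r := (Real.log_le_sub_one_of_pos (by exact_mod_cast hr1)).trans (by linarith)
  have e : r ≤ 2 * (r / 2) + 1 := by omega
  have h3 : ((7:ℝ) / 8) ^ (2 * (r / 2)) * (7 / 8) ≤ (7 / 8) ^ r := by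
    rw [← pow_succ]
    by_cases hq : r = 2 * (r / 2) + 1
    · rw [← hq]
    · apply pow_le_pow_of_le_one (by norm_num) (by norm_num)
      omega
  have h4 : ((7:ℝ) / 8) ^ (2 * (r / 2)) * Real.log r ≤ (7 / 8) ^ (2 * (r / 2)) * r := by gcongr
  have h5 : ((7:ℝ) / 8) ^ (2 * (r / 2)) * (7 / 8) * r ≤ (7 / 8) ^ r * r := by gcongr
  linarith

/-- One increment at one scale. -/
lemma incr_tail {y ρ C r1 : ℝ} (hT : ∀ a, n0 ≤ a → ∀ N : ℕ, ∀ r : ℝ,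
      0 < r → r ≤ r1 → 1 ≤ r ^ 2 * N →
      (volume.restrict (Set.Icc α β)).real
        {x | y * (r * N) ≤ |Ub p φ (Finset.Ico a (a + N)) x|} ≤ C * Real.exp (-ρ * (r ^ 2 * N)))
    (hr1 : 0 < r1) (hρ : 1 < ρ) (hC : 0 < C) {r l : ℕ} (hl5 : 5 ≤ l) (hl : l ≤ r / 2)
    (hlog : 1 ≤ Real.log r) (hsm : ((7:ℝ) / 8) ^ (2 * (r / 2)) * Real.log r ≤ r1 ^ 2) (i : ℕ) :
    (volume.restrict (Set.Icc α β)).real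
        {x | y * ((7 / 8) ^ l * √(2 ^ r * Real.log r)) ≤
          |Ub p φ (Finset.Ico (n0 + i * 2 ^ (r - l)) (n0 + i * 2 ^ (r - l) + 2 ^ (r - l))) x|} ≤
      C * Real.exp (-((l + 2) * Real.log r)) := by
  set X := √(2 ^ r * Real.log r) with hX
  have hXX : X ^ 2 = 2 ^ r * Real.log r := Real.sq_sqrt (by positivity)
  have hXp : 0 < X := Real.sqrt_pos.2 (by positivity)
  have h2 : (2:ℝ) ^ (r - l) * 2 ^ l = 2 ^ r := by rw [← pow_add]; congr 1; omega
  have e1 : ((7 / 8) ^ l * X / 2 ^ (r - l)) ^ 2 * (2:ℝ) ^ (r - l) = (2 * (7 / 8) ^ 2 : ℝ) ^ l * Real.log r := by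
    have e0 : (2 * (7 / 8) ^ 2 : ℝ) ^ l = 2 ^ l * ((7 / 8) ^ l) ^ 2 := by
      rw [mul_pow, pow_right_comm]
    rw [div_pow, mul_pow, hXX, ← h2, e0]
    generalize ((7:ℝ) / 8) ^ l = q
    have : (0:ℝ) < 2 ^ (r - l) := by positivity
    field_simp
  have hp := pow49 l hl5
  have hll : (0:ℝ) ≤ l := by positivity
  have h := hT (n0 + i * 2 ^ (r - l)) (by omega) (2 ^ (r - l)) ((7 / 8) ^ l * X / 2 ^ (r - l))
    (by positivity) ?_ ?_
  · push_cast at h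
    rw [e1, div_mul_cancel₀ _ (by positivity)] at h
    refine h.trans ?_
    gcongr
    have : ((l:ℝ) + 2) * Real.log r ≤ (2 * (7 / 8) ^ 2 : ℝ) ^ l * Real.log r := by gcongr
    have h3 : 1 * ((2 * (7 / 8) ^ 2 : ℝ) ^ l * Real.log r) ≤ ρ * ((2 * (7 / 8) ^ 2 : ℝ) ^ l * Real.log r) := by
      gcongr
    linarith
  · refine (sq_le_sq₀ (by positivity) hr1.le).1 ?_
    refine le_trans ?_ hsm
    have e2 : ((7 / 8) ^ l * X / 2 ^ (r - l)) ^ 2 = (4 * (7 / 8) ^ 2 : ℝ) ^ l * Real.log r / 2 ^ r := by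
      have e0 : (4 * (7 / 8) ^ 2 : ℝ) ^ l = 2 ^ l * 2 ^ l * ((7 / 8) ^ l) ^ 2 := by
        rw [mul_pow, pow_right_comm, ← mul_pow]; norm_num
      rw [div_pow, mul_pow, hXX, ← h2, e0]
      generalize ((7:ℝ) / 8) ^ l = q
      have : (0:ℝ) < 2 ^ (r - l) := by positivity
      field_simp
    rw [e2, div_le_iff₀ (by positivity)]
    calc (4 * (7 / 8) ^ 2 : ℝ) ^ l * Real.log r ≤ (4 * (7 / 8) ^ 2 : ℝ) ^ (r / 2) * Real.log r := by
          gcongr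
          norm_num
      _ = ((7:ℝ) / 8) ^ (2 * (r / 2)) * Real.log r * 2 ^ (2 * (r / 2)) := by
          rw [mul_pow, ← pow_mul, pow_mul 2 2]; norm_num; ring
      _ ≤ _ := by
          gcongr
          · norm_num
          · omega
  · push_cast
    rw [e1]
    nlinarith

lemma grid_tail {y ρ C r1 : ℝ} (hT : ∀ a, n0 ≤ a → ∀ N : ℕ, ∀ r : ℝ,
      0 < r → r ≤ r1 → 1 ≤ r ^ 2 * N →
      (volume.restrict (Set.Icc α β)).real
        {x | y * (r * N) ≤ |Ub p φ (Finset.Ico a (a + N)) x|} ≤ C * Real.exp (-ρ * (r ^ 2 * N)))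
    (hr1 : 0 < r1) {N : ℕ} (hN : 1 ≤ N) {L : ℝ} (hL : 1 ≤ L) (hsm : L ≤ r1 ^ 2 * N) :
    (volume.restrict (Set.Icc α β)).real
        {x | y * √(N * L) ≤ |Ub p φ (Finset.Ico n0 (n0 + N)) x|} ≤ C * Real.exp (-ρ * L) := by
  have hNp : (0:ℝ) < N := by exact_mod_cast hN
  have e : √(L / N) ^ 2 = L / N := Real.sq_sqrt (by positivity)
  have h := hT n0 le_rfl N √(L / N) (Real.sqrt_pos.2 (by positivity)) ?_ ?_
  · rw [e, div_mul_cancel₀ _ hNp.ne'] at h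
    have e2 : √(L / N) * N = √(N * L) := by
      rw [eq_comm, Real.sqrt_eq_iff_mul_self_eq (by positivity) (by positivity)]
      have : √(L / N) * N * (√(L / N) * N) = √(L / N) ^ 2 * N * N := by ring
      rw [this, e]; field_simp
    rwa [e2] at h
  · rw [Real.sqrt_le_left hr1.le, div_le_iff₀ hNp]; exact hsm
  · rw [e, div_mul_cancel₀ _ hNp.ne']; exact hL

end

section
variable {φ φ1 φ2 : ℕ → ℝ → ℝ} {α β κ c : ℝ} {n0 d : ℕ}
variable {p : ℝ → ℝ} {F : Finset ℤ} {cf : ℤ → ℂ} {W σ2 Lp : ℝ}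

lemma summable_exp_log {ρ : ℝ} (hρ : 1 < ρ) : Summable fun r : ℕ => Real.exp (-ρ * Real.log r) := by
  have h := (Real.summable_nat_rpow (p := -ρ)).2 (by linarith)
  rw [← summable_nat_add_iff 1] at h ⊢
  refine h.congr fun r => ?_
  rw [Real.rpow_def_of_pos (by positivity), mul_comm]

lemma ev_log (A : ℝ) : ∀ᶠ r : ℕ in atTop, A ≤ Real.log r :=
  (Real.tendsto_log_atTop.comp tendsto_natCast_atTop_atTop).eventually_ge_atTop A

lemma ev_log2 {A : ℝ} (hA : 0 < A) : ∀ᶠ r : ℕ in atTop, Real.log r ≤ A * 2 ^ r := by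
  have h := tendsto_self_mul_const_pow_of_lt_one (r := (1:ℝ) / 2) (by norm_num) (by norm_num)
  filter_upwards [h.eventually_lt_const hA, eventually_ge_atTop 1] with r hr hr1
  have hl : Real.log r ≤ r := (Real.log_le_sub_one_of_pos (by exact_mod_cast hr1)).trans (by linarith)
  rw [one_div, inv_pow, ← div_eq_mul_inv, div_lt_iff₀ (by positivity)] at hr
  linarith

lemma exp_pow_bound {L : ℝ} (hL : Real.log 4 ≤ L) (j : ℕ) :
    2 ^ j * Real.exp (-((j + 2) * L)) ≤ Real.exp (-2 * L) * (1 / 2) ^ j := by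
  have e : Real.exp (-((j + 2) * L)) = Real.exp (-2 * L) * Real.exp (-L) ^ j := by
    rw [← Real.exp_nat_mul, ← Real.exp_add]; congr 1; ring
  have h : Real.exp (-L) ≤ 1 / 4 := by
    rw [show (1:ℝ) / 4 = Real.exp (- Real.log 4) by rw [Real.exp_neg, Real.exp_log (by norm_num)]; norm_num]
    exact Real.exp_le_exp.2 (by linarith)
  rw [e]
  have h2 : Real.exp (-L) ^ j ≤ (1 / 4) ^ j := by gcongr
  calc 2 ^ j * (Real.exp (-2 * L) * Real.exp (-L) ^ j) ≤ 2 ^ j * (Real.exp (-2 * L) * (1 / 4) ^ j) := by gcongr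
    _ = Real.exp (-2 * L) * (2 * (1 / 4)) ^ j := by rw [mul_pow]; ring
    _ = _ := by norm_num

lemma geo12 (m k : ℕ) : ∑ l ∈ Finset.range k, ((1:ℝ) / 2) ^ (m + l + 1) ≤ 1 := by
  have h : ∑ l ∈ Finset.range k, ((1:ℝ) / 2) ^ (m + l + 1) = (1 / 2) ^ m * (1 - (1 / 2) ^ k) := by
    induction k with
    | zero => simp
    | succ k ih => rw [Finset.sum_range_succ, ih]; ring
  rw [h]
  have h1 : (0:ℝ) < (1 / 2) ^ m := by positivity
  have h2 : (0:ℝ) < (1 / 2) ^ k := by positivity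
  have h3 : ((1:ℝ) / 2) ^ m ≤ 1 := pow_le_one₀ (by norm_num) (by norm_num)
  nlinarith [mul_pos h1 h2]

def badL (p : ℝ → ℝ) (φ : ℕ → ℝ → ℝ) (n0 : ℕ) (y : ℝ) (r l i : ℕ) : Set ℝ :=
  {x | y * ((7 / 8) ^ l * √(2 ^ r * Real.log r)) ≤
    |Ub p φ (Finset.Ico (n0 + i * 2 ^ (r - l)) (n0 + i * 2 ^ (r - l) + 2 ^ (r - l))) x|}

def badG (p : ℝ → ℝ) (φ : ℕ → ℝ → ℝ) (n0 : ℕ) (y : ℝ) (r N : ℕ) : Set ℝ :=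
  {x | y * √((N : ℝ) * Real.log r) ≤ |Ub p φ (Finset.Ico n0 (n0 + N)) x|}

def bad (p : ℝ → ℝ) (φ : ℕ → ℝ → ℝ) (n0 : ℕ) (y : ℝ) (m r : ℕ) : Set ℝ :=
  (⋃ l ∈ Finset.range (r / 2 - m), ⋃ i ∈ Finset.range (2 ^ (m + l + 1)), badL p φ n0 y r (m + l + 1) i) ∪
  (⋃ i ∈ Finset.Icc 1 (2 ^ m), badG p φ n0 y r (i * 2 ^ (r - m)))

lemma bad_small {y ρ C r1 : ℝ} (hT : ∀ a, n0 ≤ a → ∀ N : ℕ, ∀ r : ℝ,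
      0 < r → r ≤ r1 → 1 ≤ r ^ 2 * N →
      (volume.restrict (Set.Icc α β)).real
        {x | y * (r * N) ≤ |Ub p φ (Finset.Ico a (a + N)) x|} ≤ C * Real.exp (-ρ * (r ^ 2 * N)))
    (hr1 : 0 < r1) (hρ : 1 < ρ) (hC : 0 < C) {m : ℕ} (hm : 5 ≤ m) :
    ∀ᶠ r in atTop, (volume.restrict (Set.Icc α β)).real (bad p φ n0 y m r) ≤
      C * Real.exp (-2 * Real.log r) + 2 ^ m * (C * Real.exp (-ρ * Real.log r)) := by
  filter_upwards [ev_small hr1, ev_log 1, ev_log (Real.log 4),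
    ev_log2 (A := r1 ^ 2 / 2 ^ m) (by positivity), eventually_ge_atTop m] with r h1 h2 h3 h4 hrm
  refine (measureReal_union_le _ _).trans (add_le_add ?_ ?_)
  · refine (measureReal_biUnion_finset_le _ _).trans ?_
    calc _ ≤ ∑ l ∈ Finset.range (r / 2 - m), C * (Real.exp (-2 * Real.log r) * (1 / 2) ^ (m + l + 1)) := by
          apply Finset.sum_le_sum
          intro l hl
          rw [Finset.mem_range] at hl
          refine (measureReal_biUnion_finset_le _ _).trans ?_
          have h5 : ∀ i ∈ Finset.range (2 ^ (m + l + 1)),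
              (volume.restrict (Set.Icc α β)).real (badL p φ n0 y r (m + l + 1) i) ≤
              C * Real.exp (-(((m + l + 1 : ℕ) + 2) * Real.log r)) := fun i _ =>
            incr_tail hT hr1 hρ hC (by omega) (by omega) h2 h1 i
          refine (Finset.sum_le_sum h5).trans ?_
          rw [Finset.sum_const, Finset.card_range, nsmul_eq_mul]
          have := exp_pow_bound h3 (m + l + 1)
          have := mul_le_mul_of_nonneg_left this hC.le
          push_cast at this ⊢
          linarith
      _ = C * (Real.exp (-2 * Real.log r)) * ∑ l ∈ Finset.range (r / 2 - m), (1 / 2) ^ (m + l + 1) := by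
          rw [Finset.mul_sum]; apply Finset.sum_congr rfl; intros; ring
      _ ≤ C * (Real.exp (-2 * Real.log r)) * 1 := by gcongr; exact geo12 _ _
      _ = _ := by ring
  · refine (measureReal_biUnion_finset_le _ _).trans ?_
    have h5 : ∀ i ∈ Finset.Icc 1 (2 ^ m),
        (volume.restrict (Set.Icc α β)).real (badG p φ n0 y r (i * 2 ^ (r - m))) ≤
        C * Real.exp (-ρ * Real.log r) := by
      intro i hi
      rw [Finset.mem_Icc] at hi
      refine grid_tail hT hr1 (Nat.mul_pos hi.1 (by positivity)) h2 (h4.trans ?_)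
      have : (2:ℝ) ^ r = 2 ^ (r - m) * 2 ^ m := by rw [← pow_add]; congr 1; omega
      rw [this]
      push_cast
      have hi1 : (1:ℝ) ≤ i := by exact_mod_cast hi.1
      calc r1 ^ 2 / 2 ^ m * (2 ^ (r - m) * 2 ^ m) = r1 ^ 2 * (1 * 2 ^ (r - m)) := by field_simp
        _ ≤ _ := by gcongr
    refine (Finset.sum_le_sum h5).trans ?_
    simp

lemma good_bound (P : Pol p F cf d W σ2 Lp) {y1 δ : ℝ} (hy1 : 0 < y1) (hδ : 0 < δ) {m r N : ℕ}
    (hm : 5 ≤ m) (hmy : y1 * (8 * (7 / 8) ^ m) ≤ δ / 4) (hr : 2 * m ≤ r) (hL : 1 ≤ Real.log r)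
    (hLW : 32 * W ^ 2 / δ ^ 2 ≤ Real.log r) {x : ℝ} (hx : x ∉ bad p φ n0 y1 m r)
    (hN1 : 2 ^ r ≤ 2 * N) (hN2 : N < 2 ^ r) :
    |Ub p φ (Finset.Ico n0 (n0 + N)) x| ≤ (y1 + δ) * √(N * Real.log r) := by
  have hW := P.Wp
  set X := √(2 ^ r * Real.log r) with hX
  have hXX : X ^ 2 = 2 ^ r * Real.log r := Real.sq_sqrt (by positivity)
  have hX0 : 0 ≤ X := Real.sqrt_nonneg _
  simp only [bad, Set.mem_union, Set.mem_iUnion, not_or, not_exists, Finset.mem_range, Finset.mem_Icc] at hx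
  obtain ⟨hxa, hxb⟩ := hx
  set g : ℕ → ℝ := fun N => Ub p φ (Finset.Ico n0 (n0 + N)) x with hg
  have hgd : ∀ M M', M ≤ M' → g M' - g M = Ub p φ (Finset.Ico (n0 + M) (n0 + M')) x := by
    intro M M' h
    simp only [hg]
    rw [Ub_Ico p φ (b := n0 + M) (by omega) (by omega)]; ring
  have hch := chain g (fun l => y1 * ((7 / 8) ^ l * X)) r m (r / 2 - m) N (by omega) hN2 ?_
    (fun l => by positivity)
  swap
  · intro l hl1 hl2 i hi
    have := hxa (l - m - 1) (by omega) i (by rwa [show m + (l - m - 1) + 1 = l by omega])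
    rw [show m + (l - m - 1) + 1 = l by omega] at this
    simp only [badL, Set.mem_ofPred_eq, not_le] at this
    rw [hgd _ _ (Nat.le_add_right _ _), ← add_assoc]
    exact this.le
  rw [show m + (r / 2 - m) = r / 2 by omega, ← Finset.mul_sum, ← Finset.sum_mul] at hch
  have hs1 : y1 * ((∑ l ∈ Finset.range (r / 2 - m), (7 / 8) ^ (m + l + 1)) * X) ≤ δ / 4 * X := by
    calc _ ≤ y1 * ((8 * (7 / 8) ^ m) * X) := by gcongr; exact geo78 _ _
      _ = y1 * (8 * (7 / 8) ^ m) * X := by ring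
      _ ≤ _ := by gcongr
  -- remainder
  have hrem : |g N - g (N / 2 ^ (r - r / 2) * 2 ^ (r - r / 2))| ≤ δ / 4 * X := by
    have hle : N / 2 ^ (r - r / 2) * 2 ^ (r - r / 2) ≤ N := Nat.div_mul_le_self _ _
    rw [hgd _ _ hle]
    refine (Ub_bd P _ x).trans ?_
    have hc : ((Finset.Ico (n0 + N / 2 ^ (r - r / 2) * 2 ^ (r - r / 2)) (n0 + N)).card : ℝ) ≤ 2 ^ (r - r / 2) := by
      have : (Finset.Ico (n0 + N / 2 ^ (r - r / 2) * 2 ^ (r - r / 2)) (n0 + N)).card ≤ 2 ^ (r - r / 2) := by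
        rw [Nat.card_Ico]
        have := Nat.lt_div_mul_add (a := N) (b := 2 ^ (r - r / 2)) (by positivity)
        omega
      exact_mod_cast this
    refine (mul_le_mul_of_nonneg_left hc hW.le).trans ?_
    refine (sq_le_sq₀ (by positivity) (by positivity)).1 ?_
    rw [mul_pow, mul_pow, hXX, ← pow_mul]
    have h2 : (2:ℝ) ^ ((r - r / 2) * 2) ≤ 2 ^ (r + 1) := by
      apply pow_le_pow_right₀ (by norm_num); omega
    rw [div_le_iff₀ (by positivity)] at hLW
    calc W ^ 2 * 2 ^ ((r - r / 2) * 2) ≤ W ^ 2 * 2 ^ (r + 1) := by gcongr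
      _ = (32 * W ^ 2) * 2 ^ r / 16 := by rw [pow_succ]; ring
      _ ≤ (Real.log r * δ ^ 2) * 2 ^ r / 16 := by gcongr
      _ = _ := by ring
  -- main
  have hmain : |g (N / 2 ^ (r - m) * 2 ^ (r - m))| ≤ y1 * √(N * Real.log r) := by
    have hi1 : 1 ≤ N / 2 ^ (r - m) := by
      rw [Nat.one_le_div_iff (by positivity)]
      have h1 : 2 ^ r = 2 * 2 ^ (r - 1) := by rw [← pow_succ']; congr 1; omega
      have h2 : 2 ^ (r - m) ≤ 2 ^ (r - 1) := Nat.pow_le_pow_right (by norm_num) (by omega)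
      omega
    have hi2 : N / 2 ^ (r - m) ≤ 2 ^ m := by
      apply Nat.div_le_of_le_mul
      rw [← pow_add, show r - m + m = r by omega]; exact hN2.le
    have := hxb _ ⟨hi1, hi2⟩
    simp only [badG, Set.mem_ofPred_eq, not_le] at this
    refine this.le.trans ?_
    have hle : N / 2 ^ (r - m) * 2 ^ (r - m) ≤ N := Nat.div_mul_le_self _ _
    have hle' : ((N / 2 ^ (r - m) * 2 ^ (r - m) : ℕ) : ℝ) ≤ N := by exact_mod_cast hle
    gcongr
  have hXN : X ≤ 2 * √(N * Real.log r) := by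
    rw [hX, Real.sqrt_le_left (by positivity), mul_pow, Real.sq_sqrt (by positivity)]
    have : (2:ℝ) ^ r ≤ 2 * N := by exact_mod_cast hN1
    have : (2:ℝ) ^ r * Real.log r ≤ 2 * N * Real.log r := by gcongr
    have : 0 ≤ (N:ℝ) * Real.log r := by positivity
    linarith
  have t1 := abs_sub_le (g N) (g (N / 2 ^ (r - r / 2) * 2 ^ (r - r / 2))) (g (N / 2 ^ (r - m) * 2 ^ (r - m)))
  have t2 := abs_sub_abs_le_abs_sub (g N) (g (N / 2 ^ (r - m) * 2 ^ (r - m)))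
  have t3 := mul_le_mul_of_nonneg_left hXN (show 0 ≤ δ / 4 by positivity)
  change |g N| ≤ _
  linarith

lemma upper0 (S : Sys φ φ1 φ2 α β κ c n0 d) (P : Pol p F cf d W σ2 Lp) {y : ℝ} (hy : 0 < y)
    (hy2 : 2 * σ2 < y ^ 2) : ∀ᵐ x ∂(volume.restrict (Set.Icc α β)), ∀ᶠ r : ℕ in atTop, ∀ N : ℕ,
      2 ^ r ≤ 2 * N → N < 2 ^ r →
      |Ub p φ (Finset.Ico n0 (n0 + N)) x| ≤ y * √(N * Real.log r) := by
  have hs0 := P.s0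
  obtain ⟨y1, hy1, hy1y⟩ : ∃ y1, Real.sqrt (2 * σ2) < y1 ∧ y1 < y :=
    exists_between (by rw [Real.sqrt_lt' hy]; exact hy2)
  have hy10 : 0 < y1 := (Real.sqrt_nonneg _).trans_lt hy1
  have hy12 : 2 * σ2 < y1 ^ 2 := by rwa [Real.sqrt_lt' hy10] at hy1
  obtain ⟨ρ, C, r1, hρ, hC, hr1, hT⟩ := T1 S P hy10 hy12
  obtain ⟨m, hm5, hm⟩ : ∃ m, 5 ≤ m ∧ y1 * (8 * (7 / 8) ^ m) ≤ (y - y1) / 4 := by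
    have h := (tendsto_pow_atTop_nhds_zero_of_lt_one (r := (7:ℝ) / 8) (by norm_num) (by norm_num)).const_mul (y1 * 8)
    rw [mul_zero] at h
    have h2 := (h.eventually_lt_const (show 0 < (y - y1) / 4 by linarith)).and (eventually_ge_atTop 5)
    obtain ⟨m, h3, h4⟩ := h2.exists
    exact ⟨m, h4, by linarith⟩
  have hbc := bc_real (volume.restrict (Set.Icc α β)) (bad p φ n0 y1 m) _
    (((summable_exp_log (ρ := 2) (by norm_num)).mul_left C).add
      (((summable_exp_log hρ).mul_left C).mul_left (2 ^ m))) (bad_small hT hr1 hρ hC hm5)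
  filter_upwards [hbc] with x hx
  filter_upwards [hx, ev_log 1, ev_log (32 * W ^ 2 / (y - y1) ^ 2), eventually_ge_atTop (2 * m)]
    with r h1 h2 h3 h4 N hN1 hN2
  have := good_bound P hy10 (δ := y - y1) (by linarith) hm5 hm h4 h2 h3 h1 hN1 hN2
  rwa [add_sub_cancel] at this

end

section
variable {φ φ1 φ2 : ℕ → ℝ → ℝ} {α β κ c : ℝ} {n0 d : ℕ}
variable {p : ℝ → ℝ} {F : Finset ℤ} {cf : ℤ → ℂ} {W σ2 Lp : ℝ}

lemma plog_pos (x : ℝ) : 1 ≤ plog x := le_max_left _ _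

lemma plog_mono {x y : ℝ} (hx : 0 < x) (h : x ≤ y) : plog x ≤ plog y :=
  max_le_max le_rfl (Real.log_le_log hx h)

lemma plogplog_pos (x : ℝ) : 1 ≤ plog (plog x) := plog_pos _

lemma plogplog_mono {x y : ℝ} (hx : 0 < x) (h : x ≤ y) : plog (plog x) ≤ plog (plog y) :=
  plog_mono (zero_lt_one.trans_le (plog_pos _)) (plog_mono hx h)

lemma plogplog_tendsto : Tendsto (fun N : ℕ => plog (plog N)) atTop atTop := by
  have h1 : Tendsto (fun N : ℕ => Real.log (Real.log N)) atTop atTop :=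
    Real.tendsto_log_atTop.comp (Real.tendsto_log_atTop.comp tendsto_natCast_atTop_atTop)
  refine tendsto_atTop_mono' _ ?_ h1
  filter_upwards [ev_log 1] with N hN
  exact (Real.log_le_log (by linarith) (le_max_right 1 (Real.log N))).trans (le_max_right _ _)

lemma log_size (N : ℕ) (hN : 1 ≤ N) : Real.log ((Nat.log 2 N + 1 : ℕ) : ℝ) ≤ plog (plog N) + 1 := by
  have h1 : ((2:ℝ)) ^ (Nat.log 2 N) ≤ N := by exact_mod_cast Nat.pow_log_le_self 2 (by omega)
  have h2 := Real.log_le_log (by positivity) h1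
  rw [Real.log_pow] at h2
  have hl2 := Real.log_two_gt_d9
  have hp : Real.log N ≤ plog N := le_max_right _ _
  have hp1 := plog_pos N
  have h3 : ((Nat.log 2 N + 1 : ℕ) : ℝ) ≤ Real.exp 1 * plog N := by
    have he := Real.exp_one_gt_d9
    push_cast
    have hn : (0:ℝ) ≤ Nat.log 2 N := by positivity
    nlinarith
  have h4 := Real.log_le_log (by positivity) h3
  rw [Real.log_mul (by positivity) (by linarith), Real.log_exp] at h4
  have : Real.log (plog N) ≤ plog (plog N) := le_max_right _ _
  linarith

lemma upper1 (S : Sys φ φ1 φ2 α β κ c n0 d) (P : Pol p F cf d W σ2 Lp) (hn0 : 1 ≤ n0) {y : ℝ} (hy : 0 < y)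
    (hy2 : 2 * σ2 < y ^ 2) : ∀ᵐ x ∂(volume.restrict (Set.Icc α β)), ∀ᶠ N : ℕ in atTop,
      |Ub p φ (Finset.Icc 1 N) x| ≤ y * √(N * plog (plog N)) := by
  have hs0 := P.s0
  have hW := P.Wp
  obtain ⟨y1, hy1, hy1y⟩ : ∃ y1, Real.sqrt (2 * σ2) < y1 ∧ y1 < y :=
    exists_between (by rw [Real.sqrt_lt' hy]; exact hy2)
  have hy10 : 0 < y1 := (Real.sqrt_nonneg _).trans_lt hy1
  have hy12 : 2 * σ2 < y1 ^ 2 := by rwa [Real.sqrt_lt' hy10] at hy1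
  obtain ⟨y3, hy3, hy3y⟩ := exists_between hy1y
  filter_upwards [upper0 S P hy10 hy12] with x hx
  obtain ⟨R, hR⟩ := eventually_atTop.1 hx
  have hy13 : 0 < y3 ^ 2 - y1 ^ 2 := by nlinarith
  filter_upwards [eventually_ge_atTop (n0 + 2 ^ R), plogplog_tendsto.eventually_ge_atTop (y1 ^ 2 / (y3 ^ 2 - y1 ^ 2)),
    tendsto_natCast_atTop_atTop.eventually_ge_atTop ((W * n0 / (y - y3)) ^ 2)] with N hN hpp hNW
  have h2R : 1 ≤ 2 ^ R := Nat.one_le_two_pow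
  set N' := N + 1 - n0 with hN'
  have hN'1 : 2 ^ R ≤ N' := by omega
  have hN'2 : N' ≤ N := by omega
  have hN'0 : N' ≠ 0 := by omega
  have h1 := hR (Nat.log 2 N' + 1) (by
      have : R ≤ Nat.log 2 N' := Nat.le_log_of_pow_le (by norm_num) hN'1
      omega) N' (by rw [pow_succ]; have := Nat.pow_log_le_self 2 hN'0; omega)
      (Nat.lt_pow_succ_log_self (by norm_num) _)
  have e : Ub p φ (Finset.Icc 1 N) x = Ub p φ (Finset.Ico 1 n0) x + Ub p φ (Finset.Ico n0 (n0 + N')) x := by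
    rw [← Ub_Ico p φ hn0 (by omega), ← Finset.Ico_add_one_right_eq_Icc]
    congr 2; omega
  have h2 := Ub_bd (φ := φ) P (Finset.Ico 1 n0) x
  have h3 : W * ((Finset.Ico 1 n0).card : ℝ) ≤ W * n0 := by
    have : (Finset.Ico 1 n0).card ≤ n0 := by rw [Nat.card_Ico]; omega
    have : ((Finset.Ico 1 n0).card : ℝ) ≤ n0 := by exact_mod_cast this
    gcongr
  set Q := plog (plog N) with hQ
  have hQ1 : 1 ≤ Q := plogplog_pos _
  have hQ0 : 0 < Q := by linarith
  have hN'c : (N':ℝ) ≤ N := by exact_mod_cast hN'2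
  have hN'p : (0:ℝ) < N' := by exact_mod_cast Nat.pos_of_ne_zero hN'0
  have h4 : W * n0 ≤ (y - y3) * √(N * Q) := by
    have h5 : W * n0 / (y - y3) ≤ √(N * Q) := by
      apply Real.le_sqrt_of_sq_le
      have : (N:ℝ) * 1 ≤ N * Q := by gcongr
      linarith
    rw [div_le_iff₀ (by linarith)] at h5
    linarith
  have h6 : y1 * √(N' * Real.log ((Nat.log 2 N' + 1 : ℕ) : ℝ)) ≤ y3 * √(N * Q) := by
    have hls := log_size N' (by omega)
    have hmono : plog (plog N') ≤ Q := plogplog_mono hN'p hN'c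
    have hy30 : 0 < y3 := by linarith
    refine (sq_le_sq₀ (by positivity) (by positivity)).1 ?_
    have hl0 : 0 ≤ Real.log ((Nat.log 2 N' + 1 : ℕ) : ℝ) := Real.log_natCast_nonneg _
    rw [mul_pow, mul_pow, Real.sq_sqrt (by positivity), Real.sq_sqrt (by positivity)]
    rw [div_le_iff₀ hy13] at hpp
    calc y1 ^ 2 * (N' * Real.log ((Nat.log 2 N' + 1 : ℕ) : ℝ)) ≤ y1 ^ 2 * (N * (Q + 1)) := by
          gcongr; linarith
      _ = N * (y1 ^ 2 * (Q + 1)) := by ring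
      _ ≤ N * (y3 ^ 2 * Q) := by
          refine mul_le_mul_of_nonneg_left ?_ (by positivity); linarith
      _ = _ := by ring
  rw [e]
  have := abs_add_le (Ub p φ (Finset.Ico 1 n0) x) (Ub p φ (Finset.Ico n0 (n0 + N')) x)
  linarith
end

section
variable {φ φ1 φ2 : ℕ → ℝ → ℝ} {α β κ c : ℝ} {n0 d : ℕ}
variable {p : ℝ → ℝ} {F : Finset ℤ} {cf : ℤ → ℂ} {W σ2 Lp : ℝ}

lemma Sys.monoOn (S : Sys φ φ1 φ2 α β κ c n0 d) {n : ℕ} (hn : n0 ≤ n) {x y : ℝ} (hx : α ≤ x) (hxy : x ≤ y)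
    (hy : y ≤ β) : φ1 n x ≤ φ1 n y := by
  have h : MonotoneOn (φ1 n) (Set.Icc α β) := by
    apply monotoneOn_of_deriv_nonneg (convex_Icc α β)
    · exact fun z _ => ((S.ph n).d2 z).continuousAt.continuousWithinAt
    · exact fun z _ => ((S.ph n).d2 z).differentiableAt.differentiableWithinAt
    · intro z hz
      rw [((S.ph n).d2 z).deriv]
      exact S.nn2 n hn z (interior_subset hz)
  exact h ⟨hx, hxy.trans hy⟩ ⟨hx.trans hxy, hy⟩ hxy

lemma Sys.lip (S : Sys φ φ1 φ2 α β κ c n0 d) {n : ℕ} (hn : n0 ≤ n) {u v x y : ℝ} (hu : α ≤ u) (hv : v ≤ β)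
    (hx : x ∈ Set.Icc u v) (hy : y ∈ Set.Icc u v) : |φ n x - φ n y| ≤ φ1 n v * (v - u) := by
  have huv : u ≤ v := hx.1.trans hx.2
  have hpos := S.pos1 n hn v ⟨hu.trans huv, hv⟩
  have h := (convex_Icc u v).norm_image_sub_le_of_norm_hasDerivWithin_le (f := φ n) (f' := φ1 n)
    (C := φ1 n v) (fun z _ => ((S.ph n).d1 z).hasDerivWithinAt) (fun z hz => by
      have hz0 := S.pos1 n hn z ⟨hu.trans hz.1, hz.2.trans hv⟩
      rw [Real.norm_eq_abs, abs_of_pos hz0]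
      exact S.monoOn hn (hu.trans hz.1) hz.2 hv) hy hx
  rw [Real.norm_eq_abs, Real.norm_eq_abs] at h
  refine h.trans ?_
  have : |x - y| ≤ v - u := by
    rw [abs_le]; constructor <;> linarith [hx.1, hx.2, hy.1, hy.2]
  gcongr

lemma geoK {κ : ℝ} (hk : 1 < κ) (a N : ℕ) :
    ∑ n ∈ Finset.Ico a (a + N), (κ ^ (a + N - n))⁻¹ ≤ 1 / (κ - 1) := by
  have h : ∀ N : ℕ, ∑ i ∈ Finset.range N, (κ⁻¹) ^ (i + 1) ≤ 1 / (κ - 1) - (κ⁻¹) ^ N / (κ - 1) := by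
    intro N
    have : κ - 1 ≠ 0 := by linarith
    have h0 : κ ≠ 0 := by linarith
    induction N with
    | zero => simp
    | succ N ih =>
      rw [Finset.sum_range_succ]
      have e : (κ⁻¹) ^ (N + 1) = (κ⁻¹) ^ N / (κ - 1) - (κ⁻¹) ^ (N + 1) / (κ - 1) := by
        rw [pow_succ]; field_simp
      linarith
  rw [Finset.sum_Ico_eq_sum_range]
  have e : ∑ k ∈ Finset.range (a + N - a), (κ ^ (a + N - (a + k)))⁻¹ = ∑ i ∈ Finset.range N, (κ⁻¹) ^ (i + 1) := by
    rw [← Finset.sum_range_reflect]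
    have : a + N - a = N := by omega
    rw [this]
    apply Finset.sum_congr rfl
    intro i hi
    rw [Finset.mem_range] at hi
    rw [← inv_pow]; congr 1; omega
  rw [e]
  have h1 := h N
  have : 0 ≤ (κ⁻¹) ^ N / (κ - 1) := by
    have : 0 < κ - 1 := by linarith
    positivity
  linarith

lemma Ub_osc (S : Sys φ φ1 φ2 α β κ c n0 d) (P : Pol p F cf d W σ2 Lp) {a b : ℕ} (ha : n0 ≤ a) (hab : a ≤ b)
    {K u v x y : ℝ} (hK : φ1 b v * (v - u) ≤ 6 * K) (hK0 : 0 < K) (hu : α ≤ u) (hv : v ≤ β)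
    (hx : x ∈ Set.Icc u v) (hy : y ∈ Set.Icc u v) :
    |Ub p φ (Finset.Ico a b) x - Ub p φ (Finset.Ico a b) y| ≤ Lp * (6 * K) * (1 / (κ - 1)) := by
  obtain ⟨N, rfl⟩ := Nat.exists_eq_add_of_le hab
  have huv : u ≤ v := hx.1.trans hx.2
  have hk := S.hk
  have hL0 := P.L0
  have hvm : v ∈ Set.Icc α β := ⟨hu.trans huv, hv⟩
  unfold Ub
  rw [← Finset.sum_sub_distrib]
  refine (Finset.abs_sum_le_sum_abs _ _).trans ?_
  calc ∑ n ∈ Finset.Ico a (a + N), |p (φ n x) - p (φ n y)|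
      ≤ ∑ n ∈ Finset.Ico a (a + N), Lp * (6 * K) * (κ ^ (a + N - n))⁻¹ := by
        apply Finset.sum_le_sum
        intro n hn
        rw [Finset.mem_Ico] at hn
        have h1 := S.lip (n := n) (by omega) hu hv hx hy
        have h2 := S.grow1 (n := n) (by omega) (a + N - n) hvm
        rw [show n + (a + N - n) = a + N by omega] at h2
        have hkp : 0 < κ ^ (a + N - n) := by positivity
        have h3 : φ1 n v * (v - u) ≤ 6 * K * (κ ^ (a + N - n))⁻¹ := by
          rw [← div_eq_mul_inv, le_div_iff₀ hkp]
          calc φ1 n v * (v - u) * κ ^ (a + N - n) = (κ ^ (a + N - n) * φ1 n v) * (v - u) := by ring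
            _ ≤ φ1 (a + N) v * (v - u) := by
              have : 0 ≤ v - u := by linarith
              gcongr
            _ ≤ _ := hK
        calc |p (φ n x) - p (φ n y)| ≤ Lp * |φ n x - φ n y| := P.lip _ _
          _ ≤ Lp * (6 * K * (κ ^ (a + N - n))⁻¹) := by gcongr; linarith
          _ = _ := by ring
    _ = Lp * (6 * K) * ∑ n ∈ Finset.Ico a (a + N), (κ ^ (a + N - n))⁻¹ := by rw [Finset.mul_sum]
    _ ≤ _ := by
      gcongr
      exact geoK hk a N

lemma restrict_split {u m v : ℝ} (h1 : u ≤ m) (h2 : m ≤ v) {X : Set ℝ} (hX : MeasurableSet X) :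
    (volume.restrict (Set.Icc u v)).real X =
      (volume.restrict (Set.Icc u m)).real X + (volume.restrict (Set.Icc m v)).real X := by
  have e : ∀ u v : ℝ, (volume.restrict (Set.Icc u v)).real X = volume.real (X ∩ Set.Ioc u v) := by
    intro u v
    rw [← restrict_Ioc_eq_restrict_Icc, measureReal_restrict_apply hX]
  rw [e, e, e, ← Set.Ioc_union_Ioc_eq_Ioc h1 h2, Set.inter_union_distrib_left]
  apply measureReal_union
  · exact (Set.Ioc_disjoint_Ioc_of_le le_rfl).mono Set.inter_subset_right Set.inter_subset_right
  · exact hX.inter measurableSet_Ioc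
  · exact ((measure_mono Set.inter_subset_right).trans_lt measure_Ioc_lt_top).ne
  · exact ((measure_mono Set.inter_subset_right).trans_lt measure_Ioc_lt_top).ne

lemma bisect (S : Sys φ φ1 φ2 α β κ c n0 d) {K : ℝ} (hK : 0 < K) {n : ℕ} (hn : n0 ≤ n)
    (hb : ∀ u v, α ≤ u → u < v → v ≤ β → 6 * K < φ1 n v * (v - u) → 2 * K ≤ φ1 n u * (v - u))
    {X Y : Set ℝ} (hX : MeasurableSet X) (hY : MeasurableSet Y) {q : ℝ}
    (hf : ∀ u v, α ≤ u → u < v → v ≤ β → K ≤ φ1 n u * (v - u) → φ1 n v * (v - u) ≤ 6 * K →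
      (volume.restrict (Set.Icc u v)).real X ≤ q * (volume.restrict (Set.Icc u v)).real Y)
    {u v : ℝ} (hu : α ≤ u) (huv : u < v) (hv : v ≤ β) (hKu : K ≤ φ1 n u * (v - u)) :
    (volume.restrict (Set.Icc u v)).real X ≤ q * (volume.restrict (Set.Icc u v)).real Y := by
  have main : ∀ k : ℕ, ∀ u v, α ≤ u → u < v → v ≤ β → K ≤ φ1 n u * (v - u) →
      φ1 n v * (v - u) ≤ 6 * K * 2 ^ k →
      (volume.restrict (Set.Icc u v)).real X ≤ q * (volume.restrict (Set.Icc u v)).real Y := by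
    intro k
    induction k with
    | zero => intro u v h1 h2 h3 h4 h5; exact hf u v h1 h2 h3 h4 (by simpa using h5)
    | succ k ih =>
      intro u v h1 h2 h3 h4 h5
      by_cases h6 : φ1 n v * (v - u) ≤ 6 * K
      · exact hf u v h1 h2 h3 h4 h6
      · have h7 := hb u v h1 h2 h3 (not_le.1 h6)
        have hm1 : u < (u + v) / 2 := by linarith
        have hm2 : (u + v) / 2 < v := by linarith
        rw [restrict_split hm1.le hm2.le hX, restrict_split hm1.le hm2.le hY, mul_add]
        have m1 := S.monoOn hn h1 hm1.le (hm2.le.trans h3)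
        have m2 := S.monoOn hn (h1.trans hm1.le) hm2.le h3
        have hd : 0 < (v - u) / 2 := by linarith
        have e1 : (u + v) / 2 - u = (v - u) / 2 := by ring
        have e2 : v - (u + v) / 2 = (v - u) / 2 := by ring
        have n1 := mul_le_mul_of_nonneg_right m1 hd.le
        have n2 := mul_le_mul_of_nonneg_right m2 hd.le
        rw [pow_succ] at h5
        apply add_le_add
        · apply ih _ _ h1 hm1 (hm2.le.trans h3) <;> rw [e1] <;> linarith
        · apply ih _ _ (h1.trans hm1.le) hm2 h3 <;> rw [e2] <;> linarith
  obtain ⟨k, hk⟩ := pow_unbounded_of_one_lt (φ1 n v * (v - u) / (6 * K)) (one_lt_two (α := ℝ))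
  refine main k u v hu huv hv hKu ?_
  rw [div_lt_iff₀ (by positivity)] at hk
  linarith

lemma lb_ind (S : Sys φ φ1 φ2 α β κ c n0 d) (P : Pol p F cf d W σ2 Lp) {K : ℝ} (hK : 0 < K)
    {a : ℕ → ℕ} (ha : Monotone a) {r0 n1 : ℕ} (hr0 : ∀ r, r0 ≤ r → n0 ≤ a r ∧ n1 ≤ a r)
    (hb : ∀ n, n1 ≤ n → ∀ u v, α ≤ u → u < v → v ≤ β →
      6 * K < φ1 n v * (v - u) → 2 * K ≤ φ1 n u * (v - u))
    {z q : ℕ → ℝ} (hq1 : ∀ r, q r ≤ 1)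
    (hT : ∀ r, r0 ≤ r → ∀ u v, α ≤ u → u < v → v ≤ β → K ≤ φ1 (a r) u * (v - u) →
      q r * (v - u) ≤ (volume.restrict (Set.Icc u v)).real
        {x | z r ≤ Ub p φ (Finset.Ico (a r) (a (r + 1))) x})
    (n : ℕ) : ∀ r, r0 ≤ r → ∀ u v, α ≤ u → u < v → v ≤ β → K ≤ φ1 (a r) u * (v - u) →
      (volume.restrict (Set.Icc u v)).real {x | ∀ i, i < n →
        Ub p φ (Finset.Ico (a (r + i)) (a (r + i + 1))) x < z (r + i) - Lp * (6 * K) * (1 / (κ - 1))}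
      ≤ (∏ i ∈ Finset.range n, (1 - q (r + i))) * (v - u) := by
  have vol : ∀ u v : ℝ, u < v → (volume.restrict (Set.Icc u v)).real Set.univ = v - u := by
    intro u v huv
    rw [measureReal_restrict_apply MeasurableSet.univ, Set.univ_inter, Real.volume_real_Icc_of_le huv.le]
  set C := Lp * (6 * K) * (1 / (κ - 1)) with hC
  have meas : ∀ r n, MeasurableSet {x | ∀ i, i < n →
        Ub p φ (Finset.Ico (a (r + i)) (a (r + i + 1))) x < z (r + i) - C} := by
    intro r n
    have : {x | ∀ i, i < n → Ub p φ (Finset.Ico (a (r + i)) (a (r + i + 1))) x < z (r + i) - C} =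
        ⋂ i, ⋂ (_ : i < n), {x | Ub p φ (Finset.Ico (a (r + i)) (a (r + i + 1))) x < z (r + i) - C} := by
      ext x; simp
    rw [this]
    exact MeasurableSet.iInter fun i => MeasurableSet.iInter fun _ =>
      (isOpen_lt (Ub_cont S P _) continuous_const).measurableSet
  induction n with
  | zero =>
    intro r hr u v h1 h2 h3 h4
    have h := measureReal_mono (μ := volume.restrict (Set.Icc u v)) (Set.subset_univ {x | ∀ i, i < 0 →
        Ub p φ (Finset.Ico (a (r + i)) (a (r + i + 1))) x < z (r + i) - C})
    rw [vol u v h2] at h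
    simpa using h
  | succ n ih =>
    intro r hr u v h1 h2 h3 h4
    have hY : MeasurableSet {x | Ub p φ (Finset.Ico (a r) (a (r + 1))) x < z r} :=
      (isOpen_lt (Ub_cont S P _) continuous_const).measurableSet
    have hpn : 0 ≤ ∏ i ∈ Finset.range n, (1 - q (r + 1 + i)) :=
      Finset.prod_nonneg fun i _ => by linarith [hq1 (r + 1 + i)]
    have hKu : K ≤ φ1 (a (r + 1)) u * (v - u) := by
      refine h4.trans ?_
      have := S.mono1 (hr0 r hr).1 (ha (Nat.le_succ r)) (x := u) ⟨h1, h2.le.trans h3⟩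
      have : 0 < v - u := by linarith
      gcongr
    have key := bisect S hK (hr0 (r + 1) (by omega)).1 (hb _ (hr0 (r + 1) (by omega)).2) (meas r (n + 1)) hY
      (q := ∏ i ∈ Finset.range n, (1 - q (r + 1 + i))) (fun u v h1 h2 h3 h4 h5 => by
        by_cases hex : ∃ x ∈ Set.Icc u v, z r ≤ Ub p φ (Finset.Ico (a r) (a (r + 1))) x
        · obtain ⟨x, hx, hzx⟩ := hex
          have : (volume.restrict (Set.Icc u v)).real {x | ∀ i, i < n + 1 →
              Ub p φ (Finset.Ico (a (r + i)) (a (r + i + 1))) x < z (r + i) - C} = 0 := by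
            rw [measureReal_restrict_apply (meas r (n + 1))]
            convert measureReal_empty
            ext y
            simp only [Set.mem_inter_iff, Set.mem_ofPred_eq, Set.mem_empty_iff_false, iff_false, not_and]
            intro hy hyJ
            have hy0 := hy 0 (by omega)
            have ho := Ub_osc S P (hr0 r hr).1 (ha (Nat.le_succ r)) h5 hK h1 h3 hx hyJ
            rw [← hC] at ho
            simp only [add_zero] at hy0
            have := le_abs_self (Ub p φ (Finset.Ico (a r) (a (r + 1))) x - Ub p φ (Finset.Ico (a r) (a (r + 1))) y)
            simp only [Nat.succ_eq_add_one] at ho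
            linarith
          rw [this]; positivity
        · push Not at hex
          have e : (volume.restrict (Set.Icc u v)).real {x | Ub p φ (Finset.Ico (a r) (a (r + 1))) x < z r} = v - u := by
            rw [← vol u v h2, measureReal_restrict_apply hY, measureReal_restrict_apply MeasurableSet.univ]
            congr 1
            ext x
            simp only [Set.mem_inter_iff, Set.mem_ofPred_eq, Set.mem_univ, true_and, and_iff_right_iff_imp]
            exact hex x
          rw [e]
          refine le_trans (measureReal_mono ?_) (ih (r + 1) (by omega) u v h1 h2 h3 h4)
          intro x hx i hi
          have := hx (i + 1) (by omega)
          rwa [show r + (i + 1) = r + 1 + i by omega] at this) h1 h2 h3 hKu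
    refine key.trans ?_
    rw [Finset.prod_range_succ']
    have hTr := hT r hr u v h1 h2 h3 h4
    have hcompl : (volume.restrict (Set.Icc u v)).real {x | Ub p φ (Finset.Ico (a r) (a (r + 1))) x < z r} =
        (v - u) - (volume.restrict (Set.Icc u v)).real {x | z r ≤ Ub p φ (Finset.Ico (a r) (a (r + 1))) x} := by
      have := measureReal_add_measureReal_compl (μ := volume.restrict (Set.Icc u v)) hY
      rw [vol u v h2] at this
      have e : {x | Ub p φ (Finset.Ico (a r) (a (r + 1))) x < z r}ᶜ = {x | z r ≤ Ub p φ (Finset.Ico (a r) (a (r + 1))) x} := by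
        ext x; simp
      rw [e] at this
      linarith
    rw [hcompl, mul_assoc]
    have e3 : ∏ k ∈ Finset.range n, (1 - q (r + (k + 1))) = ∏ i ∈ Finset.range n, (1 - q (r + 1 + i)) := by
      apply Finset.prod_congr rfl; intro i _; rw [show r + (i + 1) = r + 1 + i by omega]
    rw [e3]
    apply mul_le_mul_of_nonneg_left _ hpn
    simp only [add_zero]
    linarith
end

section
variable {φ φ1 φ2 : ℕ → ℝ → ℝ} {α β κ c : ℝ} {n0 d : ℕ}
variable {p : ℝ → ℝ} {F : Finset ℤ} {cf : ℤ → ℂ} {W σ2 Lp : ℝ}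

lemma lb_ae (S : Sys φ φ1 φ2 α β κ c n0 d) (P : Pol p F cf d W σ2 Lp) {K : ℝ} (hK : 0 < K)
    {a : ℕ → ℕ} (ha : Monotone a) (hat : Tendsto a atTop atTop) {r0 : ℕ}
    {z q : ℕ → ℝ} (hq0 : ∀ r, 0 ≤ q r) (hq1 : ∀ r, q r ≤ 1) (hqs : ¬ Summable q)
    (hT : ∀ r, r0 ≤ r → ∀ u v, α ≤ u → u < v → v ≤ β → K ≤ φ1 (a r) u * (v - u) →
      q r * (v - u) ≤ (volume.restrict (Set.Icc u v)).real
        {x | z r ≤ Ub p φ (Finset.Ico (a r) (a (r + 1))) x}) :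
    ∀ᵐ x ∂(volume.restrict (Set.Icc α β)), ∃ᶠ r in atTop,
      z r - Lp * (6 * K) * (1 / (κ - 1)) ≤ Ub p φ (Finset.Ico (a r) (a (r + 1))) x := by
  obtain ⟨n1, hb⟩ := S.bis K hK
  set C := Lp * (6 * K) * (1 / (κ - 1)) with hC
  have hαm : α ∈ Set.Icc α β := ⟨le_rfl, S.hab.le⟩
  have hφ0 := S.pos1 n0 le_rfl α hαm
  have hba : 0 < β - α := by linarith [S.hab]
  obtain ⟨k, hk⟩ := pow_unbounded_of_one_lt (K / (φ1 n0 α * (β - α))) S.hk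
  rw [div_lt_iff₀ (by positivity)] at hk
  obtain ⟨R, hR⟩ := eventually_atTop.1 (hat.eventually_ge_atTop (n0 + n1 + k))
  have hKr : ∀ r, R ≤ r → K ≤ φ1 (a r) α * (β - α) := by
    intro r hr
    have h1 := S.mono1 (m := n0 + k) (n := a r) (by omega) (by have := hR r hr; omega) hαm
    have h2 := S.grow1 le_rfl k hαm
    calc K ≤ κ ^ k * φ1 n0 α * (β - α) := by linarith
      _ ≤ _ := by gcongr; exact h2.trans h1
  have hz : ∀ r, r0 + R ≤ r → ∀ᵐ x ∂(volume.restrict (Set.Icc α β)), ¬ ∀ i,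
      Ub p φ (Finset.Ico (a (r + i)) (a (r + i + 1))) x < z (r + i) - C := by
    intro r hr
    have hle : ∀ n, (volume.restrict (Set.Icc α β)).real {x | ∀ i,
        Ub p φ (Finset.Ico (a (r + i)) (a (r + i + 1))) x < z (r + i) - C} ≤
        Real.exp (- ∑ i ∈ Finset.range n, q (i + r)) * (β - α) := by
      intro n
      have h := lb_ind S P hK ha (r0 := r0 + R) (n1 := n1)
        (fun r hr => by have := hR r (by omega); constructor <;> omega) hb hq1
        (fun r hr => hT r (by omega)) n r hr α β le_rfl S.hab le_rfl (hKr r (by omega))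
      refine (measureReal_mono ?_).trans (h.trans ?_)
      · intro x hx i _
        exact hx i
      · gcongr
        rw [← Finset.sum_neg_distrib, Real.exp_sum]
        apply Finset.prod_le_prod
        · intro i _; linarith [hq1 (r + i)]
        · intro i _
          rw [add_comm i r]
          linarith [Real.add_one_le_exp (-q (r + i))]
    have hlim : Tendsto (fun n => Real.exp (- ∑ i ∈ Finset.range n, q (i + r)) * (β - α)) atTop (nhds (0 * (β - α))) := by
      apply Tendsto.mul_const
      apply Real.tendsto_exp_neg_atTop_nhds_zero.comp
      apply (not_summable_iff_tendsto_nat_atTop_of_nonneg (fun i => hq0 _)).1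
      rwa [summable_nat_add_iff r]
    rw [zero_mul] at hlim
    have h0 := le_antisymm (ge_of_tendsto' hlim hle) measureReal_nonneg
    rw [measureReal_eq_zero_iff] at h0
    rw [ae_iff]
    simp only [not_not]
    exact h0
  have hz2 : ∀ᵐ x ∂(volume.restrict (Set.Icc α β)), ∀ r, r0 + R ≤ r → ¬ ∀ i,
      Ub p φ (Finset.Ico (a (r + i)) (a (r + i + 1))) x < z (r + i) - C := by
    rw [ae_all_iff]; intro r
    by_cases hr : r0 + R ≤ r
    · filter_upwards [hz r hr] with x hx _ using hx
    · exact Eventually.of_forall fun x h => absurd h hr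
  filter_upwards [hz2] with x hx
  rw [frequently_atTop]
  intro r
  have h := hx (r0 + R + r) (by omega)
  push Not at h
  obtain ⟨i, hi⟩ := h
  exact ⟨r0 + R + r + i, by omega, hi⟩

lemma Nk_succ (k : ℕ) : Nk (k + 1) = Nk k + ((k + 1) ^ 4 + (k + 1)) := by
  unfold Nk; rw [Finset.sum_Icc_succ_top (by omega)]

lemma Nk_mono : StrictMono Nk := strictMono_nat_of_lt_succ fun k => by
  rw [Nk_succ]; omega

lemma Nk_lo (k : ℕ) : k ^ 5 ≤ 5 * Nk k := by
  induction k with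
  | zero => simp
  | succ k ih =>
    rw [Nk_succ]
    have : (k + 1) ^ 5 = k ^ 5 + (5 * k ^ 4 + 10 * k ^ 3 + 10 * k ^ 2 + 5 * k + 1) := by ring
    have : 5 * (Nk k + ((k + 1) ^ 4 + (k + 1))) = 5 * Nk k + (5 * k ^ 4 + 20 * k ^ 3 + 30 * k ^ 2 + 25 * k + 10) := by ring
    omega

lemma Nk_hi (k : ℕ) : Nk k ≤ 2 * k ^ 5 := by
  induction k with
  | zero => simp [Nk]
  | succ k ih =>
    rw [Nk_succ]
    have : 2 * (k + 1) ^ 5 = 2 * k ^ 5 + (10 * k ^ 4 + 20 * k ^ 3 + 20 * k ^ 2 + 10 * k + 2) := by ring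
    have : (k + 1) ^ 4 + (k + 1) = k ^ 4 + 4 * k ^ 3 + 6 * k ^ 2 + 5 * k + 2 := by ring
    omega

lemma not_summable_exp_log {ρ : ℝ} (hρ : ρ < 1) :
    ¬ Summable fun r : ℕ => min 1 (1 / 8 * Real.exp (-ρ * Real.log r)) := by
  intro h
  have h2 : Summable fun r : ℕ => 1 / 8 * (1 / (r:ℝ)) := by
    refine Summable.of_norm_bounded_eventually_nat h ?_
    filter_upwards [eventually_ge_atTop 1] with r hr
    have hr' : (1:ℝ) ≤ r := by exact_mod_cast hr
    have hr0 : (0:ℝ) < r := by linarith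
    rw [Real.norm_of_nonneg (by positivity)]
    apply le_min
    · have : 1 / (r:ℝ) ≤ 1 := by rw [div_le_one hr0]; exact hr'
      linarith
    · gcongr
      calc 1 / (r:ℝ) = Real.exp (- Real.log r) := by rw [Real.exp_neg, Real.exp_log hr0, one_div]
        _ ≤ _ := by
          apply Real.exp_le_exp.2
          have := Real.log_nonneg hr'
          nlinarith
  rw [summable_mul_left_iff (by norm_num)] at h2
  exact Real.not_summable_one_div_natCast h2

lemma pp_upper {Θ : ℕ} (hΘ : 2 ≤ Θ) : ∃ C : ℝ, ∀ᶠ r : ℕ in atTop,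
    plog (plog (Nk (Θ ^ (r + 1)))) ≤ Real.log r + C := by
  have hΘ' : (2:ℝ) ≤ Θ := by exact_mod_cast hΘ
  have hlT : 0 < Real.log Θ := Real.log_pos (by linarith)
  set D := 1 + (Real.log 2 + 10 * Real.log Θ) with hD
  have hl2 : 0 < Real.log 2 := Real.log_pos (by norm_num)
  have hD1 : 1 ≤ D := by linarith
  refine ⟨Real.log D + 1, ?_⟩
  filter_upwards [eventually_ge_atTop 1] with r hr
  have hr' : (1:ℝ) ≤ r := by exact_mod_cast hr
  have hl := Real.log_nonneg hr'
  have hM1 : 0 < (Nk (Θ ^ (r + 1)) : ℝ) := by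
    have h1 := Nk_lo (Θ ^ (r + 1))
    have h2 : 0 < (Θ ^ (r + 1)) ^ 5 := by positivity
    exact_mod_cast (by omega : 0 < Nk (Θ ^ (r + 1)))
  have hM : (Nk (Θ ^ (r + 1)) : ℝ) ≤ 2 * ((Θ:ℝ) ^ (r + 1)) ^ 5 := by exact_mod_cast Nk_hi (Θ ^ (r + 1))
  have h3 := Real.log_le_log hM1 hM
  rw [Real.log_mul (by norm_num) (by positivity), Real.log_pow, Real.log_pow] at h3
  have h4 : plog (Nk (Θ ^ (r + 1))) ≤ D * r := by
    unfold plog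
    apply max_le
    · nlinarith
    · push_cast at h3
      have : Real.log Θ ≤ Real.log Θ * r := by nlinarith
      have : Real.log 2 ≤ Real.log 2 * r := by nlinarith
      rw [hD]; nlinarith
  have h5 : Real.log (plog (Nk (Θ ^ (r + 1)))) ≤ Real.log D + Real.log r := by
    rw [← Real.log_mul (by linarith) (by linarith)]
    exact Real.log_le_log (zero_lt_one.trans_le (plog_pos _)) h4
  have hlD := Real.log_nonneg hD1
  exact max_le (by linarith) (by linarith)

lemma lower1 (S : Sys φ φ1 φ2 α β κ c n0 d) (P : Pol p F cf d W σ2 Lp) (hn0 : 1 ≤ n0) {y : ℝ} (hy : 0 < y)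
    (hy2 : y ^ 2 < 2 * σ2) : ∀ᵐ x ∂(volume.restrict (Set.Icc α β)), ∃ᶠ k : ℕ in atTop,
      y * √(Nk k * plog (plog (Nk k))) ≤ |Ub p φ (Finset.Icc 1 (Nk k)) x| := by
  have hσ : 0 < σ2 := by nlinarith
  obtain ⟨y1, hyy1, hy1⟩ : ∃ y1, y < y1 ∧ y1 < √(2 * σ2) :=
    exists_between (by rw [Real.lt_sqrt hy.le]; exact hy2)
  have hy10 : 0 < y1 := hy.trans hyy1
  have hy12 : y1 ^ 2 < 2 * σ2 := by rwa [Real.lt_sqrt hy10.le] at hy1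
  set y' := √(2 * σ2) + 1 with hy'
  have hy'0 : 0 < y' := by positivity
  have hy'2 : 2 * σ2 < y' ^ 2 := by
    have := Real.sq_sqrt (show 0 ≤ 2 * σ2 by linarith)
    have := Real.sqrt_nonneg (2 * σ2)
    nlinarith
  obtain ⟨δ, hδ0, hδ1, hδ⟩ : ∃ δ : ℝ, 0 < δ ∧ δ < 1 ∧ y < y1 * (1 - δ) - y' * √δ - δ := by
    have hc : Continuous fun δ : ℝ => y1 * (1 - δ) - y' * √δ - δ := by fun_prop
    have h1 : ∀ᶠ δ : ℝ in nhds 0, y < y1 * (1 - δ) - y' * √δ - δ := by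
      apply hc.continuousAt.eventually_const_lt (u := y)
      simpa using hyy1
    have h2 : ∀ᶠ δ : ℝ in nhds 0, δ < 1 := eventually_lt_nhds one_pos
    have h3 : ∃ᶠ δ : ℝ in nhds 0, 0 < δ := (eventually_mem_nhdsWithin (a := (0:ℝ)) (s := Set.Ioi 0)).frequently.filter_mono nhdsWithin_le_nhds
    obtain ⟨δ, a1, a2, a3⟩ := (h3.and_eventually (h2.and h1)).exists
    exact ⟨δ, a1, a2, a3⟩
  obtain ⟨Θ, hΘδ⟩ := exists_nat_gt (20 / δ)
  rw [div_lt_iff₀ hδ0] at hΘδ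
  have hΘ20 : (20:ℝ) < Θ := by
    have : (0:ℝ) ≤ Θ := by positivity
    nlinarith
  have hΘ20n : 20 < Θ := by exact_mod_cast hΘ20
  obtain ⟨ρ, K, L1, r1, hρ0, hρ1, hK, hL1, hr1, hT2⟩ := T2 S P hσ hy10 hy12
  set M : ℕ → ℕ := fun r => Nk (Θ ^ r) with hM
  have hMmono : StrictMono M := Nk_mono.comp (pow_right_strictMono₀ (by omega))
  set a : ℕ → ℕ := fun r => M r + 1 with ha
  have hamono : Monotone a := fun i j h => by
    have := hMmono.monotone h
    simp only [ha]; omega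
  have hMt : Tendsto M atTop atTop := hMmono.tendsto_atTop
  have hat : Tendsto a atTop atTop := tendsto_atTop_mono (fun r => Nat.le_succ (M r)) hMt
  -- ratio
  have hrat : ∀ r, (M r : ℝ) ≤ δ / 2 * M (r + 1) := by
    intro r
    have h1 : (M r : ℝ) ≤ 2 * ((Θ:ℝ) ^ r) ^ 5 := by exact_mod_cast Nk_hi (Θ ^ r)
    have h2 : ((Θ:ℝ) ^ (r + 1)) ^ 5 ≤ 5 * M (r + 1) := by exact_mod_cast Nk_lo (Θ ^ (r + 1))
    have h3 : ((Θ:ℝ) ^ (r + 1)) ^ 5 = ((Θ:ℝ) ^ r) ^ 5 * Θ ^ 5 := by ring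
    have h4 : (Θ:ℝ) ≤ Θ ^ 5 := le_self_pow₀ (by linarith) (by norm_num)
    have h5 : (0:ℝ) ≤ ((Θ:ℝ) ^ r) ^ 5 := by positivity
    have h6 : ((Θ:ℝ) ^ r) ^ 5 * Θ ≤ 5 * M (r + 1) := by
      rw [h3] at h2
      exact (mul_le_mul_of_nonneg_left h4 h5).trans h2
    have h7 : ((Θ:ℝ) ^ r) ^ 5 * 20 ≤ ((Θ:ℝ) ^ r) ^ 5 * (Θ * δ) := mul_le_mul_of_nonneg_left hΘδ.le h5
    have h8 := mul_le_mul_of_nonneg_left h6 hδ0.le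
    linarith
  have hNr : ∀ r, a r + (M (r + 1) - M r) = a (r + 1) := by
    intro r
    have := hMmono.monotone (Nat.le_succ r)
    simp only [ha, Nat.succ_eq_add_one] at *
    omega
  have hNc : ∀ r, ((M (r + 1) - M r : ℕ) : ℝ) = M (r + 1) - M r := by
    intro r
    exact Nat.cast_sub (hMmono.monotone (Nat.le_succ r))
  have hNbig : ∀ r, (1 - δ) * M (r + 1) ≤ ((M (r + 1) - M r : ℕ) : ℝ) := by
    intro r
    rw [hNc]
    have := hrat r
    have : (0:ℝ) ≤ M (r + 1) := by positivity
    nlinarith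
  have hN2 : ∀ r, (2:ℝ) ^ r ≤ ((M (r + 1) - M r : ℕ) : ℝ) := by
    intro r
    rw [hNc]
    have h0 := hrat r
    have h2 : ((Θ:ℝ) ^ (r + 1)) ^ 5 ≤ 5 * M (r + 1) := by exact_mod_cast Nk_lo (Θ ^ (r + 1))
    have h3 : (2:ℝ) ^ r * 10 ≤ ((Θ:ℝ) ^ (r + 1)) ^ 5 := by
      calc (2:ℝ) ^ r * 10 ≤ (Θ:ℝ) ^ r * Θ := by gcongr <;> linarith
        _ = (Θ:ℝ) ^ (r + 1) := by rw [pow_succ]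
        _ ≤ _ := le_self_pow₀ (one_le_pow₀ (by linarith)) (by norm_num)
    have : (0:ℝ) ≤ M (r + 1) := by positivity
    nlinarith
  obtain ⟨r0, hr0⟩ := eventually_atTop.1 ((ev_log L1).and ((ev_log2 (A := r1 ^ 2) (by positivity)).and
    (hat.eventually_ge_atTop n0)))
  have hLB := lb_ae S P hK hamono hat (r0 := r0)
    (z := fun r => y1 * √((M (r + 1) - M r : ℕ) * Real.log r))
    (q := fun r => min 1 (1 / 8 * Real.exp (-ρ * Real.log r))) (fun r => by positivity) (fun r => min_le_left _ _)
    (not_summable_exp_log hρ1) (fun r hr u v hu huv hv hKu => by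
      obtain ⟨e1, e2, e3⟩ := hr0 r hr
      set N := M (r + 1) - M r with hN
      have hNp : (0:ℝ) < N := lt_of_lt_of_le (by positivity) (hN2 r)
      set L := Real.log r with hL
      have hLp : 0 < L := by linarith
      have e : √(L / N) ^ 2 = L / N := Real.sq_sqrt (by positivity)
      have h := hT2 (a r) e3 N √(L / N) (Real.sqrt_pos.2 (by positivity)) (by
        rw [Real.sqrt_le_left hr1.le, div_le_iff₀ hNp]
        exact e2.trans (by gcongr; exact hN2 r)) (by
        rw [e, div_mul_cancel₀ _ hNp.ne']; exact e1) u v hu huv.le hv hKu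
      rw [e, div_mul_cancel₀ _ hNp.ne'] at h
      have e2 : √(L / N) * N = √(N * L) := by
        rw [eq_comm, Real.sqrt_eq_iff_mul_self_eq (by positivity) (by positivity)]
        have : √(L / N) * N * (√(L / N) * N) = √(L / N) ^ 2 * N * N := by ring
        rw [this, e]; field_simp
      rw [e2, hNr r] at h
      refine le_trans ?_ h
      have : min 1 (1 / 8 * Real.exp (-ρ * L)) ≤ 1 / 8 * Real.exp (-ρ * L) := min_le_right _ _
      have hvu : 0 ≤ v - u := by linarith
      calc min 1 (1 / 8 * Real.exp (-ρ * L)) * (v - u) ≤ (1 / 8 * Real.exp (-ρ * L)) * (v - u) := by gcongr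
        _ = _ := by ring)
  set C := Lp * (6 * K) * (1 / (κ - 1)) with hC
  obtain ⟨Cp, hCp⟩ := pp_upper (Θ := Θ) (by omega)
  have hMt1 : Tendsto (fun r => M (r + 1)) atTop atTop := hMt.comp (tendsto_add_atTop_nat 1)
  have hQt := plogplog_tendsto.comp hMt1
  filter_upwards [hLB, upper1 S P hn0 hy'0 hy'2] with x hx hux
  have hux2 := hMt.eventually hux
  have hev := hx.and_eventually (hux2.and (hCp.and ((hQt.eventually_ge_atTop (Cp / δ)).and
    ((tendsto_natCast_atTop_atTop.comp hMt1).eventually_ge_atTop ((C / δ) ^ 2)))))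
  have htt : Tendsto (fun r : ℕ => Θ ^ (r + 1)) atTop atTop :=
    (tendsto_pow_atTop_atTop_of_one_lt (by omega)).comp (tendsto_add_atTop_nat 1)
  refine htt.frequently (hev.mono ?_)
  rintro r ⟨f1, f2, f3, f4, f5⟩
  simp only [Function.comp] at f4 f5
  change _ ≤ |Ub p φ (Finset.Icc 1 (M (r + 1))) x|
  change y * √(M (r + 1) * plog (plog (M (r + 1)))) ≤ _
  change plog (plog (M (r + 1))) ≤ _ at f3
  have hQ1 : 1 ≤ plog (plog (M (r + 1))) := plogplog_pos _
  have hQle : plog (plog (M r)) ≤ plog (plog (M (r + 1))) ∨ M r = 0 := by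
    rcases Nat.eq_zero_or_pos (M r) with h | h
    · exact Or.inr h
    · left
      apply plogplog_mono (by exact_mod_cast h)
      exact_mod_cast hMmono.monotone (Nat.le_succ r)
  have hMQ : (M r : ℝ) * plog (plog (M r)) ≤ δ * (M (r + 1) * plog (plog (M (r + 1)))) := by
    have hm0 : (0:ℝ) ≤ M (r + 1) * plog (plog (M (r + 1))) := by positivity
    rcases hQle with h | h
    · calc (M r : ℝ) * plog (plog (M r)) ≤ (δ / 2 * M (r + 1)) * plog (plog (M (r + 1))) := by
            have := plogplog_pos (M r)
            gcongr
            exact hrat r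
        _ ≤ _ := by nlinarith
    · rw [h]; simp only [Nat.cast_zero, zero_mul]; positivity
  set Q := plog (plog (M (r + 1))) with hQ
  have hQ0 : 0 < Q := by linarith
  set MM := (M (r + 1) : ℝ) with hMM
  have hMM0 : 0 ≤ MM := by positivity
  set T := √(MM * Q) with hTdef
  have g1 : √(M r * plog (plog (M r))) ≤ √δ * T := by
    rw [hTdef, ← Real.sqrt_mul hδ0.le]
    exact Real.sqrt_le_sqrt hMQ
  have g2 : (1 - δ) * T ≤ √((M (r + 1) - M r : ℕ) * Real.log r) := by
    apply Real.le_sqrt_of_sq_le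
    rw [mul_pow, hTdef, Real.sq_sqrt (by positivity)]
    have hl : (1 - δ) * Q ≤ Real.log r := by
      rw [div_le_iff₀ hδ0] at f4
      linarith
    have h1δ : 0 < 1 - δ := by linarith
    calc (1 - δ) ^ 2 * (MM * Q) = ((1 - δ) * MM) * ((1 - δ) * Q) := by ring
      _ ≤ _ := by
        gcongr
        exact hNbig r
  have g3 : C ≤ δ * T := by
    have : C / δ ≤ T := by
      apply Real.le_sqrt_of_sq_le
      have : MM * 1 ≤ MM * Q := by gcongr
      linarith
    rw [div_le_iff₀ hδ0] at this
    linarith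
  have hsum : Ub p φ (Finset.Icc 1 (M (r + 1))) x = Ub p φ (Finset.Icc 1 (M r)) x + Ub p φ (Finset.Ico (a r) (a (r + 1))) x := by
    rw [← Finset.Ico_add_one_right_eq_Icc, ← Finset.Ico_add_one_right_eq_Icc]
    exact Ub_Ico p φ (Nat.le_add_left 1 (M r)) (hamono (Nat.le_succ r)) x
  have hT0 : 0 ≤ T := Real.sqrt_nonneg _
  have q1 := mul_le_mul_of_nonneg_left g1 hy'0.le
  have q2 := mul_le_mul_of_nonneg_left g2 hy10.le
  have q3 := mul_le_mul_of_nonneg_right hδ.le hT0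
  have q4 := neg_abs_le (Ub p φ (Finset.Icc 1 (M r)) x)
  have q5 := le_abs_self (Ub p φ (Finset.Icc 1 (M (r + 1))) x)
  rw [hsum] at q5 ⊢
  linarith
end

lemma ee_int (m : ℤ) : ee m = 1 := by
  unfold ee
  rw [Complex.exp_eq_one_iff]
  exact ⟨m, by push_cast; ring⟩

lemma ee_integral {A B : ℝ} (hAB : B - A = 1) (m : ℤ) :
    ∫ x in A..B, ee (m * x) = if m = 0 then 1 else 0 := by
  split_ifs with h
  · subst h
    have : ∀ x : ℝ, ee (((0:ℤ):ℝ) * x) = 1 := fun x => by simp [ee_zero]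
    simp only [this, intervalIntegral.integral_const, hAB, one_smul]
  · set cc : ℂ := 2 * Real.pi * m * Complex.I with hcc
    have hc0 : cc ≠ 0 := by
      have hm : (m:ℂ) ≠ 0 := by exact_mod_cast h
      have hp : (Real.pi : ℂ) ≠ 0 := by exact_mod_cast Real.pi_ne_zero
      rw [hcc]; simp [hm]
    have e : ∀ x : ℝ, ee (m * x) = Complex.exp (cc * x) := by
      intro x; unfold ee; congr 1; rw [hcc]; push_cast; ring
    have e1 : ee (m * B) = ee (m * A) := by
      have : (m:ℝ) * B = m * A + m := by rw [show B = A + 1 by linarith]; ring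
      rw [this, ee_add, ee_int, mul_one]
    simp only [e] at e1 ⊢
    rw [integral_exp_mul_complex hc0, e1, sub_self, zero_div]

noncomputable def cfz (a b : ℕ → ℝ) (j : ℤ) : ℂ :=
  ((a j.natAbs : ℂ) - (j.sign : ℂ) * Complex.I * (b j.natAbs : ℂ)) / 2

def Fz (d : ℕ) : Finset ℤ :=
  (Finset.Icc 1 d).image (fun n : ℕ => (n:ℤ)) ∪ (Finset.Icc 1 d).image (fun n : ℕ => -(n:ℤ))

lemma Fz_sum (d : ℕ) (f : ℤ → ℂ) : ∑ j ∈ Fz d, f j = ∑ n ∈ Finset.Icc 1 d, (f n + f (-n)) := by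
  unfold Fz
  rw [Finset.sum_union, Finset.sum_image, Finset.sum_image, Finset.sum_add_distrib]
  · intro x _ y _ h; simpa using h
  · intro x _ y _ h; simpa using h
  · rw [Finset.disjoint_left]
    intro j hj hj2
    rw [Finset.mem_image] at hj hj2
    obtain ⟨x, hx, rfl⟩ := hj
    obtain ⟨y, hy, hxy⟩ := hj2
    rw [Finset.mem_Icc] at hx hy
    omega

lemma Fz_mem (d : ℕ) : ∀ j ∈ Fz d, j ≠ 0 ∧ |j| ≤ d ∧ -j ∈ Fz d := by
  intro j hj
  unfold Fz at hj ⊢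
  simp only [Finset.mem_union, Finset.mem_image, Finset.mem_Icc] at hj ⊢
  rcases hj with ⟨x, hx, rfl⟩ | ⟨x, hx, rfl⟩
  · refine ⟨by omega, by rw [abs_le]; constructor <;> omega, Or.inr ⟨x, hx, rfl⟩⟩
  · refine ⟨by omega, by rw [abs_le]; constructor <;> omega, Or.inl ⟨x, hx, by simp⟩⟩

lemma rep_term (a b : ℕ → ℝ) (n : ℕ) (hn : 1 ≤ n) (x : ℝ) :
    cfz a b n * ee (((n:ℤ):ℝ) * x) + cfz a b (-n) * ee (((-(n:ℤ) : ℤ):ℝ) * x) =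
    ((a n * Real.cos (2 * Real.pi * n * x) + b n * Real.sin (2 * Real.pi * n * x) : ℝ) : ℂ) := by
  have hs : (n:ℤ).sign = 1 := Int.sign_eq_one_of_pos (by omega)
  unfold cfz ee
  rw [Int.sign_neg, hs]
  simp only [Int.natAbs_neg, Int.natAbs_natCast]
  push_cast
  have e1 : 2 * (Real.pi:ℂ) * (n * x) * Complex.I = (2 * Real.pi * n * x) * Complex.I := by ring
  have e2 : 2 * (Real.pi:ℂ) * (-n * x) * Complex.I = (-(2 * Real.pi * n * x)) * Complex.I := by ring
  rw [e1, e2, Complex.exp_mul_I, Complex.exp_mul_I, Complex.cos_neg, Complex.sin_neg]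
  linear_combination (-(b n : ℂ) * Complex.sin (2 * Real.pi * n * x)) * Complex.I_sq

lemma mkPol {A B : ℝ} (hAB : B - A = 1) (d : ℕ) (a b : ℕ → ℝ) (p : ℝ → ℝ)
    (hp : p = fun x => ∑ j ∈ Finset.Icc 1 d,
        (a j * Real.cos (2 * Real.pi * j * x) + b j * Real.sin (2 * Real.pi * j * x))) :
    ∃ W Lp : ℝ, Pol p (Fz d) (cfz a b) d W (∫ x in A..B, (p x) ^ 2) Lp := by
  have hAB' : A ≤ B := by linarith
  have hcont : Continuous p := by rw [hp]; fun_prop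
  have rep : ∀ x, (p x : ℂ) = ∑ j ∈ Fz d, cfz a b j * ee (j * x) := by
    intro x
    rw [Fz_sum, hp]
    simp only [Complex.ofReal_sum]
    apply Finset.sum_congr rfl
    intro n hn
    rw [Finset.mem_Icc] at hn
    exact (rep_term a b n hn.1 x).symm
  set W := ∑ j ∈ Fz d, ‖cfz a b j‖ + 1 with hW
  have hs0 : 0 ≤ ∑ j ∈ Fz d, ‖cfz a b j‖ := Finset.sum_nonneg fun _ _ => norm_nonneg _
  have bd : ∀ x, |p x| ≤ W := by
    intro x
    rw [← Real.norm_eq_abs, ← Complex.norm_real, rep]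
    refine (norm_sum_le _ _).trans ?_
    simp only [norm_mul, ee_norm, mul_one]
    linarith
  refine ⟨W, ∑ j ∈ Finset.Icc 1 d, (|a j| + |b j|) * (2 * Real.pi * j), rep, Fz_mem d, by linarith, by linarith,
    ?_, intervalIntegral.integral_nonneg hAB' fun x _ => sq_nonneg _, ?_, bd, ?_, ?_, hcont⟩
  · have h1 : ((∫ x in A..B, (p x) ^ 2 : ℝ) : ℂ) =
        ∑ i ∈ Fz d, ∑ j ∈ Fz d, cfz a b i * cfz a b j * (if i + j = 0 then 1 else 0) := by
      rw [← intervalIntegral.integral_ofReal]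
      have h2 : ∀ x : ℝ, (((p x) ^ 2 : ℝ) : ℂ) =
          ∑ i ∈ Fz d, ∑ j ∈ Fz d, cfz a b i * cfz a b j * ee (((i + j : ℤ) : ℝ) * x) := by
        intro x
        push_cast
        rw [sq, rep, Finset.sum_mul_sum]
        apply Finset.sum_congr rfl; intro i _
        apply Finset.sum_congr rfl; intro j _
        rw [add_mul, ee_add]; ring
      simp only [h2]
      have hc : ∀ i j : ℤ, Continuous fun x : ℝ => cfz a b i * cfz a b j * ee (((i + j : ℤ) : ℝ) * x) := by
        intro i j
        exact continuous_const.mul (ee_cont.comp (by fun_prop))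
      rw [intervalIntegral.integral_finsetSum]
      · apply Finset.sum_congr rfl; intro i _
        rw [intervalIntegral.integral_finsetSum]
        · apply Finset.sum_congr rfl; intro j _
          rw [intervalIntegral.integral_const_mul, ee_integral hAB]
        · intro j _; exact (hc i j).intervalIntegrable _ _
      · intro i _
        exact (continuous_finsetSum _ fun j _ => hc i j).intervalIntegrable _ _
    rw [h1]
    apply Finset.sum_congr rfl; intro i hi
    rw [Finset.sum_eq_single (-i)]
    · simp
    · intro j _ hj
      rw [if_neg (by omega), mul_zero]
    · intro h; exact absurd (Fz_mem d i hi).2.2 h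
  · have h := intervalIntegral.norm_integral_le_of_norm_le_const (a := A) (b := B) (f := fun x => (p x) ^ 2) (C := W ^ 2)
      (fun x _ => by
        rw [norm_pow, Real.norm_eq_abs]
        exact pow_le_pow_left₀ (abs_nonneg _) (bd x) 2)
    rw [hAB, abs_one, mul_one] at h
    exact (le_abs_self _).trans h
  · have := Real.pi_pos
    positivity
  · intro x y
    rw [hp]
    simp only
    rw [← Finset.sum_sub_distrib, Finset.sum_mul]
    refine (Finset.abs_sum_le_sum_abs _ _).trans (Finset.sum_le_sum fun j _ => ?_)
    have hpi := Real.pi_pos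
    have e : |2 * Real.pi * j * x - 2 * Real.pi * j * y| = 2 * Real.pi * j * |x - y| := by
      rw [← mul_sub, abs_mul, abs_of_nonneg (by positivity)]
    have c1 := Real.abs_cos_sub_cos_le (2 * Real.pi * j * x) (2 * Real.pi * j * y)
    have c2 := Real.abs_sin_sub_sin_le (2 * Real.pi * j * x) (2 * Real.pi * j * y)
    rw [e] at c1 c2
    have e2 : a j * Real.cos (2 * Real.pi * j * x) + b j * Real.sin (2 * Real.pi * j * x) -
      (a j * Real.cos (2 * Real.pi * j * y) + b j * Real.sin (2 * Real.pi * j * y)) =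
      a j * (Real.cos (2 * Real.pi * j * x) - Real.cos (2 * Real.pi * j * y)) +
      b j * (Real.sin (2 * Real.pi * j * x) - Real.sin (2 * Real.pi * j * y)) := by ring
    rw [e2]
    refine (abs_add_le _ _).trans ?_
    rw [abs_mul, abs_mul]
    have m1 := mul_le_mul_of_nonneg_left c1 (abs_nonneg (a j))
    have m2 := mul_le_mul_of_nonneg_left c2 (abs_nonneg (b j))
    linarith

noncomputable def ph0 (ξ : ℝ) (s : ℕ → ℕ) (n : ℕ) (x : ℝ) : ℝ := ξ * x ^ s n
noncomputable def ph1 (ξ : ℝ) (s : ℕ → ℕ) (n : ℕ) (x : ℝ) : ℝ := ξ * ((s n : ℝ) * x ^ (s n - 1))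
noncomputable def ph2 (ξ : ℝ) (s : ℕ → ℕ) (n : ℕ) (x : ℝ) : ℝ :=
  ξ * ((s n : ℝ) * (((s n - 1 : ℕ) : ℝ) * x ^ (s n - 1 - 1)))

lemma pow_step {κ x : ℝ} (hκ : 1 ≤ κ) (hx : κ ≤ x) {k l : ℕ} (h : k < l) : κ * x ^ k ≤ x ^ l := by
  have h1 : 1 ≤ x := hκ.trans hx
  calc κ * x ^ k ≤ x * x ^ k := by gcongr
    _ = x ^ (k + 1) := by rw [pow_succ, mul_comm]
    _ ≤ x ^ l := pow_le_pow_right₀ h1 h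

lemma bis_pow {ξ κ : ℝ} (hξ : 0 < ξ) (hκ : 1 < κ) {s : ℕ → ℕ} (hmono : StrictMono s) (K : ℝ) (hK : 0 < K) :
    ∃ n1 : ℕ, ∀ n, n1 ≤ n → ∀ u v, κ ≤ u → u < v →
    6 * K < ph1 ξ s n v * (v - u) → 2 * K ≤ ph1 ξ s n u * (v - u) := by
  obtain ⟨k, hk⟩ := pow_unbounded_of_one_lt (2 * K / ξ) hκ
  refine ⟨k + 1, fun n hn u v hu huv h => ?_⟩
  have hsn : n ≤ s n := hmono.le_apply
  have hu0 : 0 < u := by linarith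
  have hvu : 0 < v - u := by linarith
  unfold ph1 at *
  have hs1 : (1:ℝ) ≤ s n := by exact_mod_cast (by omega : 1 ≤ s n)
  by_cases hc : (s n : ℝ) * (v - u) ≤ 1
  · have h1 : v ^ (s n - 1) ≤ 3 * u ^ (s n - 1) := by
      have h2 : v ≤ u * Real.exp (v - u) := by
        have := Real.add_one_le_exp (v - u)
        have : u * (v - u + 1) ≤ u * Real.exp (v - u) := by gcongr
        nlinarith
      have h3 : v ^ (s n - 1) ≤ (u * Real.exp (v - u)) ^ (s n - 1) := by
        have : 0 ≤ v := by linarith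
        gcongr
      rw [mul_pow, ← Real.exp_nat_mul] at h3
      have h4 : Real.exp (((s n - 1 : ℕ) : ℝ) * (v - u)) ≤ 3 := by
        have : ((s n - 1 : ℕ) : ℝ) ≤ s n := by exact_mod_cast Nat.sub_le _ _
        have h5 : ((s n - 1 : ℕ) : ℝ) * (v - u) ≤ 1 := le_trans (by gcongr) hc
        have := Real.exp_le_exp.2 h5
        have := Real.exp_one_lt_d9
        linarith
      calc v ^ (s n - 1) ≤ _ := h3
        _ ≤ u ^ (s n - 1) * 3 := by gcongr
        _ = _ := by ring
    have : ξ * ((s n:ℝ) * v ^ (s n - 1)) * (v - u) ≤ ξ * ((s n:ℝ) * (3 * u ^ (s n - 1))) * (v - u) := by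
      gcongr
    linarith
  · rw [div_lt_iff₀ hξ] at hk
    have h1 : κ ^ k ≤ u ^ (s n - 1) :=
      calc κ ^ k ≤ κ ^ (s n - 1) := pow_le_pow_right₀ hκ.le (by omega)
        _ ≤ _ := by gcongr
    have h2 : ξ * u ^ (s n - 1) * 1 ≤ ξ * u ^ (s n - 1) * ((s n:ℝ) * (v - u)) := by
      have := not_le.1 hc
      gcongr
    have h3 := mul_le_mul_of_nonneg_left h1 hξ.le
    linarith

lemma mkSys {ξ : ℝ} (hξ : 0 < ξ) {s : ℕ → ℕ} (hmono : StrictMono s) (d : ℕ) {x0 : ℝ} (hx0 : 1 < x0)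
    (hgood : ∀ i j : ℤ, i ≠ 0 → ∀ h : ℕ, 1 ≤ h → (i:ℝ) * x0 ^ h + j ≠ 0) :
    ∃ α β κ c : ℝ, ∃ n0 : ℕ, α < x0 ∧ x0 < β ∧ 1 ≤ n0 ∧ Sys (ph0 ξ s) (ph1 ξ s) (ph2 ξ s) α β κ c n0 d := by
  obtain ⟨κ, hκ1, hκx⟩ := exists_between hx0
  obtain ⟨H, hH⟩ := pow_unbounded_of_one_lt (2 * (d:ℝ)) hκ1
  set E := (Finset.Icc (-(d:ℤ)) d).erase 0 with hE
  have hEm : ∀ i : ℤ, i ≠ 0 → |i| ≤ d → i ∈ E := by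
    intro i h1 h2
    rw [abs_le] at h2
    rw [hE, Finset.mem_erase, Finset.mem_Icc]; exact ⟨h1, h2⟩
  set T := (Finset.Icc 1 H) ×ˢ (E ×ˢ E) with hT
  have hTm : ∀ t ∈ T, 1 ≤ t.1 ∧ t.2.1 ≠ 0 := by
    intro t ht
    rw [hT, Finset.mem_product, Finset.mem_product, Finset.mem_Icc, hE, Finset.mem_erase] at ht
    exact ⟨ht.1.1, ht.2.1.1⟩
  have hpos : ∀ t ∈ T, 0 < |(t.2.1:ℝ) + t.2.2 * (x0 ^ t.1)⁻¹| := by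
    intro t ht
    obtain ⟨h1, h2⟩ := hTm t ht
    rw [abs_pos]
    intro h0
    apply hgood t.2.1 t.2.2 h2 t.1 h1
    have hp : (x0 ^ t.1) ≠ 0 := by positivity
    have := congrArg (· * x0 ^ t.1) h0
    simp only [zero_mul, add_mul, mul_assoc, inv_mul_cancel₀ hp, mul_one] at this
    exact this
  obtain ⟨c, hc0, hc2, hcT⟩ : ∃ c : ℝ, 0 < c ∧ c < 1 / 2 ∧ ∀ t ∈ T, 2 * c < |(t.2.1:ℝ) + t.2.2 * (x0 ^ t.1)⁻¹| := by
    have h1 : ∀ᶠ c : ℝ in nhds 0, ∀ t ∈ T, 2 * c < |(t.2.1:ℝ) + t.2.2 * (x0 ^ t.1)⁻¹| := by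
      rw [Filter.eventually_all_finset]
      intro t ht
      have hc : Continuous fun c : ℝ => 2 * c := by fun_prop
      apply hc.continuousAt.eventually_lt_const
      simpa using hpos t ht
    have h2 : ∀ᶠ c : ℝ in nhds 0, c < 1 / 2 := eventually_lt_nhds (by norm_num)
    have h3 : ∃ᶠ c : ℝ in nhds 0, 0 < c := (eventually_mem_nhdsWithin (a := (0:ℝ)) (s := Set.Ioi 0)).frequently.filter_mono nhdsWithin_le_nhds
    exact (h3.and_eventually (h2.and h1)).exists
  have hnear : ∀ᶠ x in nhds x0, κ < x ∧ ∀ t ∈ T, 2 * c < |(t.2.1:ℝ) + t.2.2 * (x ^ t.1)⁻¹| := by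
    refine (eventually_gt_nhds hκx).and ?_
    rw [Filter.eventually_all_finset]
    intro t ht
    have hcont : ContinuousAt (fun x : ℝ => |(t.2.1:ℝ) + t.2.2 * (x ^ t.1)⁻¹|) x0 := by
      have : x0 ^ t.1 ≠ 0 := by positivity
      fun_prop (disch := assumption)
    exact hcont.eventually_const_lt (hcT t ht)
  obtain ⟨ε, hε, hball⟩ := Metric.eventually_nhds_iff.1 hnear
  have hnb : ∀ x ∈ Set.Icc (x0 - ε / 2) (x0 + ε / 2), κ < x ∧ ∀ t ∈ T, 2 * c < |(t.2.1:ℝ) + t.2.2 * (x ^ t.1)⁻¹| := by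
    intro x hx
    apply hball
    rw [Real.dist_eq, abs_lt]
    constructor <;> linarith [hx.1, hx.2]
  obtain ⟨n2, hn2⟩ := exists_nat_gt (d * H / c)
  rw [div_lt_iff₀ hc0] at hn2
  refine ⟨x0 - ε / 2, x0 + ε / 2, κ, c, n2 + 2, by linarith, by linarith, by omega, ?_⟩
  have hsn : ∀ n, n ≤ s n := fun n => hmono.le_apply
  have hss : ∀ n, s n < s (n + 1) := fun n => hmono (Nat.lt_succ_self n)
  refine ⟨by linarith, hκ1, hc0, by linarith, ?_, ?_, ?_, ?_, ?_, ?_, ?_⟩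
  · intro n
    refine ⟨fun x => ?_, fun x => ?_, ?_⟩
    · exact (hasDerivAt_pow (s n) x).const_mul ξ
    · exact ((hasDerivAt_pow (s n - 1) x).const_mul (s n : ℝ)).const_mul ξ
    · unfold ph2; fun_prop
  · intro n hn x hx
    have hx1 := (hnb x hx).1
    have : 0 < x := by linarith
    have : (0:ℝ) < s n := by exact_mod_cast (by have := hsn n; omega : 0 < s n)
    unfold ph1; positivity
  · intro n hn x hx
    have hx1 := (hnb x hx).1
    have : 0 < x := by linarith
    unfold ph2; positivity
  · intro n hn x hx
    have hx1 := (hnb x hx).1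
    have hx0 : 0 < x := by linarith
    have h1 := hsn n
    have h2 := hss n
    have h3 := pow_step hκ1.le hx1.le (show s n - 1 < s (n + 1) - 1 by omega)
    have h4 : (s n : ℝ) ≤ s (n + 1) := by exact_mod_cast h2.le
    unfold ph1
    calc κ * (ξ * ((s n:ℝ) * x ^ (s n - 1))) = ξ * ((s n:ℝ) * (κ * x ^ (s n - 1))) := by ring
      _ ≤ _ := by gcongr
  · intro n hn x hx
    have hx1 := (hnb x hx).1
    have hx0 : 0 < x := by linarith
    have h1 := hsn n
    have h2 := hss n
    have h3 := pow_step hκ1.le hx1.le (show s n - 1 - 1 < s (n + 1) - 1 - 1 by omega)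
    have h4 : (s n : ℝ) ≤ s (n + 1) := by exact_mod_cast h2.le
    have h5 : ((s n - 1 : ℕ) : ℝ) ≤ (s (n + 1) - 1 : ℕ) := by exact_mod_cast (by omega)
    unfold ph2
    calc κ * (ξ * ((s n:ℝ) * (((s n - 1 : ℕ) : ℝ) * x ^ (s n - 1 - 1))))
        = ξ * ((s n:ℝ) * (((s n - 1 : ℕ) : ℝ) * (κ * x ^ (s n - 1 - 1)))) := by ring
      _ ≤ _ := by gcongr
  · intro m n hm hmn i j hi hj hid hjd x hx
    obtain ⟨hx1, hxT⟩ := hnb x hx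
    have hx0 : 0 < x := by linarith
    have h1 := hsn m
    have h2 := hmono hmn
    have h6 := hsn n
    obtain ⟨h, hh⟩ := Nat.exists_eq_add_of_lt h2
    set g := h + 1 with hg
    have hsng : s n = s m + g := by omega
    have hsn0 : (0:ℝ) < s n := by exact_mod_cast (by omega : 0 < s n)
    have hxg : 0 < x ^ g := by positivity
    set t : ℝ := s m / s n with ht
    set w : ℝ := (x ^ g)⁻¹ with hw
    have hw0 : 0 < w := by positivity
    have e : ph1 ξ s m x = ph1 ξ s n x * (t * w) := by
      unfold ph1
      have : x ^ (s n - 1) = x ^ (s m - 1) * x ^ g := by rw [← pow_add]; congr 1; omega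
      rw [this, ht, hw]; field_simp
    have hf0 : 0 < ph1 ξ s n x := by unfold ph1; positivity
    have e2 : (i:ℝ) * ph1 ξ s n x + j * ph1 ξ s m x = ph1 ξ s n x * (i + j * (t * w)) := by rw [e]; ring
    rw [e2, abs_mul, abs_of_pos hf0, mul_comm c]
    apply mul_le_mul_of_nonneg_left _ hf0.le
    have hj1 : |(j:ℝ)| ≤ d := int_abs_le hjd
    have hd0 : (0:ℝ) ≤ d := by positivity
    have ht0 : 0 ≤ t := by positivity
    have hsnc : (s n : ℝ) = s m + g := by exact_mod_cast hsng
    have ht1 : 1 - t = g / s n := by rw [ht, eq_div_iff hsn0.ne', sub_mul, div_mul_cancel₀ _ hsn0.ne', hsnc]; ring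
    have ht1' : t ≤ 1 := by
      have : 0 ≤ (g:ℝ) / s n := by positivity
      linarith
    have hxg1 : 1 ≤ x ^ g := one_le_pow₀ (by linarith)
    have hw1 : w ≤ 1 := inv_le_one_of_one_le₀ hxg1
    by_cases hgH : g ≤ H
    · have k1 := hxT (g, i, j) (by
        rw [hT, Finset.mem_product, Finset.mem_product, Finset.mem_Icc]
        exact ⟨⟨by omega, hgH⟩, hEm i hi hid, hEm j hj hjd⟩)
      simp only at k1
      have k2 : |(j:ℝ) * w * (1 - t)| ≤ c := by
        rw [abs_mul, abs_mul, abs_of_pos hw0, abs_of_nonneg (by linarith : 0 ≤ 1 - t)]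
        calc |(j:ℝ)| * w * (1 - t) ≤ d * 1 * (1 - t) := by
              have : 0 ≤ 1 - t := by linarith
              gcongr
          _ = d * g / s n := by rw [ht1]; ring
          _ ≤ c := by
            rw [div_le_iff₀ hsn0]
            have a1 : (n2:ℝ) ≤ s n := by exact_mod_cast (by omega)
            have a2 : (g:ℝ) ≤ H := by exact_mod_cast hgH
            have a3 : (d:ℝ) * g ≤ d * H := by gcongr
            have a4 : (n2:ℝ) * c ≤ s n * c := by gcongr
            linarith
      have k3 : (i:ℝ) + j * (t * w) = (i + j * w) - j * w * (1 - t) := by ring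
      rw [k3]
      have k4 := abs_sub_abs_le_abs_sub ((i:ℝ) + j * w) (j * w * (1 - t))
      linarith
    · have k1 : |(j:ℝ) * (t * w)| ≤ 1 / 2 := by
        rw [abs_mul, abs_of_nonneg (by positivity : 0 ≤ t * w)]
        have k2 : κ ^ H ≤ x ^ g :=
          calc κ ^ H ≤ κ ^ g := pow_le_pow_right₀ hκ1.le (by omega)
            _ ≤ x ^ g := by gcongr
        calc |(j:ℝ)| * (t * w) ≤ d * (1 * w) := by gcongr
          _ = d / x ^ g := by rw [hw]; ring
          _ ≤ 1 / 2 := by rw [div_le_iff₀ hxg]; linarith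
      have k3 := int_abs_one hi
      have k4 := abs_sub_abs_le_abs_sub (i:ℝ) (-(j * (t * w)))
      rw [abs_neg, sub_neg_eq_add] at k4
      linarith
  · intro K hK
    obtain ⟨n1, hn1⟩ := bis_pow hξ hκ1 hmono K hK
    refine ⟨n1, fun n hn u v hu huv hv h => hn1 n hn u v ?_ huv h⟩
    exact (hnb u ⟨hu, huv.le.trans hv⟩).1.le

lemma bad_countable : {x : ℝ | 1 < x ∧ ∃ i j : ℤ, i ≠ 0 ∧ ∃ h : ℕ, 1 ≤ h ∧ (i:ℝ) * x ^ h + j = 0}.Countable := by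
  have e : {x : ℝ | 1 < x ∧ ∃ i j : ℤ, i ≠ 0 ∧ ∃ h : ℕ, 1 ≤ h ∧ (i:ℝ) * x ^ h + j = 0} ⊆
      ⋃ t : ℤ × ℤ × ℕ, {x : ℝ | 1 < x ∧ t.1 ≠ 0 ∧ 1 ≤ t.2.2 ∧ (t.1:ℝ) * x ^ t.2.2 + t.2.1 = 0} := by
    rintro x ⟨h1, i, j, hi, h, hh, hx⟩
    rw [Set.mem_iUnion]
    exact ⟨(i, j, h), h1, hi, hh, hx⟩
  refine Set.Countable.mono e (Set.countable_iUnion fun t => Set.Subsingleton.countable ?_)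
  rintro x ⟨a1, a2, a3, a4⟩ y ⟨b1, b2, b3, b4⟩
  have ht : (t.1:ℝ) ≠ 0 := by exact_mod_cast a2
  have : x ^ t.2.2 = y ^ t.2.2 := mul_left_cancel₀ ht (by linarith)
  exact (pow_left_inj₀ (by linarith) (by linarith) (by omega)).1 this

lemma limsup_crit {h : ℕ → ℝ} {c : ℝ} (hup : ∀ m : ℕ, ∀ᶠ k in atTop, h k ≤ c + 1 / ((m:ℝ) + 1))
    (hlo : ∀ m : ℕ, ∃ᶠ k in atTop, c - 1 / ((m:ℝ) + 1) ≤ h k) : atTop.limsup h = c := by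
  have hm : ∀ ε : ℝ, 0 < ε → ∃ m : ℕ, 1 / ((m:ℝ) + 1) < ε := fun ε hε => exists_nat_one_div_lt hε
  have hb : IsBoundedUnder (· ≤ ·) atTop h := ⟨_, (hup 0)⟩
  have hcb : IsCoboundedUnder (· ≤ ·) atTop h := IsCoboundedUnder.of_frequently_ge (hlo 0)
  apply le_antisymm
  · apply le_of_forall_pos_le_add
    intro ε hε
    obtain ⟨m, hm⟩ := hm ε hε
    exact (limsup_le_of_le hcb (hup m)).trans (by linarith)
  · apply le_of_forall_pos_le_add
    intro ε hε
    obtain ⟨m, hm⟩ := hm ε hε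
    have := le_limsup_of_frequently_le (hlo m) hb
    linarith

lemma Nk_tendsto : Tendsto Nk atTop atTop := Nk_mono.tendsto_atTop

lemma local_lil {φ φ1 φ2 : ℕ → ℝ → ℝ} {α β κ c : ℝ} {n0 d : ℕ} {p : ℝ → ℝ} {F : Finset ℤ} {cf : ℤ → ℂ}
    {W σ2 Lp : ℝ} (S : Sys φ φ1 φ2 α β κ c n0 d) (P : Pol p F cf d W σ2 Lp) (hn0 : 1 ≤ n0) :
    ∀ᵐ x ∂(volume.restrict (Set.Icc α β)), Filter.atTop.limsup (fun k : ℕ =>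
      |Ub p φ (Finset.Icc 1 (Nk k)) x| / √((Nk k : ℝ) * plog (plog (Nk k)))) = √(2 * σ2) := by
  have hs0 := P.s0
  have hc0 : 0 ≤ √(2 * σ2) := Real.sqrt_nonneg _
  have hc2 : √(2 * σ2) ^ 2 = 2 * σ2 := Real.sq_sqrt (by linarith)
  have hm0 : ∀ m : ℕ, (0:ℝ) < 1 / ((m:ℝ) + 1) := fun m => by positivity
  have hup : ∀ᵐ x ∂(volume.restrict (Set.Icc α β)), ∀ m : ℕ, ∀ᶠ N : ℕ in atTop,
      |Ub p φ (Finset.Icc 1 N) x| ≤ (√(2 * σ2) + 1 / ((m:ℝ) + 1)) * √(N * plog (plog N)) := by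
    rw [ae_all_iff]
    intro m
    have := hm0 m
    exact upper1 S P hn0 (by linarith) (by nlinarith)
  have hlo : ∀ᵐ x ∂(volume.restrict (Set.Icc α β)), ∀ m : ℕ, 0 < √(2 * σ2) - 1 / ((m:ℝ) + 1) →
      ∃ᶠ k : ℕ in atTop, (√(2 * σ2) - 1 / ((m:ℝ) + 1)) * √(Nk k * plog (plog (Nk k))) ≤
        |Ub p φ (Finset.Icc 1 (Nk k)) x| := by
    rw [ae_all_iff]
    intro m
    by_cases h : 0 < √(2 * σ2) - 1 / ((m:ℝ) + 1)
    · have := hm0 m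
      filter_upwards [lower1 S P hn0 h (by nlinarith)] with x hx _ using hx
    · exact Eventually.of_forall fun x h' => absurd h' h
  filter_upwards [hup, hlo] with x hxu hxl
  apply limsup_crit
  · intro m
    filter_upwards [Nk_tendsto.eventually (hxu m)] with k hk
    have := hm0 m
    exact div_le_of_le_mul₀ (Real.sqrt_nonneg _) (by linarith) hk
  · intro m
    by_cases h : 0 < √(2 * σ2) - 1 / ((m:ℝ) + 1)
    · refine ((hxl m h).and_eventually (Nk_tendsto.eventually_ge_atTop 1)).mono ?_
      rintro k ⟨hk, hk1⟩
      have h1 : (0:ℝ) < Nk k := by exact_mod_cast hk1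
      have h2 := plogplog_pos (Nk k)
      rw [le_div_iff₀ (Real.sqrt_pos.2 (by positivity))]
      exact hk
    · refine (Eventually.of_forall fun k => ?_).frequently
      have : 0 ≤ |Ub p φ (Finset.Icc 1 (Nk k)) x| / √((Nk k : ℝ) * plog (plog (Nk k))) := by positivity
      linarith

theorem stmt15 (ξ A B : ℝ) (hξ : 0 < ξ) (hA : 1 < A) (hAB : B - A = 1)
    (s : ℕ → ℕ) (hmono : StrictMono s) (hpos : ∀ n, 1 ≤ n → 1 ≤ s n)
    (d : ℕ) (a b : ℕ → ℝ) (p : ℝ → ℝ)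
    (hp : p = fun x => ∑ j ∈ Finset.Icc 1 d,
        (a j * Real.cos (2 * Real.pi * j * x) + b j * Real.sin (2 * Real.pi * j * x)))
    (hint : (∫ x in (0:ℝ)..1, p x) = 0) :
    ∀ᵐ x : ℝ ∂volume, x ∈ Set.Icc A B →
      Filter.atTop.limsup (fun k : ℕ =>
          |∑ n ∈ Finset.Icc 1 (Nk k), p (ξ * x ^ s n)| /
            Real.sqrt ((Nk k : ℝ) * plog (plog (Nk k)))) =
        Real.sqrt 2 * fnorm A B p := by
  obtain ⟨W, Lp, P⟩ := mkPol hAB d a b p hp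
  set bad := {x : ℝ | 1 < x ∧ ∃ i j : ℤ, i ≠ 0 ∧ ∃ h : ℕ, 1 ≤ h ∧ (i:ℝ) * x ^ h + j = 0} with hbad
  have hb0 : volume bad = 0 := bad_countable.measure_zero volume
  have hbae : ∀ᵐ x : ℝ ∂volume, x ∉ bad := by
    rw [ae_iff]; simpa using hb0
  have key : ∀ᵐ x : ℝ ∂volume, (1 < x ∧ x ∉ bad) →
      Filter.atTop.limsup (fun k : ℕ =>
          |∑ n ∈ Finset.Icc 1 (Nk k), p (ξ * x ^ s n)| /
            Real.sqrt ((Nk k : ℝ) * plog (plog (Nk k)))) =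
        Real.sqrt 2 * fnorm A B p := by
    rw [ae_iff]
    apply measure_null_of_locally_null
    intro x0 hx0
    rw [Set.mem_ofPred_eq, Classical.not_imp] at hx0
    obtain ⟨⟨h1, h2⟩, -⟩ := hx0
    obtain ⟨α, β, κ, c, n0, hα, hβ, hn0, S⟩ := mkSys hξ hmono d h1 (fun i j hi h hh h0 =>
      h2 ⟨h1, i, j, hi, h, hh, h0⟩)
    have hL := local_lil S P hn0
    rw [ae_restrict_iff' measurableSet_Icc, ae_iff] at hL
    refine ⟨_, inter_mem_nhdsWithin _ (Icc_mem_nhds hα hβ), measure_mono_null ?_ hL⟩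
    rintro x ⟨hx1, hx2⟩
    rw [Set.mem_ofPred_eq, Classical.not_imp] at hx1 ⊢
    refine ⟨hx2, fun hlim => hx1.2 ?_⟩
    rw [fnorm, ← Real.sqrt_mul (by norm_num)]
    exact hlim
  filter_upwards [key, hbae] with x hx hxb hxA
  exact hx ⟨by linarith [hxA.1], hxb⟩
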